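/- Let G be an s-bridgeless signed graph with negativeness ε_N(G) > 0, vertex set V and edge set E. Then SCC(G) ≤ |E| + 3|V| + z₁, where z₁ = min{ (2/3)|E| + (4/3)ε_N(G) − 7 , |V| + 2ε_N(G) − 8 }. -/

import Mathlib

open scoped Classical

noncomputable section

/-- A signed (multi)graph: a finite multigraph (loops and multiple edges allowed)
together with a sign on each edge (`neg e = true` means `e` is negative). -/
structure SignedMultigraph where
  V : Type
  E : Type
  [fintypeV : Fintype V]
  [fintypeE : Fintype E]
  ends : E → Sym2 V
  neg : E → Bool

attribute [instance] SignedMultigraph.fintypeV SignedMultigraph.fintypeE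

namespace SignedMultigraph

variable (G : SignedMultigraph)

/-- The vertices incident with at least one edge of `S`. -/
def support (S : Finset G.E) : Finset G.V :=
  Finset.univ.filter fun v => ∃ e ∈ S, v ∈ G.ends e

/-- Degree of `v` in the edge set `S`; loops count twice. -/
def degIn (S : Finset G.E) (v : G.V) : ℕ :=
  ∑ e ∈ S, (if G.ends e = Sym2.diag v then 2 else if v ∈ G.ends e then 1 else 0)

/-- `u` and `v` are joined by an edge of `S`. -/
def Adj (S : Finset G.E) (u v : G.V) : Prop := ∃ e ∈ S, G.ends e = s(u, v)

/-- Reachability using only edges of `S`. -/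
def Reach (S : Finset G.E) : G.V → G.V → Prop := Relation.ReflTransGen (G.Adj S)

/-- The subgraph with edge set `S` (and vertex set its support) is connected. -/
def ConnOn (S : Finset G.E) : Prop :=
  ∀ u ∈ G.support S, ∀ v ∈ G.support S, G.Reach S u v

/-- The whole signed graph is connected. -/
def Connected : Prop := Nonempty G.V ∧ ∀ u v : G.V, G.Reach Finset.univ u v

/-- The negative edges among `S`. -/
def negEdges (S : Finset G.E) : Finset G.E := S.filter fun e => G.neg e = true

/-- A circuit: a (nonempty) connected 2-regular subgraph, given by its edge set. -/
def IsCircuit (S : Finset G.E) : Prop :=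
  S.Nonempty ∧ G.ConnOn S ∧ ∀ v ∈ G.support S, G.degIn S v = 2

/-- A balanced circuit: a circuit with an even number of negative edges. -/
def IsBalancedCircuit (S : Finset G.E) : Prop :=
  G.IsCircuit S ∧ Even (G.negEdges S).card

/-- An unbalanced circuit: a circuit with an odd number of negative edges. -/
def IsUnbalancedCircuit (S : Finset G.E) : Prop :=
  G.IsCircuit S ∧ ¬ Even (G.negEdges S).card

/-- A short barbell: two unbalanced circuits meeting at exactly one vertex. -/
def IsShortBarbell (S : Finset G.E) : Prop :=
  ∃ C₁ C₂ : Finset G.E, G.IsUnbalancedCircuit C₁ ∧ G.IsUnbalancedCircuit C₂ ∧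
    Disjoint C₁ C₂ ∧ (G.support C₁ ∩ G.support C₂).card = 1 ∧ S = C₁ ∪ C₂

/-- A path with (distinct) ends `u` and `v`, given by its edge set. -/
def IsPath (P : Finset G.E) (u v : G.V) : Prop :=
  P.Nonempty ∧ G.ConnOn P ∧ u ≠ v ∧ u ∈ G.support P ∧ v ∈ G.support P ∧
    G.degIn P u = 1 ∧ G.degIn P v = 1 ∧
    ∀ w ∈ G.support P, w ≠ u → w ≠ v → G.degIn P w = 2

/-- A long barbell: two vertex-disjoint unbalanced circuits joined by a path
meeting the circuits only at its ends. -/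
def IsLongBarbell (S : Finset G.E) : Prop :=
  ∃ (C₁ C₂ P : Finset G.E) (u v : G.V),
    G.IsUnbalancedCircuit C₁ ∧ G.IsUnbalancedCircuit C₂ ∧
    Disjoint (G.support C₁) (G.support C₂) ∧
    G.IsPath P u v ∧
    G.support P ∩ G.support C₁ = {u} ∧ G.support P ∩ G.support C₂ = {v} ∧
    Disjoint P C₁ ∧ Disjoint P C₂ ∧
    S = C₁ ∪ C₂ ∪ P

/-- A signed circuit: a balanced circuit, a short barbell, or a long barbell. -/
def IsSignedCircuit (S : Finset G.E) : Prop :=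
  G.IsBalancedCircuit S ∨ G.IsShortBarbell S ∨ G.IsLongBarbell S

/-- The number of members of the family `F` containing the edge `e`. -/
def coverCount (F : Multiset (Finset G.E)) (e : G.E) : ℕ :=
  (F.filter fun S => e ∈ S).card

/-- The total length of the family `F`. -/
def coverLength (F : Multiset (Finset G.E)) : ℕ := (F.map Finset.card).sum

/-- A signed circuit cover: every edge is in at least one member. -/
def IsSignedCircuitCover (F : Multiset (Finset G.E)) : Prop :=
  (∀ S ∈ F, G.IsSignedCircuit S) ∧ ∀ e : G.E, 1 ≤ G.coverCount F e

/-- The length of a shortest signed circuit cover. -/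
def SCC : ℕ := sInf { n | ∃ F, G.IsSignedCircuitCover F ∧ G.coverLength F = n }

/-- Whether edge `e` has exactly one endpoint in the vertex set `A`. -/
def crossesB (A : Finset G.V) (e : G.E) : Bool :=
  Sym2.lift ⟨fun x y => Bool.xor (decide (x ∈ A)) (decide (y ∈ A)),
    fun x y => Bool.xor_comm _ _⟩ (G.ends e)

/-- Sign of `e` (`true` = negative) after switching at every vertex of `A`. -/
def negAfter (A : Finset G.V) (e : G.E) : Bool :=
  Bool.xor (G.neg e) (G.crossesB A e)

/-- Minimum number of negative edges in `S` over all switchings. -/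
def negOf (S : Finset G.E) : ℕ :=
  sInf { n | ∃ A : Finset G.V, (S.filter fun e => G.negAfter A e = true).card = n }

/-- The negativeness of `G`. -/
def negativeness : ℕ := G.negOf Finset.univ

/-- The edges of `S` with exactly one endpoint in `U`: the edge boundary `δ(U)` inside `S`. -/
def boundary (S : Finset G.E) (U : Finset G.V) : Finset G.E :=
  S.filter fun e => G.crossesB U e = true

/-- `b` is a bridge of the subgraph with edge set `S`. -/
def IsBridge (S : Finset G.E) (b : G.E) : Prop :=
  ∃ U : Finset G.V, G.boundary S U = {b}

/-- The subgraph with edge set `S` is bridgeless. -/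
def Bridgeless (S : Finset G.E) : Prop := ∀ b ∈ S, ¬ G.IsBridge S b

/-- `G` is 2-edge-connected. -/
def TwoEdgeConnected : Prop :=
  G.Connected ∧ ∀ b : G.E, ¬ G.IsBridge Finset.univ b

/-- Edges of `S` lying in the same component (of the subgraph with edge set `S`)
as the vertex `x`. -/
def compEdges (S : Finset G.E) (x : G.V) : Finset G.E :=
  S.filter fun e => ∃ u, u ∈ G.ends e ∧ G.Reach S x u

/-- A g-bridge: a bridge such that both components of `G - b` have even negativeness. -/
def IsGBridge (b : G.E) : Prop :=
  G.IsBridge Finset.univ b ∧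
    ∃ x y : G.V, G.ends b = s(x, y) ∧
      Even (G.negOf (G.compEdges (Finset.univ.erase b) x)) ∧
      Even (G.negOf (G.compEdges (Finset.univ.erase b) y))

/-- `G` has no g-bridge (in any of its components). -/
def GBridgeless : Prop := ∀ b : G.E, ¬ G.IsGBridge b

/-- Member of `B_g(G)`: a bridge such that at least one component of `G - b`
contains an odd number of negative edges. -/
def IsBgBridge (b : G.E) : Prop :=
  G.IsBridge Finset.univ b ∧
    ∃ x : G.V, x ∈ G.ends b ∧
      ¬ Even (G.negEdges (G.compEdges (Finset.univ.erase b) x)).card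

/-- Member of `B_s(G)`: a bridge such that each of the two components of `G - b`
contains a negative edge. -/
def IsSBridge (b : G.E) : Prop :=
  G.IsBridge Finset.univ b ∧
    ∃ x y : G.V, G.ends b = s(x, y) ∧
      (G.negEdges (G.compEdges (Finset.univ.erase b) x)).Nonempty ∧
      (G.negEdges (G.compEdges (Finset.univ.erase b) y)).Nonempty

/-- `G` is s-bridgeless: every edge lies in some signed circuit. -/
def SBridgeless : Prop := ∀ e : G.E, ∃ S : Finset G.E, G.IsSignedCircuit S ∧ e ∈ S

/-- `{e, f}` is a 2-edge-cut of `G`. -/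
def IsTwoEdgeCut (e f : G.E) : Prop :=
  e ≠ f ∧ ∃ U : Finset G.V, G.boundary Finset.univ U = {e, f}

/-- `S_G(e) = {e} ∪ {f : {e,f} is a 2-edge-cut of G}`. -/
def SSet (e : G.E) : Finset G.E :=
  insert e (Finset.univ.filter fun f => G.IsTwoEdgeCut e f)

/-- The edge set `R` spans an acyclic subgraph (every nonempty subset has a
vertex of degree one). -/
def AcyclicSet (R : Finset G.E) : Prop :=
  ∀ F ⊆ R, F.Nonempty → ∃ v : G.V, G.degIn F v = 1

/-- `T` is the edge set of a spanning tree of `G`. -/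
def IsSpanningTree (T : Finset G.E) : Prop :=
  G.AcyclicSet T ∧ Nonempty G.V ∧ ∀ u v : G.V, G.Reach T u v

/-- `G` is eulerian: connected with all degrees even. -/
def Eulerian : Prop :=
  G.Connected ∧ ∀ v : G.V, Even (G.degIn Finset.univ v)

/-- The edge set `S` spans an eulerian subgraph. -/
def IsEulerianSub (S : Finset G.E) : Prop :=
  S.Nonempty ∧ G.ConnOn S ∧ ∀ v ∈ G.support S, Even (G.degIn S v)

/-- The vertex class of `v` after contracting each member of `ℬ`. -/
def classOf (ℬ : Finset (Finset G.E)) (v : G.V) : Finset G.V :=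
  Finset.univ.filter fun u => u = v ∨ ∃ B ∈ ℬ, v ∈ G.support B ∧ u ∈ G.support B

/-- Degree, in edge set `F`, of the contracted class of `v`. -/
def classDeg (ℬ : Finset (Finset G.E)) (F : Finset G.E) (v : G.V) : ℕ :=
  ∑ u ∈ G.classOf ℬ v, G.degIn F u

/-- `ℬ` witnesses that the subgraph with edge set `S` is a generalized barbell:
`ℬ` is a family of vertex-disjoint eulerian subgraphs of `S`, the contraction
`S/(∪ℬ)` is acyclic, and for every vertex `x` of the contracted graph,
`|E_N(B_x)| ≡ |δ(V(B_x))| (mod 2)`. -/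
def GenBarbellWitness (S : Finset G.E) (ℬ : Finset (Finset G.E)) : Prop :=
  (∀ B ∈ ℬ, B ⊆ S ∧ G.IsEulerianSub B) ∧
  (∀ B₁ ∈ ℬ, ∀ B₂ ∈ ℬ, B₁ ≠ B₂ → Disjoint (G.support B₁) (G.support B₂)) ∧
  (∀ F ⊆ S \ ℬ.sup id, F.Nonempty → ∃ v : G.V, G.classDeg ℬ F v = 1) ∧
  (∀ B ∈ ℬ, (G.negEdges B).card ≡ (G.boundary S (G.support B)).card [MOD 2]) ∧
  (∀ v ∈ G.support S, (∀ B ∈ ℬ, v ∉ G.support B) → Even (G.boundary S {v}).card)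

/-- The subgraph with edge set `S` is a generalized barbell. -/
def IsGenBarbell (S : Finset G.E) : Prop := ∃ ℬ, G.GenBarbellWitness S ℬ

end SignedMultigraph

namespace SignedMultigraph

variable {G : SignedMultigraph}

/-! ### Incidence, degrees and parity -/

/-- The number of times the edge `e` is incident with the vertex `v`. -/
def inc (e : G.E) (v : G.V) : ℕ :=
  if G.ends e = Sym2.diag v then 2 else if v ∈ G.ends e then 1 else 0

lemma exists_ends (e : G.E) : ∃ x y, G.ends e = s(x, y) := by
  induction h : G.ends e with
  | _ x y => exact ⟨x, y, rfl⟩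

lemma inc_of_ends {e : G.E} {x y : G.V} (h : G.ends e = s(x, y)) (v : G.V) :
    inc e v = (if v = x then 1 else 0) + (if v = y then 1 else 0) := by
  unfold inc
  rw [h]
  have : Sym2.diag v = s(v, v) := rfl
  rw [this]
  simp only [Sym2.eq_iff, Sym2.mem_iff]
  by_cases h1 : v = x <;> by_cases h2 : v = y <;> simp_all [eq_comm]

lemma degIn_eq_sum (S : Finset G.E) (v : G.V) : G.degIn S v = ∑ e ∈ S, inc e v := rfl

lemma degIn_insert {S : Finset G.E} {e : G.E} (h : e ∉ S) (v : G.V) :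
    G.degIn (insert e S) v = inc e v + G.degIn S v := by
  simp only [degIn_eq_sum]; rw [Finset.sum_insert h]

lemma degIn_union {S T : Finset G.E} (h : Disjoint S T) (v : G.V) :
    G.degIn (S ∪ T) v = G.degIn S v + G.degIn T v := by
  simp only [degIn_eq_sum]; rw [Finset.sum_union h]

lemma degIn_mono {S T : Finset G.E} (h : S ⊆ T) (v : G.V) : G.degIn S v ≤ G.degIn T v :=
  Finset.sum_le_sum_of_subset h

lemma inc_pos_iff {e : G.E} {v : G.V} : 0 < inc e v ↔ v ∈ G.ends e := by
  obtain ⟨x, y, h⟩ := exists_ends e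
  rw [inc_of_ends h, h, Sym2.mem_iff]
  by_cases h1 : v = x <;> by_cases h2 : v = y <;> simp_all

lemma mem_support {S : Finset G.E} {v : G.V} :
    v ∈ G.support S ↔ ∃ e ∈ S, v ∈ G.ends e := by
  simp [support]

lemma degIn_pos_iff {S : Finset G.E} {v : G.V} : 0 < G.degIn S v ↔ v ∈ G.support S := by
  rw [mem_support, degIn_eq_sum, Nat.pos_iff_ne_zero, Ne, Finset.sum_eq_zero_iff]
  push Not
  simp only [← Nat.pos_iff_ne_zero, inc_pos_iff]

lemma support_mono {S T : Finset G.E} (h : S ⊆ T) : G.support S ⊆ G.support T := by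
  intro v hv
  rw [mem_support] at *
  obtain ⟨e, he, hv⟩ := hv
  exact ⟨e, h he, hv⟩

lemma support_union (S T : Finset G.E) : G.support (S ∪ T) = G.support S ∪ G.support T := by
  ext v
  simp only [mem_support, Finset.mem_union]
  constructor
  · rintro ⟨e, he | he, hv⟩
    · exact Or.inl ⟨e, he, hv⟩
    · exact Or.inr ⟨e, he, hv⟩
  · rintro (⟨e, he, hv⟩ | ⟨e, he, hv⟩)
    · exact ⟨e, Or.inl he, hv⟩
    · exact ⟨e, Or.inr he, hv⟩

lemma sum_inc_univ (e : G.E) : ∑ v, inc e v = 2 := by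
  obtain ⟨x, y, h⟩ := exists_ends e
  simp only [inc_of_ends h, Finset.sum_add_distrib]
  simp

lemma sum_degIn (S : Finset G.E) : ∑ v, G.degIn S v = 2 * S.card := by
  simp only [degIn_eq_sum]
  rw [Finset.sum_comm]
  simp [sum_inc_univ, mul_comm]

/-- The degree of `v` in `S` modulo two. -/
def bd (S : Finset G.E) (v : G.V) : ZMod 2 := (G.degIn S v : ZMod 2)

lemma bd_eq_sum (S : Finset G.E) (v : G.V) : bd S v = ∑ e ∈ S, (inc e v : ZMod 2) := by
  simp [bd, degIn_eq_sum]

@[simp] lemma degIn_empty (v : G.V) : G.degIn ∅ v = 0 := rfl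

@[simp] lemma bd_empty (v : G.V) : bd (∅ : Finset G.E) v = 0 := by simp [bd]

lemma sum_symmDiff_zmod {α : Type*} (f : α → ZMod 2) (S T : Finset α) :
    ∑ e ∈ symmDiff S T, f e = ∑ e ∈ S, f e + ∑ e ∈ T, f e := by
  have h1 : symmDiff S T = (S \ T) ∪ (T \ S) := rfl
  rw [h1, Finset.sum_union disjoint_sdiff_sdiff]
  rw [← Finset.sum_sdiff (Finset.inter_subset_left : S ∩ T ⊆ S),
    ← Finset.sum_sdiff (Finset.inter_subset_right : S ∩ T ⊆ T)]
  rw [Finset.sdiff_inter_self_left, Finset.sdiff_inter_self_right]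
  have h2 : ∀ a : ZMod 2, a + a = 0 := by decide
  linear_combination - h2 (∑ e ∈ S ∩ T, f e)

lemma card_symmDiff_zmod {α : Type*} (S T : Finset α) :
    ((symmDiff S T).card : ZMod 2) = S.card + T.card := by
  have := sum_symmDiff_zmod (fun _ : α => (1 : ZMod 2)) S T
  simpa using this

lemma bd_symmDiff (S T : Finset G.E) (v : G.V) : bd (symmDiff S T) v = bd S v + bd T v := by
  simp only [bd_eq_sum]; exact sum_symmDiff_zmod _ S T

lemma crossesB_of_ends {e : G.E} {x y : G.V} (h : G.ends e = s(x, y)) (U : Finset G.V) :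
    G.crossesB U e = Bool.xor (decide (x ∈ U)) (decide (y ∈ U)) := by
  unfold crossesB
  rw [h]
  rfl

lemma mem_boundary {S : Finset G.E} {U : Finset G.V} {e : G.E} :
    e ∈ G.boundary S U ↔ e ∈ S ∧ G.crossesB U e = true := by
  simp [boundary]

lemma mem_boundary_of_ends {S : Finset G.E} {U : Finset G.V} {e : G.E} {x y : G.V}
    (h : G.ends e = s(x, y)) :
    e ∈ G.boundary S U ↔ e ∈ S ∧ ((x ∈ U ∧ y ∉ U) ∨ (x ∉ U ∧ y ∈ U)) := by
  rw [mem_boundary, crossesB_of_ends h]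
  by_cases h1 : x ∈ U <;> by_cases h2 : y ∈ U <;> simp [h1, h2]

lemma boundary_subset (S : Finset G.E) (U : Finset G.V) : G.boundary S U ⊆ S :=
  Finset.filter_subset _ _

lemma boundary_mono {S S' : Finset G.E} (h : S ⊆ S') (U : Finset G.V) :
    G.boundary S U ⊆ G.boundary S' U :=
  Finset.filter_subset_filter _ h

lemma sum_inc_zmod (e : G.E) (U : Finset G.V) :
    ∑ v ∈ U, (inc e v : ZMod 2) = if G.crossesB U e = true then 1 else 0 := by
  obtain ⟨x, y, h⟩ := exists_ends e
  simp only [inc_of_ends h, crossesB_of_ends h]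
  push_cast
  rw [Finset.sum_add_distrib]
  simp only [Finset.sum_ite_eq']
  by_cases h1 : x ∈ U <;> by_cases h2 : y ∈ U <;> simp [h1, h2]
  decide

lemma sum_bd (S : Finset G.E) (U : Finset G.V) :
    ∑ v ∈ U, bd S v = ((G.boundary S U).card : ZMod 2) := by
  simp only [bd_eq_sum]
  rw [Finset.sum_comm]
  simp only [sum_inc_zmod, boundary]
  rw [Finset.sum_boole]

/-- All degrees of `S` are even. -/
def Ev (S : Finset G.E) : Prop := ∀ v, bd S v = 0

lemma ev_empty : Ev (∅ : Finset G.E) := fun v => bd_empty v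

lemma Ev.symmDiff {S T : Finset G.E} (hS : Ev S) (hT : Ev T) : Ev (symmDiff S T) := by
  intro v; rw [bd_symmDiff, hS v, hT v, add_zero]

lemma Ev.boundary_card {S : Finset G.E} (hS : Ev S) (U : Finset G.V) :
    Even (G.boundary S U).card := by
  rw [← ZMod.natCast_eq_zero_iff_even, ← sum_bd]
  exact Finset.sum_eq_zero fun v _ => hS v

/-! ### Reachability -/

lemma Adj.symm {S : Finset G.E} {u v : G.V} (h : G.Adj S u v) : G.Adj S v u := by
  obtain ⟨e, he, h⟩ := h
  exact ⟨e, he, by rw [h, Sym2.eq_swap]⟩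

lemma Reach.refl (S : Finset G.E) (u : G.V) : G.Reach S u u := Relation.ReflTransGen.refl

lemma Reach.symm {S : Finset G.E} {u v : G.V} (h : G.Reach S u v) : G.Reach S v u := by
  induction h with
  | refl => exact Relation.ReflTransGen.refl
  | tail _ h ih => exact Relation.ReflTransGen.head h.symm ih

lemma Reach.trans {S : Finset G.E} {u v w : G.V} (h : G.Reach S u v) (h' : G.Reach S v w) :
    G.Reach S u w := Relation.ReflTransGen.trans h h'

lemma Reach.mono {S T : Finset G.E} (hST : S ⊆ T) {u v : G.V} (h : G.Reach S u v) :
    G.Reach T u v := by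
  induction h with
  | refl => exact Relation.ReflTransGen.refl
  | tail _ h ih =>
    obtain ⟨e, he, h⟩ := h
    exact Relation.ReflTransGen.tail ih ⟨e, hST he, h⟩

lemma reach_of_ends {S : Finset G.E} {e : G.E} {u v : G.V} (he : e ∈ S)
    (h : G.ends e = s(u, v)) : G.Reach S u v := Relation.ReflTransGen.single ⟨e, he, h⟩

lemma Reach.of_edges {S T : Finset G.E}
    (hST : ∀ e ∈ S, ∀ x y, G.ends e = s(x, y) → G.Reach T x y) {u v : G.V}
    (h : G.Reach S u v) : G.Reach T u v := by
  induction h with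
  | refl => exact Relation.ReflTransGen.refl
  | tail _ h ih =>
    obtain ⟨e, he, h⟩ := h
    exact ih.trans (hST e he _ _ h)

/-- A vertex set without boundary edges in `S` is closed under reachability in `S`. -/
lemma Reach.mem_of_boundary {S : Finset G.E} {U : Finset G.V} (hU : G.boundary S U = ∅)
    {u v : G.V} (h : G.Reach S u v) (hu : u ∈ U) : v ∈ U := by
  induction h with
  | refl => exact hu
  | tail _ h ih =>
    obtain ⟨e, he, h⟩ := h
    by_contra hv
    have : e ∈ G.boundary S U := (mem_boundary_of_ends h).2 ⟨he, Or.inl ⟨ih, hv⟩⟩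
    rw [hU] at this
    simp at this

/-- The set of vertices reachable from `u` in `S`. -/
def comp (S : Finset G.E) (u : G.V) : Finset G.V := Finset.univ.filter fun v => G.Reach S u v

@[simp] lemma mem_comp {S : Finset G.E} {u v : G.V} : v ∈ comp S u ↔ G.Reach S u v := by
  simp [comp]

lemma boundary_comp (S : Finset G.E) (u : G.V) : G.boundary S (comp S u) = ∅ := by
  rw [Finset.eq_empty_iff_forall_notMem]
  intro e he
  obtain ⟨x, y, h⟩ := exists_ends e
  rw [mem_boundary_of_ends h] at he
  simp only [mem_comp] at he
  obtain ⟨he, h1 | h1⟩ := he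
  · exact h1.2 (h1.1.trans (reach_of_ends he h))
  · exact h1.1 (h1.2.trans (reach_of_ends he h).symm)

/-- A vertex of odd degree reaches another vertex of odd degree. -/
lemma exists_reach_of_bd {S : Finset G.E} {u : G.V} (hu : bd S u ≠ 0) :
    ∃ v, v ≠ u ∧ G.Reach S u v ∧ bd S v ≠ 0 := by
  by_contra! hcon
  have h1 := sum_bd S (comp S u)
  rw [boundary_comp, Finset.sum_eq_single u] at h1
  · exact hu (by simpa using h1)
  · intro v hv hvu
    exact hcon v hvu (mem_comp.1 hv)
  · intro h
    exact absurd (mem_comp.2 (Reach.refl S u)) h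

lemma reach_of_bd {S : Finset G.E} {u v : G.V} (hu : bd S u ≠ 0)
    (h : ∀ x, x ≠ u → x ≠ v → bd S x = 0) : G.Reach S u v := by
  obtain ⟨w, hw, hr, hb⟩ := exists_reach_of_bd hu
  by_cases hwv : w = v
  · rwa [← hwv]
  · exact absurd (h w hw hwv) hb

/-! ### Paths with their vertex sets -/

/-- `Pth P W u v`: the edge set `P` is a (possibly trivial) path from `u` to `v` with
vertex set `W`. -/
inductive Pth : Finset G.E → Finset G.V → G.V → G.V → Prop
  | nil (u : G.V) : Pth ∅ {u} u u
  | cons {e : G.E} {P : Finset G.E} {W : Finset G.V} {u w v : G.V} :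
      G.ends e = s(u, w) → u ∉ W → Pth P W w v → Pth (insert e P) (insert u W) u v

namespace Pth

variable {P P' : Finset G.E} {W W' : Finset G.V} {u v w : G.V}

lemma left_mem (h : Pth P W u v) : u ∈ W := by cases h <;> simp

lemma right_mem (h : Pth P W u v) : v ∈ W := by
  induction h with
  | nil => simp
  | cons _ _ _ ih => exact Finset.mem_insert_of_mem ih

lemma ends_mem (h : Pth P W u v) {e : G.E} (he : e ∈ P) {x : G.V} (hx : x ∈ G.ends e) :
    x ∈ W := by
  induction h with
  | nil => simp at he
  | cons h1 h2 h3 ih =>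
    rw [Finset.mem_insert] at he
    rcases he with rfl | he
    · rw [h1, Sym2.mem_iff] at hx
      rcases hx with rfl | rfl
      · simp
      · exact Finset.mem_insert_of_mem h3.left_mem
    · exact Finset.mem_insert_of_mem (ih he)

lemma degIn_add (h : Pth P W u v) (x : G.V) :
    G.degIn P x + (if x = u then 1 else 0) + (if x = v then 1 else 0) =
      2 * (if x ∈ W then 1 else 0) := by
  induction h with
  | nil u => by_cases h : x = u <;> simp [h]
  | @cons e P W u w v h1 h2 h3 ih =>
    have he : e ∉ P := fun he => h2 (h3.ends_mem he (by rw [h1]; simp))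
    rw [degIn_insert he, inc_of_ends h1]
    by_cases hxu : x = u
    · subst hxu
      simp only [h2, if_false, if_true, Finset.mem_insert_self] at ih ⊢
      omega
    · simp only [hxu, if_false, Finset.mem_insert, false_or] at ih ⊢
      omega

lemma reach_right (h : Pth P W u v) {x : G.V} (hx : x ∈ W) : G.Reach P x v := by
  induction h generalizing x with
  | nil u => simp at hx; subst hx; exact Reach.refl _ _
  | @cons e P W u w v h1 h2 h3 ih =>
    rw [Finset.mem_insert] at hx
    rcases hx with rfl | hx
    · exact (reach_of_ends (Finset.mem_insert_self e P) h1).trans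
        ((ih h3.left_mem).mono (Finset.subset_insert _ _))
    · exact (ih hx).mono (Finset.subset_insert _ _)

lemma reach_mem (h : Pth P W u v) {x y : G.V} (hx : x ∈ W) (hy : y ∈ W) : G.Reach P x y :=
  (h.reach_right hx).trans (h.reach_right hy).symm

lemma bd_eq (h : Pth P W u v) (x : G.V) :
    bd P x = (if x = u then 1 else 0) + (if x = v then 1 else 0) := by
  have h1 := congrArg (Nat.cast : ℕ → ZMod 2) (h.degIn_add x)
  push_cast at h1
  have h2 : (2 : ZMod 2) = 0 := by decide
  rw [h2, zero_mul] at h1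
  have h3 : ∀ a : ZMod 2, a + a = 0 := by decide
  unfold bd
  linear_combination h1 - h3 (if x = u then 1 else 0) - h3 (if x = v then 1 else 0)

lemma suffix (h : Pth P W u v) {x : G.V} (hx : x ∈ W) :
    ∃ P' ⊆ P, ∃ W' ⊆ W, Pth P' W' x v ∧ (x ≠ u → u ∉ W') := by
  induction h with
  | nil u =>
    simp at hx; subst hx
    exact ⟨∅, le_rfl, _, le_rfl, Pth.nil x, fun h => absurd rfl h⟩
  | @cons e P W u w v h1 h2 h3 ih =>
    by_cases hxu : x = u
    · subst hxu
      exact ⟨_, le_rfl, _, le_rfl, Pth.cons h1 h2 h3, fun h => absurd rfl h⟩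
    · rw [Finset.mem_insert, or_iff_right hxu] at hx
      obtain ⟨P', hP', W', hW', h', _⟩ := ih hx
      exact ⟨P', hP'.trans (Finset.subset_insert _ _), W',
        hW'.trans (Finset.subset_insert _ _), h', fun _ hu => h2 (hW' hu)⟩

lemma concat (h : Pth P W u v) (h' : Pth P' W' v w) (hd : ∀ x ∈ W, x ∈ W' → x = v) :
    Pth (P ∪ P') (W ∪ W') u w := by
  induction h with
  | nil u =>
    have h1 : {u} ∪ W' = W' := Finset.union_eq_right.2 (by simpa using h'.left_mem)
    rw [h1, Finset.empty_union]
    exact h'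
  | @cons e P W u z v h1 h2 h3 ih =>
    rw [Finset.insert_union, Finset.insert_union]
    have h4 := ih h' fun x hx hx' => hd x (Finset.mem_insert_of_mem hx) hx'
    refine Pth.cons h1 ?_ h4
    rw [Finset.mem_union, not_or]
    refine ⟨h2, fun hu => h2 ?_⟩
    rw [hd u (Finset.mem_insert_self _ _) hu]
    exact h3.right_mem

lemma single {e : G.E} (h : G.ends e = s(u, v)) (huv : u ≠ v) : Pth {e} {u, v} u v := by
  have := Pth.cons h (by simpa using huv) (Pth.nil v)
  simpa using this

lemma reverse (h : Pth P W u v) : Pth P W v u := by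
  induction h with
  | nil u => exact Pth.nil u
  | @cons e P W u w v h1 h2 h3 ih =>
    have huw : w ≠ u := fun h => h2 (h ▸ h3.left_mem)
    have h4 := ih.concat (single (h1.trans Sym2.eq_swap) huw) (by
      intro x hx hx'
      simp only [Finset.mem_insert, Finset.mem_singleton] at hx'
      rcases hx' with rfl | rfl
      · rfl
      · exact absurd hx h2)
    have h5 : P ∪ {e} = insert e P := by ext; simp
    have h6 : W ∪ {w, u} = insert u W := by
      ext x
      simp only [Finset.mem_union, Finset.mem_insert, Finset.mem_singleton]
      constructor
      · rintro (h | rfl | h)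
        · exact Or.inr h
        · exact Or.inr h3.left_mem
        · exact Or.inl h
      · rintro (h | h)
        · exact Or.inr (Or.inr h)
        · exact Or.inl h
    rwa [h5, h6] at h4

lemma prefix_of_mem (h : Pth P W u v) {x : G.V} (hx : x ∈ W) :
    ∃ P' ⊆ P, ∃ W' ⊆ W, Pth P' W' u x ∧ (x ≠ v → v ∉ W') := by
  obtain ⟨P', hP', W', hW', h', h2⟩ := h.reverse.suffix hx
  exact ⟨P', hP', W', hW', h'.reverse, h2⟩

/-- A path between two vertex sets contains one meeting them only at its ends. -/
lemma trim (h : Pth P W u v) {A B : Finset G.V} (hu : u ∈ A) (hv : v ∈ B) :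
    ∃ P' ⊆ P, ∃ W' ⊆ W, ∃ a ∈ A, ∃ b ∈ B, Pth P' W' a b ∧
      (∀ x ∈ W', x ∈ A → x = a) ∧ (∀ x ∈ W', x ∈ B → x = b) := by
  induction hn : W.card using Nat.strong_induction_on generalizing P W u v with
  | _ n ih =>
    subst hn
    by_cases h1 : ∀ x ∈ W, x ∈ A → x = u
    · by_cases h2 : ∀ x ∈ W, x ∈ B → x = v
      · exact ⟨P, le_rfl, W, le_rfl, u, hu, v, hv, h, h1, h2⟩
      · push Not at h2
        obtain ⟨x, hx, hxB, hxv⟩ := h2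
        obtain ⟨P', hP', W', hW', h', h3⟩ := h.prefix_of_mem hx
        have hlt : W'.card < W.card := Finset.card_lt_card
          ⟨hW', fun hh => h3 hxv (hh h.right_mem)⟩
        obtain ⟨P₂, hP₂, W₂, hW₂, h4⟩ := ih _ hlt h' hu hxB rfl
        exact ⟨P₂, hP₂.trans hP', W₂, hW₂.trans hW', h4⟩
    · push Not at h1
      obtain ⟨x, hx, hxA, hxu⟩ := h1
      obtain ⟨P', hP', W', hW', h', h3⟩ := h.suffix hx
      have hlt : W'.card < W.card := Finset.card_lt_card
        ⟨hW', fun hh => h3 hxu (hh h.left_mem)⟩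
      obtain ⟨P₂, hP₂, W₂, hW₂, h4⟩ := ih _ hlt h' hxA hv rfl
      exact ⟨P₂, hP₂.trans hP', W₂, hW₂.trans hW', h4⟩

lemma eq_empty (h : Pth P W u u) : P = ∅ ∧ W = {u} := by
  cases h with
  | nil => exact ⟨rfl, rfl⟩
  | cons h1 h2 h3 => exact absurd h3.right_mem h2

lemma degIn_eq_of_ne (h : Pth P W u v) (huv : u ≠ v) {x : G.V} (hx : x ∈ W) :
    0 < G.degIn P x := by
  have := h.degIn_add x
  rw [if_pos hx] at this
  by_cases h1 : x = u
  · subst h1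
    simp only [if_true, huv, if_false] at this
    omega
  · rw [if_neg h1] at this
    by_cases h2 : x = v
    · rw [if_pos h2] at this; omega
    · rw [if_neg h2] at this; omega

lemma support_eq (h : Pth P W u v) (huv : u ≠ v) : G.support P = W := by
  ext x
  constructor
  · intro hx
    obtain ⟨e, he, hx⟩ := mem_support.1 hx
    exact h.ends_mem he hx
  · intro hx
    exact degIn_pos_iff.1 (h.degIn_eq_of_ne huv hx)

lemma isPath (h : Pth P W u v) (huv : u ≠ v) : G.IsPath P u v := by
  have hs := h.support_eq huv
  have hdeg := h.degIn_add
  refine ⟨?_, ?_, huv, ?_, ?_, ?_, ?_, ?_⟩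
  · have := degIn_pos_iff.1 (h.degIn_eq_of_ne huv h.left_mem)
    obtain ⟨e, he, _⟩ := mem_support.1 this
    exact ⟨e, he⟩
  · intro x hx y hy
    rw [hs] at hx hy
    exact h.reach_mem hx hy
  · rw [hs]; exact h.left_mem
  · rw [hs]; exact h.right_mem
  · have := hdeg u
    rw [if_pos rfl, if_neg huv, if_pos h.left_mem] at this
    omega
  · have := hdeg v
    rw [if_pos rfl, if_neg huv.symm, if_pos h.right_mem] at this
    omega
  · intro w hw hwu hwv
    have := hdeg w
    rw [if_neg hwu, if_neg hwv, if_pos (hs ▸ hw)] at this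
    omega

end Pth

lemma Reach.exists_pth {S : Finset G.E} {u v : G.V} (h : G.Reach S u v) :
    ∃ P ⊆ S, ∃ W, Pth P W u v := by
  induction h using Relation.ReflTransGen.head_induction_on with
  | refl => exact ⟨∅, by simp, _, Pth.nil v⟩
  | @head u w h1 _ ih =>
    obtain ⟨e, he, h1⟩ := h1
    obtain ⟨P, hP, W, h2⟩ := ih
    by_cases hu : u ∈ W
    · obtain ⟨P', hP', W', hW', h3, _⟩ := h2.suffix hu
      exact ⟨P', hP'.trans hP, W', h3⟩
    · exact ⟨_, Finset.insert_subset he hP, _, Pth.cons h1 hu h2⟩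

/-! ### Circuits -/

lemma IsCircuit.degIn_eq {K : Finset G.E} (hK : G.IsCircuit K) (x : G.V) :
    G.degIn K x = 2 * (if x ∈ G.support K then 1 else 0) := by
  by_cases hx : x ∈ G.support K
  · rw [if_pos hx, hK.2.2 x hx]
  · rw [if_neg hx]
    by_contra h
    exact hx (degIn_pos_iff.1 (Nat.pos_of_ne_zero (by simpa using h)))

lemma IsCircuit.ev {K : Finset G.E} (hK : G.IsCircuit K) : Ev K := by
  intro v
  have h2 : (2 : ZMod 2) = 0 := by decide
  unfold bd
  rw [hK.degIn_eq v]
  push_cast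
  rw [h2, zero_mul]

lemma IsCircuit.card_support {K : Finset G.E} (hK : G.IsCircuit K) :
    (G.support K).card = K.card := by
  have h := sum_degIn K
  simp only [hK.degIn_eq] at h
  rw [← Finset.mul_sum] at h
  simp at h
  exact h

lemma isCircuit_of_deg {S : Finset G.E} {W : Finset G.V} {u : G.V} (hu : u ∈ W)
    (hdeg : ∀ x, G.degIn S x = 2 * (if x ∈ W then 1 else 0))
    (hc : ∀ x ∈ W, G.Reach S u x) : G.IsCircuit S ∧ G.support S = W := by
  have hs : G.support S = W := by
    ext x
    rw [← degIn_pos_iff, hdeg]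
    by_cases h : x ∈ W <;> simp [h]
  refine ⟨⟨?_, ?_, ?_⟩, hs⟩
  · rw [← hs] at hu
    obtain ⟨e, he, _⟩ := mem_support.1 hu
    exact ⟨e, he⟩
  · intro x hx y hy
    rw [hs] at hx hy
    exact (hc x hx).symm.trans (hc y hy)
  · intro v hv
    rw [hs] at hv
    rw [hdeg, if_pos hv]

/-- An edge and a path joining its ends form a circuit. -/
lemma Pth.close {P : Finset G.E} {W : Finset G.V} {x y : G.V} (h : Pth P W x y) {e : G.E}
    (he : G.ends e = s(x, y)) (heP : e ∉ P) :
    G.IsCircuit (insert e P) ∧ G.support (insert e P) = W := by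
  refine isCircuit_of_deg h.left_mem ?_ ?_
  · intro v
    rw [degIn_insert heP, inc_of_ends he, ← h.degIn_add v]
    omega
  · intro v hv
    exact (h.reach_mem h.left_mem hv).mono (Finset.subset_insert _ _)

/-- Two internally disjoint paths with the same distinct ends form a circuit. -/
lemma Pth.join {P₁ P₂ : Finset G.E} {W₁ W₂ : Finset G.V} {u v : G.V} (h₁ : Pth P₁ W₁ u v)
    (h₂ : Pth P₂ W₂ u v) (huv : u ≠ v) (hd : Disjoint P₁ P₂)
    (hW : ∀ x ∈ W₁, x ∈ W₂ → x = u ∨ x = v) :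
    G.IsCircuit (P₁ ∪ P₂) ∧ G.support (P₁ ∪ P₂) = W₁ ∪ W₂ := by
  refine isCircuit_of_deg (Finset.mem_union_left _ h₁.left_mem) ?_ ?_
  · intro x
    have e1 := h₁.degIn_add x
    have e2 := h₂.degIn_add x
    rw [degIn_union hd]
    by_cases hxu : x = u
    · subst hxu
      simp only [h₁.left_mem, h₂.left_mem, huv, if_true, if_false, Finset.mem_union,
        or_self] at *
      omega
    · by_cases hxv : x = v
      · subst hxv
        simp only [h₁.right_mem, h₂.right_mem, hxu, if_true, if_false, Finset.mem_union,
          or_self] at *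
        omega
      · by_cases h1 : x ∈ W₁
        · have h2 : x ∉ W₂ := fun h2 => by
            rcases hW x h1 h2 with h | h
            · exact hxu h
            · exact hxv h
          simp only [hxu, hxv, h1, h2, if_true, if_false, Finset.mem_union, true_or] at *
          omega
        · simp only [hxu, hxv, h1, if_false, Finset.mem_union, false_or] at *
          omega
  · intro x hx
    rw [Finset.mem_union] at hx
    rcases hx with hx | hx
    · exact (h₁.reach_mem h₁.left_mem hx).mono Finset.subset_union_left
    · exact (h₂.reach_mem h₂.left_mem hx).mono Finset.subset_union_right

/-- Circuits are minimal nonempty even sets. -/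
lemma IsCircuit.eq_of_ev {K S : Finset G.E} (hK : G.IsCircuit K) (hS : S ⊆ K) (hev : Ev S)
    (hne : S.Nonempty) : S = K := by
  have hdeg : ∀ v ∈ G.support S, G.degIn S v = G.degIn K v := by
    intro v hv
    have h1 := degIn_pos_iff.2 hv
    have h2 := degIn_mono hS v
    have h3 := hK.2.2 v (support_mono hS hv)
    have h4 : Even (G.degIn S v) := ZMod.natCast_eq_zero_iff_even.1 (hev v)
    obtain ⟨k, hk⟩ := h4
    omega
  have hdiff : ∀ e ∈ K, ∀ v ∈ G.support S, v ∈ G.ends e → e ∈ S := by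
    intro e he v hv hve
    by_contra heS
    have h1 : G.degIn (insert e S) v ≤ G.degIn K v :=
      degIn_mono (Finset.insert_subset he hS) v
    rw [degIn_insert heS, ← hdeg v hv] at h1
    have := inc_pos_iff.2 hve
    omega
  have hb : G.boundary K (G.support S) = ∅ := by
    rw [Finset.eq_empty_iff_forall_notMem]
    intro e he
    obtain ⟨x, y, h⟩ := exists_ends e
    obtain ⟨heK, h1⟩ := (mem_boundary_of_ends h).1 he
    rcases h1 with ⟨h1, h2⟩ | ⟨h2, h1⟩
    · exact h2 (mem_support.2 ⟨e, hdiff e heK x h1 (by rw [h]; simp), by rw [h]; simp⟩)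
    · exact h2 (mem_support.2 ⟨e, hdiff e heK y h1 (by rw [h]; simp), by rw [h]; simp⟩)
  refine Finset.Subset.antisymm hS fun e he => ?_
  obtain ⟨f, hf⟩ := hne
  obtain ⟨x, y, h⟩ := exists_ends e
  obtain ⟨x', y', h'⟩ := exists_ends f
  have hx' : x' ∈ G.support S := mem_support.2 ⟨f, hf, by rw [h']; simp⟩
  have hx : x ∈ G.support K := mem_support.2 ⟨e, he, by rw [h]; simp⟩
  have hr := hK.2.1 x' (support_mono hS hx') x hx
  exact hdiff e he x (hr.mem_of_boundary hb hx') (by rw [h]; simp)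

lemma bd_erase {S : Finset G.E} {e : G.E} (he : e ∈ S) (v : G.V) :
    bd (S.erase e) v = bd S v + inc e v := by
  have h3 : ∀ a : ZMod 2, a + a = 0 := by decide
  simp only [bd_eq_sum]
  rw [← Finset.add_sum_erase S _ he]
  linear_combination - h3 (inc e v)

/-- Removing an edge of an even set keeps its ends connected. -/
lemma Ev.reach_erase {S : Finset G.E} (hS : Ev S) {e : G.E} (he : e ∈ S) {x y : G.V}
    (h : G.ends e = s(x, y)) : G.Reach (S.erase e) x y := by
  by_cases hxy : x = y
  · subst hxy; exact Reach.refl _ _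
  · apply reach_of_bd
    · rw [bd_erase he, hS x, inc_of_ends h]; simp [hxy]
    · intro z hz1 hz2
      rw [bd_erase he, hS z, inc_of_ends h]; simp [hz1, hz2]

/-- Every edge of an even set lies in a circuit contained in it. -/
lemma Ev.exists_circuit {S : Finset G.E} (hS : Ev S) {e : G.E} (he : e ∈ S) :
    ∃ K ⊆ S, G.IsCircuit K ∧ e ∈ K := by
  obtain ⟨x, y, h⟩ := exists_ends e
  obtain ⟨P, hP, W, hp⟩ := (hS.reach_erase he h).exists_pth
  refine ⟨insert e P, Finset.insert_subset he (hP.trans (Finset.erase_subset _ _)),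
    (hp.close h fun h => by simpa using hP h).1, by simp⟩

lemma IsCircuit.exists_pth_erase {K : Finset G.E} (hK : G.IsCircuit K) {e : G.E} (he : e ∈ K)
    {x y : G.V} (h : G.ends e = s(x, y)) : Pth (K.erase e) (G.support K) x y := by
  obtain ⟨P, hP, W, hp⟩ := (hK.ev.reach_erase he h).exists_pth
  have heP : e ∉ P := fun h => by simpa using hP h
  have hc := hp.close h heP
  have heq := hK.eq_of_ev (Finset.insert_subset he (hP.trans (Finset.erase_subset _ _)))
    hc.1.ev ⟨e, by simp⟩
  rw [heq] at hc
  have : K.erase e = P := by rw [← heq, Finset.erase_insert heP]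
  rw [this, hc.2]
  exact hp

/-- Two distinct vertices split a circuit into two paths. -/
lemma IsCircuit.split {K : Finset G.E} (hK : G.IsCircuit K) {u v : G.V}
    (hu : u ∈ G.support K) (hv : v ∈ G.support K) (huv : u ≠ v) :
    ∃ P₁ W₁ P₂ W₂, Pth P₁ W₁ u v ∧ Pth P₂ W₂ u v ∧ Disjoint P₁ P₂ ∧ P₁ ∪ P₂ = K ∧
      W₁ ∪ W₂ = G.support K ∧ ∀ x ∈ W₁, x ∈ W₂ → x = u ∨ x = v := by
  obtain ⟨P₁, hP₁, W₁, h₁⟩ := (hK.2.1 u hu v hv).exists_pth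
  have hbd : ∀ x, bd (K \ P₁) x = (if x = u then 1 else 0) + (if x = v then 1 else 0) := by
    intro x
    have h := hK.ev x
    have h3 : ∀ a : ZMod 2, a + a = 0 := by decide
    rw [bd_eq_sum, ← Finset.sum_sdiff hP₁, ← bd_eq_sum, ← bd_eq_sum, h₁.bd_eq] at h
    linear_combination h - h3 (if x = u then 1 else 0) - h3 (if x = v then 1 else 0)
  have hr : G.Reach (K \ P₁) u v := by
    apply reach_of_bd
    · rw [hbd]; simp [huv]
    · intro x h1 h2; rw [hbd]; simp [h1, h2]
  obtain ⟨P₂, hP₂, W₂, h₂⟩ := hr.exists_pth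
  have hd : Disjoint P₁ P₂ := Finset.disjoint_of_subset_right hP₂ Finset.disjoint_sdiff
  have hev : Ev (P₁ ∪ P₂) := by
    intro x
    have h3 : ∀ a : ZMod 2, a + a = 0 := by decide
    rw [bd_eq_sum, Finset.sum_union hd, ← bd_eq_sum, ← bd_eq_sum, h₁.bd_eq, h₂.bd_eq]
    exact h3 _
  have hne : (P₁ ∪ P₂).Nonempty := by
    obtain ⟨e, he, _⟩ := mem_support.1 (degIn_pos_iff.1 (h₁.degIn_eq_of_ne huv h₁.left_mem))
    exact ⟨e, Finset.mem_union_left _ he⟩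
  have heq := hK.eq_of_ev (Finset.union_subset hP₁ (hP₂.trans Finset.sdiff_subset)) hev hne
  refine ⟨P₁, W₁, P₂, W₂, h₁, h₂, hd, heq, ?_, ?_⟩
  · rw [← heq, support_union, h₁.support_eq huv, h₂.support_eq huv]
  · intro x hx1 hx2
    by_contra! hcon
    have e1 := h₁.degIn_add x
    have e2 := h₂.degIn_add x
    have e3 := hK.degIn_eq x
    rw [← heq, degIn_union hd] at e3
    simp only [hx1, hx2, hcon.1, hcon.2, if_true, if_false] at e1 e2
    split_ifs at e3 <;> omega

/-- `𝒞` is a decomposition of `S` into pairwise disjoint circuits. -/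
def Dec (𝒞 : Finset (Finset G.E)) (S : Finset G.E) : Prop :=
  (∀ K ∈ 𝒞, G.IsCircuit K) ∧ (∀ K ∈ 𝒞, ∀ K' ∈ 𝒞, K ≠ K' → Disjoint K K') ∧ 𝒞.biUnion id = S

lemma ev_sdiff {S K : Finset G.E} (hS : Ev S) (hK : Ev K) (h : K ⊆ S) : Ev (S \ K) := by
  have h1 : S \ K = symmDiff S K := by
    ext e
    simp only [Finset.mem_sdiff, Finset.mem_symmDiff]
    constructor
    · exact Or.inl
    · rintro (h' | h')
      · exact h'
      · exact absurd (h h'.1) h'.2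
  rw [h1]
  exact hS.symmDiff hK

lemma Ev.union_of_disjoint {S T : Finset G.E} (hS : Ev S) (hT : Ev T) (h : Disjoint S T) :
    Ev (S ∪ T) := by
  intro v
  rw [bd, degIn_union h]
  push_cast
  change bd S v + bd T v = 0
  rw [hS v, hT v, add_zero]

lemma Dec.insert {𝒞 : Finset (Finset G.E)} {S K : Finset G.E} (h : Dec 𝒞 S)
    (hK : G.IsCircuit K) (hd : Disjoint K S) : Dec (insert K 𝒞) (K ∪ S) := by
  obtain ⟨h1, h2, h3⟩ := h
  have h4 : ∀ K' ∈ 𝒞, Disjoint K K' := fun K' hK' =>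
    Finset.disjoint_of_subset_right (h3 ▸ Finset.subset_biUnion_of_mem id hK') hd
  refine ⟨?_, ?_, ?_⟩
  · intro K' hK'
    rcases Finset.mem_insert.1 hK' with rfl | hK'
    · exact hK
    · exact h1 K' hK'
  · intro K₁ hK₁ K₂ hK₂ hne
    rcases Finset.mem_insert.1 hK₁ with e₁ | m₁ <;>
      rcases Finset.mem_insert.1 hK₂ with e₂ | m₂
    · exact absurd (e₁.trans e₂.symm) hne
    · exact e₁ ▸ h4 _ m₂
    · exact e₂ ▸ (h4 _ m₁).symm
    · exact h2 _ m₁ _ m₂ hne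
  · rw [Finset.biUnion_insert, h3]; rfl

lemma Ev.exists_dec {S : Finset G.E} (hS : Ev S) : ∃ 𝒞, Dec 𝒞 S := by
  induction hn : S.card using Nat.strong_induction_on generalizing S with
  | _ n ih =>
    subst hn
    rcases S.eq_empty_or_nonempty with rfl | ⟨e, he⟩
    · exact ⟨∅, by simp, by simp, by simp⟩
    · obtain ⟨K, hKS, hK, heK⟩ := hS.exists_circuit he
      have hlt : (S \ K).card < S.card :=
        Finset.card_lt_card ⟨Finset.sdiff_subset, fun h => by simpa [heK] using h he⟩
      obtain ⟨𝒞, h⟩ := ih _ hlt (ev_sdiff hS hK.ev hKS) rfl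
      refine ⟨insert K 𝒞, ?_⟩
      have := h.insert hK Finset.disjoint_sdiff
      rwa [Finset.union_sdiff_of_subset hKS] at this

/-! ### Rerouting circuits -/

namespace Pth

variable {P P' : Finset G.E} {W W' : Finset G.V} {u v w : G.V}

lemma split_at (h : Pth P W u v) {x : G.V} (hx : x ∈ W) :
    ∃ P₁ ⊆ P, ∃ P₂ ⊆ P, ∃ W₁ W₂, Pth P₁ W₁ u x ∧ Pth P₂ W₂ x v ∧ W₁ ∪ W₂ = W ∧
      (x ≠ v → v ∉ W₁) ∧ (x ≠ u → u ∉ W₂) := by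
  induction h with
  | nil u =>
    simp at hx; subst hx
    exact ⟨∅, le_rfl, ∅, le_rfl, _, _, Pth.nil x, Pth.nil x, by simp, by simp, by simp⟩
  | @cons e P W u w v h1 h2 h3 ih =>
    by_cases hxu : x = u
    · subst hxu
      refine ⟨∅, by simp, _, le_rfl, _, _, Pth.nil x, Pth.cons h1 h2 h3, by simp, ?_, by simp⟩
      intro h; simpa using h.symm
    · rw [Finset.mem_insert, or_iff_right hxu] at hx
      obtain ⟨P₁, hP₁, P₂, hP₂, W₁, W₂, p₁, p₂, hW, h4, h5⟩ := ih hx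
      refine ⟨_, Finset.insert_subset_insert e hP₁, P₂, hP₂.trans (Finset.subset_insert _ _), _,
        W₂, Pth.cons h1 (fun hu => h2 (hW ▸ Finset.mem_union_left _ hu)) p₁, p₂, ?_, ?_, ?_⟩
      · rw [Finset.insert_union, hW]
      · intro hxv
        rw [Finset.mem_insert, not_or]
        exact ⟨fun h => h2 (h ▸ h3.right_mem), h4 hxv⟩
      · exact fun _ hu => h2 (hW ▸ Finset.mem_union_right _ hu)

lemma not_loop (h : Pth P W u v) {e : G.E} (he : e ∈ P) {x : G.V} : G.ends e ≠ s(x, x) := by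
  induction h with
  | nil => simp at he
  | @cons f P W u w v h1 h2 h3 ih =>
    rcases Finset.mem_insert.1 he with rfl | he
    · intro h
      rw [h1] at h
      have : u = w := by
        rcases Sym2.eq_iff.1 h with ⟨a, b⟩ | ⟨a, b⟩ <;> exact a.trans b.symm
      exact h2 (this ▸ h3.left_mem)
    · exact ih he

lemma eq_pair (h : Pth P W u v) {e : G.E} (he : e ∈ P)
    (hx : ∀ x ∈ G.ends e, x = u ∨ x = v) : W = {u, v} := by
  cases h with
  | nil => simp at he
  | @cons f P W _ w _ h1 h2 h3 =>
    rcases Finset.mem_insert.1 he with rfl | he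
    · have hw : w ∈ G.ends e := by rw [h1]; simp
      rcases hx w hw with rfl | rfl
      · exact absurd h3.left_mem h2
      · rw [h3.eq_empty.2]
    · obtain ⟨x, y, hxy⟩ := exists_ends e
      have key : ∀ z ∈ G.ends e, z = v := fun z hz => by
        rcases hx z hz with rfl | h
        · exact absurd (h3.ends_mem he hz) h2
        · exact h
      have hx1 := key x (by rw [hxy]; simp)
      have hy1 := key y (by rw [hxy]; simp)
      subst hx1
      rw [hy1] at hxy
      exact absurd hxy (h3.not_loop he)

/-- A shortest subpath with distinct ends in `A`. -/
lemma exists_ear (h : Pth P W u v) {A : Finset G.V} (hu : u ∈ A) (hv : v ∈ A) (huv : u ≠ v)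
    {s : G.V} (hs : s ∈ W) :
    ∃ P' ⊆ P, ∃ W' ⊆ W, ∃ a ∈ A, ∃ b ∈ A, a ≠ b ∧ Pth P' W' a b ∧ s ∈ W' ∧
      (∀ x ∈ W', x ∈ A → x = a ∨ x = b) := by
  induction hn : W.card using Nat.strong_induction_on generalizing P W u v with
  | _ n ih =>
    subst hn
    by_cases h1 : ∀ x ∈ W, x ∈ A → x = u ∨ x = v
    · exact ⟨P, le_rfl, W, le_rfl, u, hu, v, hv, huv, h, hs, h1⟩
    · push Not at h1
      obtain ⟨x, hx, hxA, hxu, hxv⟩ := h1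
      obtain ⟨P₁, hP₁, P₂, hP₂, W₁, W₂, p₁, p₂, hW, h4, h5⟩ := h.split_at hx
      have hs' := hs
      rw [← hW, Finset.mem_union] at hs'
      have hs1 : W₁ ⊆ W := hW ▸ Finset.subset_union_left
      have hs2 : W₂ ⊆ W := hW ▸ Finset.subset_union_right
      rcases hs' with hs' | hs'
      · have hlt : W₁.card < W.card := Finset.card_lt_card
          ⟨hs1, fun hh => h4 hxv (hh h.right_mem)⟩
        obtain ⟨P', hP', W', hW', r⟩ := ih _ hlt p₁ hu hxA (Ne.symm hxu) hs' rfl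
        exact ⟨P', hP'.trans hP₁, W', hW'.trans hs1, r⟩
      · have hlt : W₂.card < W.card := Finset.card_lt_card
          ⟨hs2, fun hh => h5 hxu (hh h.left_mem)⟩
        obtain ⟨P', hP', W', hW', r⟩ := ih _ hlt p₂ hxA hv hxv hs' rfl
        exact ⟨P', hP'.trans hP₂, W', hW'.trans hs2, r⟩

end Pth

/-- Two circuits sharing at least two vertices: any vertex of the first and any vertex of the
second lie on a common circuit inside their union. -/
lemma IsCircuit.merge {K K' : Finset G.E} (hK : G.IsCircuit K) (hK' : G.IsCircuit K')
    {p q : G.V} (hpq : p ≠ q) (hp : p ∈ G.support K) (hq : q ∈ G.support K)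
    (hp' : p ∈ G.support K') (hq' : q ∈ G.support K') {s t : G.V}
    (hs : s ∈ G.support K) (ht : t ∈ G.support K') :
    ∃ C ⊆ K ∪ K', G.IsCircuit C ∧ s ∈ G.support C ∧ t ∈ G.support C := by
  by_cases hs' : s ∈ G.support K'
  · exact ⟨K', Finset.subset_union_right, hK', hs', ht⟩
  have harc : ∃ P ⊆ K, ∃ W, Pth P W p q ∧ s ∈ W := by
    obtain ⟨P₁, W₁, P₂, W₂, p₁, p₂, hd, hP, hW, _⟩ := hK.split hp hq hpq
    rw [← hW, Finset.mem_union] at hs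
    rcases hs with hs | hs
    · exact ⟨P₁, hP ▸ Finset.subset_union_left, W₁, p₁, hs⟩
    · exact ⟨P₂, hP ▸ Finset.subset_union_right, W₂, p₂, hs⟩
  obtain ⟨P, hPK, W, hP, hsW⟩ := harc
  obtain ⟨P', hP', W', hW', a, ha, b, hb, hab, h', hs'', hA⟩ := hP.exists_ear hp' hq' hpq hsW
  have harc' : ∃ P₂ ⊆ K', ∃ W₂, Pth P₂ W₂ a b ∧ t ∈ W₂ := by
    obtain ⟨P₁, W₁, P₂, W₂, p₁, p₂, hd, hP, hW, _⟩ := hK'.split ha hb hab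
    rw [← hW, Finset.mem_union] at ht
    rcases ht with ht | ht
    · exact ⟨P₁, hP ▸ Finset.subset_union_left, W₁, p₁, ht⟩
    · exact ⟨P₂, hP ▸ Finset.subset_union_right, W₂, p₂, ht⟩
  obtain ⟨P₂, hP₂, W₂, h₂, ht₂⟩ := harc'
  have hsub : ∀ x ∈ W₂, x ∈ G.support K' := by
    intro x hx
    rw [← h₂.support_eq hab] at hx
    exact support_mono hP₂ hx
  have hd : Disjoint P' P₂ := by
    rw [Finset.disjoint_left]
    intro e he he₂
    have := h'.eq_pair he fun x hx => hA x (h'.ends_mem he hx) (hsub x (h₂.ends_mem he₂ hx))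
    rw [this] at hs''
    simp only [Finset.mem_insert, Finset.mem_singleton] at hs''
    rcases hs'' with rfl | rfl
    · exact hs' ha
    · exact hs' hb
  obtain ⟨hc, hsup⟩ := h'.join h₂ hab hd fun x hx hx' => hA x hx (hsub x hx')
  refine ⟨_, Finset.union_subset_union (hP'.trans hPK) hP₂, hc, ?_, ?_⟩
  · rw [hsup]; exact Finset.mem_union_left _ hs''
  · rw [hsup]; exact Finset.mem_union_right _ ht₂

/-- The parity of the number of negative edges. -/
def np (S : Finset G.E) : ZMod 2 := ((G.negEdges S).card : ZMod 2)

lemma np_eq_sum (S : Finset G.E) : np S = ∑ e ∈ S, if G.neg e = true then 1 else 0 := by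
  simp [np, negEdges, Finset.sum_boole]

lemma np_union {S T : Finset G.E} (h : Disjoint S T) : np (S ∪ T) = np S + np T := by
  simp only [np_eq_sum]; rw [Finset.sum_union h]

lemma np_eq_zero_iff {S : Finset G.E} : np S = 0 ↔ Even (G.negEdges S).card :=
  ZMod.natCast_eq_zero_iff_even

lemma np_eq_one_iff {S : Finset G.E} : np S = 1 ↔ ¬ Even (G.negEdges S).card := by
  rw [← np_eq_zero_iff]
  have : ∀ a : ZMod 2, a = 1 ↔ ¬ a = 0 := by decide
  exact this _

lemma negEdges_eq_empty {S : Finset G.E} (h : ∀ e ∈ S, G.neg e = false) :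
    G.negEdges S = ∅ := by
  rw [negEdges, Finset.filter_eq_empty_iff]
  intro e he
  simp [h e he]

/-- Two edge-disjoint unbalanced circuits sharing at least two vertices contain a balanced
circuit in their union. -/
lemma IsUnbalancedCircuit.exists_balanced {K K' : Finset G.E} (hK : G.IsUnbalancedCircuit K)
    (hK' : G.IsUnbalancedCircuit K') (hKK' : Disjoint K K') {p q : G.V} (hpq : p ≠ q)
    (hp : p ∈ G.support K) (hq : q ∈ G.support K)
    (hp' : p ∈ G.support K') (hq' : q ∈ G.support K') :
    ∃ C ⊆ K ∪ K', G.IsBalancedCircuit C := by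
  obtain ⟨P₁, W₁, P₂, W₂, p₁, p₂, hd, hP, hW, _⟩ := hK.1.split hp hq hpq
  obtain ⟨P', hP', W', hW', a, ha, b, hb, hab, h', _, hA⟩ :=
    p₁.exists_ear hp' hq' hpq p₁.left_mem
  have hPK : P' ⊆ K := hP'.trans (hP ▸ Finset.subset_union_left)
  obtain ⟨Q₁, X₁, Q₂, X₂, q₁, q₂, hdQ, hQ, hX, _⟩ := hK'.1.split ha hb hab
  have hnp : np P' = np Q₁ ∨ np P' = np Q₂ := by
    have h1 := np_eq_one_iff.2 hK'.2
    rw [← hQ, np_union hdQ] at h1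
    have : ∀ a b c : ZMod 2, b + c = 1 → a = b ∨ a = c := by decide
    exact this _ _ _ h1
  have hadd : ∀ a : ZMod 2, a + a = 0 := by decide
  have key : ∀ Q ⊆ K', ∀ X, Pth Q X a b → np P' = np Q →
      ∃ C ⊆ K ∪ K', G.IsBalancedCircuit C := by
    intro Q hQ X hq hn
    have hd' : Disjoint P' Q := Finset.disjoint_of_subset_left hPK
      (Finset.disjoint_of_subset_right hQ hKK')
    refine ⟨P' ∪ Q, Finset.union_subset_union hPK hQ, (h'.join hq hab hd' ?_).1, ?_⟩
    · intro x hx hx'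
      rw [← hq.support_eq hab] at hx'
      exact hA x hx (support_mono hQ hx')
    · rw [← np_eq_zero_iff, np_union hd', hn, hadd]
  rcases hnp with hn | hn
  · exact key Q₁ (hQ ▸ Finset.subset_union_left) X₁ q₁ hn
  · exact key Q₂ (hQ ▸ Finset.subset_union_right) X₂ q₂ hn

/-! ### Barbells -/

lemma IsUnbalancedCircuit.shortBarbell {C₁ C₂ : Finset G.E} (h₁ : G.IsUnbalancedCircuit C₁)
    (h₂ : G.IsUnbalancedCircuit C₂) (hd : Disjoint C₁ C₂)
    (hc : (G.support C₁ ∩ G.support C₂).card = 1) : G.IsSignedCircuit (C₁ ∪ C₂) :=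
  Or.inr (Or.inl ⟨C₁, C₂, h₁, h₂, hd, hc, rfl⟩)

lemma Pth.disjoint_circuit {P : Finset G.E} {W : Finset G.V} {a b : G.V} (hP : Pth P W a b)
    {C : Finset G.E} {c : G.V} (h : ∀ x ∈ W, x ∈ G.support C → x = c) : Disjoint P C := by
  rw [Finset.disjoint_left]
  intro e he heC
  obtain ⟨x, y, hxy⟩ := exists_ends e
  have key : ∀ z ∈ G.ends e, z = c := fun z hz =>
    h z (hP.ends_mem he hz) (mem_support.2 ⟨e, heC, hz⟩)
  have hx := key x (by rw [hxy]; simp)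
  have hy := key y (by rw [hxy]; simp)
  rw [hx, hy] at hxy
  exact hP.not_loop he hxy

lemma IsUnbalancedCircuit.longBarbell {C₁ C₂ P : Finset G.E} {W : Finset G.V} {a b : G.V}
    (h₁ : G.IsUnbalancedCircuit C₁) (h₂ : G.IsUnbalancedCircuit C₂)
    (hd : Disjoint (G.support C₁) (G.support C₂)) (hP : Pth P W a b)
    (ha : a ∈ G.support C₁) (hb : b ∈ G.support C₂)
    (hWa : ∀ x ∈ W, x ∈ G.support C₁ → x = a) (hWb : ∀ x ∈ W, x ∈ G.support C₂ → x = b) :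
    G.IsSignedCircuit (C₁ ∪ C₂ ∪ P) := by
  have hab : a ≠ b := fun h => Finset.disjoint_left.1 hd ha (h ▸ hb)
  refine Or.inr (Or.inr ⟨C₁, C₂, P, a, b, h₁, h₂, hd, hP.isPath hab, ?_, ?_,
    hP.disjoint_circuit hWa, hP.disjoint_circuit hWb, rfl⟩)
  · rw [hP.support_eq hab]
    ext x
    rw [Finset.mem_inter, Finset.mem_singleton]
    exact ⟨fun h => hWa x h.1 h.2, fun h => h ▸ ⟨hP.left_mem, ha⟩⟩
  · rw [hP.support_eq hab]
    ext x
    rw [Finset.mem_inter, Finset.mem_singleton]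
    exact ⟨fun h => hWb x h.1 h.2, fun h => h ▸ ⟨hP.right_mem, hb⟩⟩

lemma ConnOn.union {S T : Finset G.E} (hS : G.ConnOn S) (hT : G.ConnOn T) {x : G.V}
    (hxS : x ∈ G.support S) (hxT : x ∈ G.support T) : G.ConnOn (S ∪ T) := by
  have key : ∀ u ∈ G.support (S ∪ T), G.Reach (S ∪ T) u x := by
    intro u hu
    rw [support_union, Finset.mem_union] at hu
    rcases hu with hu | hu
    · exact (hS u hu x hxS).mono Finset.subset_union_left
    · exact (hT u hu x hxT).mono Finset.subset_union_right
  exact fun u hu v hv => (key u hu).trans (key v hv).symm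

lemma IsSignedCircuit.connOn {S : Finset G.E} (h : G.IsSignedCircuit S) : G.ConnOn S := by
  rcases h with h | ⟨C₁, C₂, h₁, h₂, hd, hc, rfl⟩ | ⟨C₁, C₂, P, u, v, h₁, h₂, hd, hP, hu, hv, -, -, rfl⟩
  · exact h.1.2.1
  · obtain ⟨x, hx⟩ := Finset.card_pos.1 (by omega : 0 < (G.support C₁ ∩ G.support C₂).card)
    rw [Finset.mem_inter] at hx
    exact h₁.1.2.1.union h₂.1.2.1 hx.1 hx.2
  · have hu' : u ∈ G.support P ∩ G.support C₁ := by rw [hu]; simp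
    have hv' : v ∈ G.support P ∩ G.support C₂ := by rw [hv]; simp
    rw [Finset.mem_inter] at hu' hv'
    have h3 := h₁.1.2.1.union hP.2.1 hu'.2 hu'.1
    have h4 := h3.union h₂.1.2.1 (x := v)
      (by rw [support_union]; exact Finset.mem_union_right _ hv'.1) hv'.2
    have : C₁ ∪ C₂ ∪ P = C₁ ∪ P ∪ C₂ := by ext; simp only [Finset.mem_union]; tauto
    rwa [this]

lemma coverLength_cons (S : Finset G.E) (F : Multiset (Finset G.E)) :
    G.coverLength (S ::ₘ F) = S.card + G.coverLength F := by
  simp [coverLength]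

lemma coverLength_add (F F' : Multiset (Finset G.E)) :
    G.coverLength (F + F') = G.coverLength F + G.coverLength F' := by
  simp [coverLength]

/-! ### Pairing unbalanced circuits along a join -/

lemma mem_iff_of_boundary {S : Finset G.E} {W : Finset G.V} (h : G.boundary S W = ∅) {u v : G.V}
    (hr : G.Reach S u v) : u ∈ W ↔ v ∈ W :=
  ⟨hr.mem_of_boundary h, hr.symm.mem_of_boundary h⟩

lemma exists_pairing (t : Finset G.E → G.V) (𝒰 : Finset (Finset G.E)) (J : Finset G.E)
    (hU : ∀ U ∈ 𝒰, G.IsUnbalancedCircuit U)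
    (ht : ∀ U ∈ 𝒰, t U ∈ G.support U)
    (hd : ∀ U ∈ 𝒰, ∀ U' ∈ 𝒰, U ≠ U' →
      Disjoint U U' ∧ (G.support U ∩ G.support U').card ≤ 1)
    (hJ : ∀ v, bd J v = ∑ U ∈ 𝒰, if v = t U then 1 else 0) :
    ∃ F : Multiset (Finset G.E), (∀ S ∈ F, G.IsSignedCircuit S) ∧
      (∀ S ∈ F, S ⊆ 𝒰.biUnion id ∪ J) ∧
      (∀ U ∈ 𝒰, ∃ S ∈ F, U ⊆ S) ∧
      (∀ W : Finset G.V, (∀ S ∈ F, G.boundary S W = ∅) →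
        ∑ U ∈ 𝒰, (if t U ∈ W then (1 : ZMod 2) else 0) = 0) ∧
      G.coverLength F ≤ ∑ U ∈ 𝒰, U.card + J.card := by
  induction hn : 𝒰.card using Nat.strong_induction_on generalizing 𝒰 J with
  | _ n ih =>
  subst hn
  have hadd : ∀ a : ZMod 2, a + a = 0 := by decide
  rcases 𝒰.eq_empty_or_nonempty with rfl | ⟨U₁, h₁⟩
  · exact ⟨0, by simp, by simp, by simp, by simp, by simp [coverLength]⟩
  -- remove two circuits joined by a signed circuit `B`
  have step : ∀ U₂ ∈ 𝒰, U₂ ≠ U₁ → ∀ Q ⊆ J,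
      (∀ v, bd Q v = (if v = t U₁ then 1 else 0) + (if v = t U₂ then 1 else 0)) →
      ∀ B, G.IsSignedCircuit B → U₁ ⊆ B → U₂ ⊆ B → B ⊆ U₁ ∪ U₂ ∪ Q →
      ∃ F : Multiset (Finset G.E), (∀ S ∈ F, G.IsSignedCircuit S) ∧
      (∀ S ∈ F, S ⊆ 𝒰.biUnion id ∪ J) ∧
      (∀ U ∈ 𝒰, ∃ S ∈ F, U ⊆ S) ∧
      (∀ W : Finset G.V, (∀ S ∈ F, G.boundary S W = ∅) →
        ∑ U ∈ 𝒰, (if t U ∈ W then (1 : ZMod 2) else 0) = 0) ∧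
      G.coverLength F ≤ ∑ U ∈ 𝒰, U.card + J.card := by
    intro U₂ h₂ hne Q hQ hbQ B hB hB₁ hB₂ hBs
    set 𝒰' := (𝒰.erase U₁).erase U₂ with h𝒰'
    have h₂' : U₂ ∈ 𝒰.erase U₁ := Finset.mem_erase.2 ⟨hne, h₂⟩
    have hsub : ∀ U ∈ 𝒰', U ∈ 𝒰 := fun U hU =>
      Finset.mem_of_mem_erase (Finset.mem_of_mem_erase hU)
    have hlt : 𝒰'.card < 𝒰.card :=
      (Finset.card_erase_lt_of_mem h₂').trans (Finset.card_erase_lt_of_mem h₁)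
    have hsum : ∀ {M : Type} [AddCommMonoid M] (f : Finset G.E → M),
        ∑ U ∈ 𝒰, f U = f U₁ + (f U₂ + ∑ U ∈ 𝒰', f U) := by
      intro M _ f
      rw [← Finset.add_sum_erase 𝒰 f h₁, ← Finset.add_sum_erase (𝒰.erase U₁) f h₂']
    have hbJ : ∀ v, bd (J \ Q) v = ∑ U ∈ 𝒰', if v = t U then 1 else 0 := by
      intro v
      have h := hJ v
      rw [hsum, bd_eq_sum, ← Finset.sum_sdiff hQ, ← bd_eq_sum, ← bd_eq_sum, hbQ] at h
      linear_combination h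
    obtain ⟨F, f1, f2, f3, f4, f5⟩ := ih _ hlt 𝒰' (J \ Q) (fun U h => hU U (hsub U h))
      (fun U h => ht U (hsub U h)) (fun U h U' h' => hd U (hsub U h) U' (hsub U' h')) hbJ rfl
    have hsubU : ∀ U ∈ 𝒰, U ⊆ 𝒰.biUnion id := fun U h => Finset.subset_biUnion_of_mem id h
    refine ⟨B ::ₘ F, ?_, ?_, ?_, ?_, ?_⟩
    · intro S hS
      rcases Multiset.mem_cons.1 hS with rfl | hS
      · exact hB
      · exact f1 S hS
    · intro S hS
      rcases Multiset.mem_cons.1 hS with rfl | hS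
      · exact hBs.trans (Finset.union_subset_union
          (Finset.union_subset (hsubU _ h₁) (hsubU _ h₂)) hQ)
      · refine (f2 S hS).trans (Finset.union_subset_union ?_ Finset.sdiff_subset)
        exact Finset.biUnion_subset_biUnion_of_subset_left id hsub
    · intro U hUm
      by_cases e1 : U = U₁
      · exact ⟨B, by simp, e1 ▸ hB₁⟩
      · by_cases e2 : U = U₂
        · exact ⟨B, by simp, e2 ▸ hB₂⟩
        · obtain ⟨S, hS, hUS⟩ :=
            f3 U (Finset.mem_erase.2 ⟨e2, Finset.mem_erase.2 ⟨e1, hUm⟩⟩)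
          exact ⟨S, Multiset.mem_cons_of_mem hS, hUS⟩
    · intro W hW
      rw [hsum, f4 W fun S hS => hW S (Multiset.mem_cons_of_mem hS), add_zero]
      have hr := hB.connOn _ (support_mono hB₁ (ht U₁ h₁)) _ (support_mono hB₂ (ht U₂ h₂))
      rw [if_congr (mem_iff_of_boundary (hW B (by simp)) hr) rfl rfl]
      exact hadd _
    · rw [coverLength_cons, hsum]
      have c1 : B.card ≤ U₁.card + U₂.card + Q.card :=
        (Finset.card_le_card hBs).trans ((Finset.card_union_le _ _).trans
          (Nat.add_le_add_right (Finset.card_union_le _ _) _))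
      have c2 := Finset.card_sdiff_add_card_eq_card hQ
      omega
  -- two circuits sharing a vertex form a short barbell
  have short : ∀ U₂ ∈ 𝒰, U₂ ≠ U₁ → (G.support U₁ ∩ G.support U₂).Nonempty →
      G.IsSignedCircuit (U₁ ∪ U₂) := by
    intro U₂ h₂ hne hx
    have h := hd U₁ h₁ U₂ h₂ hne.symm
    exact (hU U₁ h₁).shortBarbell (hU U₂ h₂) h.1
      (le_antisymm h.2 (Finset.card_pos.2 hx))
  by_cases hsame : ∃ U₂ ∈ 𝒰, U₂ ≠ U₁ ∧ t U₂ = t U₁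
  · obtain ⟨U₂, h₂, hne, heq⟩ := hsame
    refine step U₂ h₂ hne ∅ (by simp) ?_ (U₁ ∪ U₂) ?_ Finset.subset_union_left
      Finset.subset_union_right Finset.subset_union_left
    · intro v
      rw [heq, hadd, bd_empty]
    · exact short U₂ h₂ hne ⟨t U₁, Finset.mem_inter.2 ⟨ht U₁ h₁, heq ▸ ht U₂ h₂⟩⟩
  · push Not at hsame
    have hodd : bd J (t U₁) ≠ 0 := by
      rw [hJ, Finset.sum_eq_single U₁]
      · simp
      · intro U hUm hne
        rw [if_neg (hsame U hUm hne).symm]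
      · exact fun h => absurd h₁ h
    obtain ⟨v, hv, hr, hb⟩ := exists_reach_of_bd hodd
    rw [hJ] at hb
    obtain ⟨U₂, h₂, hU₂⟩ := Finset.exists_ne_zero_of_sum_ne_zero hb
    have hvt : v = t U₂ := by by_contra h; rw [if_neg h] at hU₂; exact hU₂ rfl
    have hne : U₂ ≠ U₁ := by rintro rfl; exact hv hvt
    subst hvt
    obtain ⟨Q, hQ, W, hp⟩ := hr.exists_pth
    by_cases hx : (G.support U₁ ∩ G.support U₂).Nonempty
    · exact step U₂ h₂ hne Q hQ hp.bd_eq (U₁ ∪ U₂) (short U₂ h₂ hne hx)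
        Finset.subset_union_left Finset.subset_union_right Finset.subset_union_left
    · obtain ⟨Q', hQs, W', hW', a, ha, b, hb, hp', hWa, hWb⟩ := hp.trim (ht U₁ h₁) (ht U₂ h₂)
      have hdis : Disjoint (G.support U₁) (G.support U₂) :=
        Finset.disjoint_iff_inter_eq_empty.2 (Finset.not_nonempty_iff_eq_empty.1 hx)
      refine step U₂ h₂ hne Q hQ hp.bd_eq (U₁ ∪ U₂ ∪ Q') ?_ ?_ ?_ ?_
      · exact (hU U₁ h₁).longBarbell (hU U₂ h₂) hdis hp' ha hb hWa hWb
      · exact Finset.subset_union_left.trans Finset.subset_union_left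
      · exact Finset.subset_union_right.trans Finset.subset_union_left
      · exact Finset.union_subset_union le_rfl hQs

/-! ### Joins inside a spanning set -/

lemma exists_join (T : Finset G.E) (g : G.V → ZMod 2)
    (hg : ∀ W, G.boundary T W = ∅ → ∑ v ∈ W, g v = 0) :
    ∃ J ⊆ T, ∀ v, bd J v = g v := by
  induction hn : (Finset.univ.filter fun v => g v ≠ 0).card using Nat.strong_induction_on
    generalizing g with
  | _ n ih =>
  subst hn
  by_cases h0 : ∀ v, g v = 0
  · exact ⟨∅, by simp, fun v => by rw [h0 v, bd_empty]⟩
  push Not at h0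
  obtain ⟨u, hu⟩ := h0
  have hadd : ∀ a : ZMod 2, a + a = 0 := by decide
  have hone : ∀ a : ZMod 2, a ≠ 0 → a = 1 := by decide
  have hex : ∃ v ∈ comp T u, v ≠ u ∧ g v ≠ 0 := by
    by_contra! hcon
    have h1 := hg _ (boundary_comp T u)
    rw [Finset.sum_eq_single u] at h1
    · exact hu h1
    · exact hcon
    · exact fun h => absurd (mem_comp.2 (Reach.refl T u)) h
  obtain ⟨v, hv, hvu, hgv⟩ := hex
  obtain ⟨P, hP, W, hp⟩ := (mem_comp.1 hv).exists_pth
  have hlt : (Finset.univ.filter fun x => g x + bd P x ≠ 0).card <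
      (Finset.univ.filter fun x => g x ≠ 0).card := by
    apply Finset.card_lt_card
    refine ⟨?_, ?_⟩
    · intro x
      simp only [Finset.mem_filter, Finset.mem_univ, true_and]
      intro hx
      rw [hp.bd_eq] at hx
      by_cases h1 : x = u
      · rw [h1]; exact hu
      · by_cases h2 : x = v
        · rw [h2]; exact hgv
        · rw [if_neg h1, if_neg h2] at hx
          simpa using hx
    · intro hsub
      have := hsub (show u ∈ _ by simpa using hu)
      simp only [Finset.mem_filter, Finset.mem_univ, true_and] at this
      apply this
      rw [hp.bd_eq, hone _ hu, if_pos rfl, if_neg hvu.symm]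
      decide
  obtain ⟨J, hJ, hbJ⟩ := ih _ hlt (fun x => g x + bd P x) (fun W' hW' => by
    rw [Finset.sum_add_distrib, hg W' hW', sum_bd, zero_add]
    have : G.boundary P W' = ∅ := Finset.subset_empty.1 (hW' ▸ boundary_mono hP W')
    rw [this]; simp) rfl
  refine ⟨symmDiff J P, ?_, ?_⟩
  · exact (Finset.symmDiff_subset_union).trans (Finset.union_subset hJ hP)
  · intro x
    rw [bd_symmDiff, hbJ x, add_assoc, hadd, add_zero]

/-! ### Covering an even set by signed circuits -/

/-- The parity of the number of negative edges of `S` with all ends in `W`. -/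
def nin (W : Finset G.V) (S : Finset G.E) : ZMod 2 :=
  ∑ e ∈ S, if G.neg e = true ∧ ∀ x ∈ G.ends e, x ∈ W then 1 else 0

lemma nin_of_connOn {W : Finset G.V} {K : Finset G.E} (hK : G.ConnOn K)
    (hW : G.boundary K W = ∅) {u : G.V} (hu : u ∈ G.support K) :
    nin W K = if u ∈ W then np K else 0 := by
  have key : ∀ e ∈ K, ∀ x ∈ G.ends e, (x ∈ W ↔ u ∈ W) := fun e he x hx =>
    (mem_iff_of_boundary hW (hK u hu x (mem_support.2 ⟨e, he, hx⟩))).symm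
  rw [nin]
  split_ifs with h
  · rw [np_eq_sum]
    refine Finset.sum_congr rfl fun e he => ?_
    have : (∀ x ∈ G.ends e, x ∈ W) := fun x hx => (key e he x hx).2 h
    have h3 : (G.neg e = true ∧ ∀ x ∈ G.ends e, x ∈ W) ↔ G.neg e = true :=
      ⟨And.left, fun h => ⟨h, this⟩⟩
    simp only [h3]
  · refine Finset.sum_eq_zero fun e he => ?_
    obtain ⟨x, y, hxy⟩ := exists_ends e
    have hx : x ∈ G.ends e := by rw [hxy]; simp
    rw [if_neg]
    rintro ⟨-, h'⟩
    exact h ((key e he x hx).1 (h' x hx))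

lemma Dec.sum_eq {𝒞 : Finset (Finset G.E)} {S : Finset G.E} (h : Dec 𝒞 S) {M : Type*}
    [AddCommMonoid M] (f : G.E → M) : ∑ e ∈ S, f e = ∑ K ∈ 𝒞, ∑ e ∈ K, f e := by
  obtain ⟨-, h2, rfl⟩ := h
  rw [Finset.sum_biUnion]
  · rfl
  · intro K hK K' hK' hne
    exact h2 K hK K' hK' hne

lemma Dec.card_eq {𝒞 : Finset (Finset G.E)} {S : Finset G.E} (h : Dec 𝒞 S) :
    S.card = ∑ K ∈ 𝒞, K.card := by
  simpa using h.sum_eq (fun _ => (1 : ℕ))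

lemma Dec.subset {𝒞 : Finset (Finset G.E)} {S : Finset G.E} (h : Dec 𝒞 S) {K : Finset G.E}
    (hK : K ∈ 𝒞) : K ⊆ S := by
  rw [← h.2.2]; exact Finset.subset_biUnion_of_mem id hK

lemma Dec.exists_mem {𝒞 : Finset (Finset G.E)} {S : Finset G.E} (h : Dec 𝒞 S) {e : G.E}
    (he : e ∈ S) : ∃ K ∈ 𝒞, e ∈ K := by
  rw [← h.2.2, Finset.mem_biUnion] at he
  exact he

/-- An even set splits into balanced circuits and unbalanced circuits that pairwise share at
most one vertex. -/
lemma Ev.exists_balanced_dec {Z : Finset G.E} (hZ : Ev Z) :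
    ∃ B ℬ 𝒰, B ⊆ Z ∧ Dec ℬ B ∧ Dec 𝒰 (Z \ B) ∧ (∀ K ∈ ℬ, G.IsBalancedCircuit K) ∧
      (∀ U ∈ 𝒰, G.IsUnbalancedCircuit U) ∧
      ∀ U ∈ 𝒰, ∀ U' ∈ 𝒰, U ≠ U' →
        Disjoint U U' ∧ (G.support U ∩ G.support U').card ≤ 1 := by
  have hne : (Z.powerset.filter fun B =>
      ∃ ℬ, Dec ℬ B ∧ ∀ K ∈ ℬ, G.IsBalancedCircuit K).Nonempty :=
    ⟨∅, by
      simp only [Finset.mem_filter, Finset.mem_powerset]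
      exact ⟨by simp, ∅, ⟨by simp, by simp, by simp⟩, by simp⟩⟩
  obtain ⟨B, hB, hmax⟩ := Finset.exists_max_image _ Finset.card hne
  simp only [Finset.mem_filter, Finset.mem_powerset] at hB hmax
  obtain ⟨hBZ, ℬ, hℬ, hbal⟩ := hB
  have hBev : Ev B := by
    intro v
    rw [bd_eq_sum, hℬ.sum_eq]
    refine Finset.sum_eq_zero fun K hK => ?_
    rw [← bd_eq_sum]
    exact (hℬ.1 K hK).ev v
  have hno : ∀ K ⊆ Z \ B, ¬ G.IsBalancedCircuit K := by
    intro K hK hKb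
    have hd : Disjoint K B := Finset.disjoint_of_subset_left hK Finset.sdiff_disjoint
    have h1 := hmax (K ∪ B) ⟨Finset.union_subset (hK.trans Finset.sdiff_subset) hBZ,
      insert K ℬ, hℬ.insert hKb.1 hd, fun K' hK' => by
        rcases Finset.mem_insert.1 hK' with rfl | hK'
        · exact hKb
        · exact hbal K' hK'⟩
    rw [Finset.card_union_of_disjoint hd] at h1
    have := Finset.card_pos.2 hKb.1.1
    omega
  obtain ⟨𝒰, h𝒰⟩ := (ev_sdiff hZ hBev hBZ).exists_dec
  have hunb : ∀ U ∈ 𝒰, G.IsUnbalancedCircuit U := fun U hU =>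
    ⟨h𝒰.1 U hU, fun h => hno U (h𝒰.subset hU) ⟨h𝒰.1 U hU, h⟩⟩
  refine ⟨B, ℬ, 𝒰, hBZ, hℬ, h𝒰, hbal, hunb, fun U hU U' hU' hne => ?_⟩
  have hd := h𝒰.2.1 U hU U' hU' hne
  refine ⟨hd, ?_⟩
  by_contra! hcard
  obtain ⟨p, hp, q, hq, hpq⟩ := Finset.one_lt_card.1 hcard
  rw [Finset.mem_inter] at hp hq
  obtain ⟨C, hC, hCb⟩ :=
    (hunb U hU).exists_balanced (hunb U' hU') hd hpq hp.1 hq.1 hp.2 hq.2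
  exact hno C (hC.trans (Finset.union_subset (h𝒰.subset hU) (h𝒰.subset hU'))) hCb

lemma card_symmDiff_add {α : Type*} (S T : Finset α) :
    (symmDiff S T).card + 2 * (S ∩ T).card = S.card + T.card := by
  have h1 : symmDiff S T = (S \ T) ∪ (T \ S) := rfl
  rw [h1, Finset.card_union_of_disjoint disjoint_sdiff_sdiff]
  have h2 := Finset.card_sdiff_add_card_inter S T
  have h3 := Finset.card_sdiff_add_card_inter T S
  rw [Finset.inter_comm T S] at h3
  omega

/-- An even set having an even number of negative edges in every component is covered by
short signed circuits, which moreover cover every bridge with an odd number of negative edges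
on one side. -/
theorem exists_pass {T Z : Finset G.E} (hT : ∀ u v, G.Reach Finset.univ u v → G.Reach T u v)
    (hZ : Ev Z) (hpar : ∀ W, G.boundary Finset.univ W = ∅ → nin W Z = 0) :
    ∃ F : Multiset (Finset G.E), (∀ S ∈ F, G.IsSignedCircuit S) ∧ (∀ S ∈ F, S ⊆ T ∪ Z) ∧
      (∀ e ∈ Z, ∃ S ∈ F, e ∈ S) ∧
      (∀ b W, G.boundary Finset.univ W = {b} → nin W Z ≠ 0 → ∃ S ∈ F, b ∈ S) ∧
      2 * G.coverLength F ≤ 2 * (T \ Z).card + 3 * Z.card := by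
  obtain ⟨B, ℬ, 𝒰, hBZ, hℬ, h𝒰, hbal, hunb, hpair⟩ := hZ.exists_balanced_dec
  rcases isEmpty_or_nonempty G.V with hV | hV
  · have hno : ∀ e : G.E, False := fun e => hV.false (exists_ends e).choose
    exact ⟨0, by simp, by simp, fun e => (hno e).elim, fun e => (hno e).elim,
      by simp [coverLength]⟩
  have hex : ∀ U ∈ 𝒰, ∃ v, v ∈ G.support U := by
    intro U hU
    obtain ⟨e, he⟩ := (hunb U hU).1.1
    obtain ⟨x, y, h⟩ := exists_ends e
    exact ⟨x, mem_support.2 ⟨e, he, by rw [h]; simp⟩⟩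
  choose! t ht using hex
  have hninZ : ∀ W, (∀ K ∈ ℬ, G.boundary K W = ∅) → (∀ U ∈ 𝒰, G.boundary U W = ∅) →
      nin W Z = ∑ U ∈ 𝒰, if t U ∈ W then 1 else 0 := by
    intro W h1 h2
    have e1 : nin W B = 0 := by
      rw [nin, hℬ.sum_eq]
      refine Finset.sum_eq_zero fun K hK => ?_
      obtain ⟨e, he⟩ := (hbal K hK).1.1
      obtain ⟨x, y, h⟩ := exists_ends e
      rw [← nin, nin_of_connOn (hbal K hK).1.2.1 (h1 K hK)
        (mem_support.2 ⟨e, he, show x ∈ G.ends e by rw [h]; simp⟩),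
        np_eq_zero_iff.2 (hbal K hK).2, ite_self]
    have e2 : nin W (Z \ B) = ∑ U ∈ 𝒰, if t U ∈ W then 1 else 0 := by
      rw [nin, h𝒰.sum_eq]
      refine Finset.sum_congr rfl fun U hU => ?_
      rw [← nin, nin_of_connOn (hunb U hU).1.2.1 (h2 U hU) (ht U hU),
        np_eq_one_iff.2 (hunb U hU).2]
    rw [nin, ← Finset.sum_sdiff hBZ, ← nin, ← nin, e1, e2, add_zero]
  have hbsub : ∀ {S S' : Finset G.E} {W}, S ⊆ S' → G.boundary S' W = ∅ →
      G.boundary S W = ∅ := fun h h' => Finset.subset_empty.1 (h' ▸ boundary_mono h _)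
  -- a minimum join
  obtain ⟨J₀, hJ₀, hb₀⟩ := exists_join T (fun v => ∑ U ∈ 𝒰, if v = t U then 1 else 0) (by
    intro W hW
    have hWu : G.boundary Finset.univ W = ∅ := by
      rw [Finset.eq_empty_iff_forall_notMem]
      intro e he
      obtain ⟨x, y, h⟩ := exists_ends e
      have hr := hT x y (reach_of_ends (Finset.mem_univ e) h)
      have hi := mem_iff_of_boundary hW hr
      rw [mem_boundary_of_ends h] at he
      tauto
    have h0 := hpar W hWu
    rw [hninZ W (fun K _ => hbsub (Finset.subset_univ _) hWu)
      (fun K _ => hbsub (Finset.subset_univ _) hWu)] at h0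
    rw [Finset.sum_comm]
    refine Eq.trans ?_ h0
    refine Finset.sum_congr rfl fun U _ => ?_
    rw [Finset.sum_ite_eq'])
  have hne : ((T ∪ Z).powerset.filter fun J =>
      ∀ v, bd J v = ∑ U ∈ 𝒰, if v = t U then 1 else 0).Nonempty :=
    ⟨J₀, by
      simp only [Finset.mem_filter, Finset.mem_powerset]
      exact ⟨hJ₀.trans Finset.subset_union_left, hb₀⟩⟩
  obtain ⟨J, hJ, hmin⟩ := Finset.exists_min_image _ Finset.card hne
  simp only [Finset.mem_filter, Finset.mem_powerset] at hJ hmin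
  obtain ⟨hJs, hbJ⟩ := hJ
  have hJZ : 2 * (J ∩ Z).card ≤ Z.card := by
    have h1 := hmin (symmDiff J Z) ⟨Finset.symmDiff_subset_union.trans
      (Finset.union_subset hJs Finset.subset_union_right), fun v => by
        rw [bd_symmDiff, hZ v, add_zero, hbJ]⟩
    have h2 := card_symmDiff_add J Z
    omega
  have hJc : J.card ≤ (T \ Z).card + (J ∩ Z).card := by
    rw [← Finset.card_sdiff_add_card_inter J Z]
    refine Nat.add_le_add_right (Finset.card_le_card ?_) _
    intro e he
    rw [Finset.mem_sdiff] at he ⊢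
    refine ⟨?_, he.2⟩
    rcases Finset.mem_union.1 (hJs he.1) with h | h
    · exact h
    · exact absurd h he.2
  obtain ⟨F, f1, f2, f3, f4, f5⟩ := exists_pairing t 𝒰 J hunb ht hpair hbJ
  have hℬF : ∀ S ∈ ℬ.val, S ⊆ B := fun S hS => hℬ.subset hS
  refine ⟨ℬ.val + F, ?_, ?_, ?_, ?_, ?_⟩
  · intro S hS
    rcases Multiset.mem_add.1 hS with hS | hS
    · exact Or.inl (hbal S hS)
    · exact f1 S hS
  · intro S hS
    rcases Multiset.mem_add.1 hS with hS | hS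
    · exact ((hℬF S hS).trans hBZ).trans Finset.subset_union_right
    · refine (f2 S hS).trans (Finset.union_subset ?_ hJs)
      rw [h𝒰.2.2]
      exact Finset.sdiff_subset.trans Finset.subset_union_right
  · intro e he
    by_cases heB : e ∈ B
    · obtain ⟨K, hK, heK⟩ := hℬ.exists_mem heB
      exact ⟨K, Multiset.mem_add.2 (Or.inl hK), heK⟩
    · obtain ⟨U, hU, heU⟩ := h𝒰.exists_mem (Finset.mem_sdiff.2 ⟨he, heB⟩)
      obtain ⟨S, hS, hUS⟩ := f3 U hU
      exact ⟨S, Multiset.mem_add.2 (Or.inr hS), hUS heU⟩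
  · intro b W hbW hodd
    by_contra! hcon
    have hS : ∀ S ∈ ℬ.val + F, G.boundary S W = ∅ := by
      intro S hS
      rw [Finset.eq_empty_iff_forall_notMem]
      intro e he
      have h1 := boundary_mono (Finset.subset_univ S) W he
      rw [hbW, Finset.mem_singleton] at h1
      exact hcon S hS (h1 ▸ boundary_subset _ _ he)
    apply hodd
    rw [hninZ W (fun K hK => hS K (Multiset.mem_add.2 (Or.inl hK)))]
    · exact f4 W fun S hSF => hS S (Multiset.mem_add.2 (Or.inr hSF))
    · intro U hU
      obtain ⟨S, hSF, hUS⟩ := f3 U hU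
      exact hbsub hUS (hS S (Multiset.mem_add.2 (Or.inr hSF)))
  · rw [coverLength_add]
    have c1 : G.coverLength ℬ.val = B.card := hℬ.card_eq.symm
    have c2 := h𝒰.card_eq
    have c3 := Finset.card_sdiff_add_card_eq_card hBZ
    omega

/-! ### Passes through the negative edges -/

/-- The edge `e` belongs to a member of the family `F`. -/
def Covers (F : Multiset (Finset G.E)) (e : G.E) : Prop := ∃ S ∈ F, e ∈ S

lemma Covers.add_left {F F' : Multiset (Finset G.E)} {e : G.E} (h : Covers F e) :
    Covers (F + F') e := by
  obtain ⟨S, hS, he⟩ := h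
  exact ⟨S, Multiset.mem_add.2 (Or.inl hS), he⟩

lemma Covers.add_right {F F' : Multiset (Finset G.E)} {e : G.E} (h : Covers F' e) :
    Covers (F + F') e := by
  obtain ⟨S, hS, he⟩ := h
  exact ⟨S, Multiset.mem_add.2 (Or.inr hS), he⟩

/-- `F` covers the edges of `S`, the partners of edges of `S` in 2-edge-cuts, and the bridges
with an odd number of edges of `S` on one side. -/
def PassCover (F : Multiset (Finset G.E)) (S : Finset G.E) : Prop :=
  (∀ e ∈ S, Covers F e) ∧
  (∀ b e W, G.boundary Finset.univ W = {b, e} → b ≠ e → e ∈ S → Covers F b) ∧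
  (∀ b W, G.boundary Finset.univ W = {b} → nin W S ≠ 0 → Covers F b)

/-- Every set of non-`T` edges extends to an even set using edges of `T`. -/
lemma exists_fundamental {T : Finset G.E}
    (hT : ∀ u v, G.Reach Finset.univ u v → G.Reach T u v) (S : Finset G.E) (hS : Disjoint S T) :
    ∃ Z, Ev Z ∧ Z ⊆ T ∪ S ∧ S ⊆ Z := by
  induction S using Finset.induction_on with
  | empty => exact ⟨∅, ev_empty, by simp, by simp⟩
  | @insert e S he ih =>
    obtain ⟨heT, hST⟩ := Finset.disjoint_insert_left.1 hS
    obtain ⟨Z, h1, h2, h3⟩ := ih hST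
    obtain ⟨x, y, h⟩ := exists_ends e
    obtain ⟨P, hP, W, hp⟩ := (hT x y (reach_of_ends (Finset.mem_univ e) h)).exists_pth
    have hc := (hp.close h fun h => heT (hP h)).1
    refine ⟨symmDiff Z (insert e P), h1.symmDiff hc.ev, ?_, ?_⟩
    · refine Finset.symmDiff_subset_union.trans ?_
      intro f
      simp only [Finset.mem_union, Finset.mem_insert]
      rintro (hf | rfl | hf)
      · rcases Finset.mem_union.1 (h2 hf) with h | h
        · exact Or.inl h
        · exact Or.inr (Or.inr h)
      · exact Or.inr (Or.inl rfl)
      · exact Or.inl (hP hf)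
    · intro f hf
      rw [Finset.mem_symmDiff]
      rcases Finset.mem_insert.1 hf with rfl | hf
      · refine Or.inr ⟨by simp, fun hZ => ?_⟩
        rcases Finset.mem_union.1 (h2 hZ) with h | h
        · exact heT h
        · exact he h
      · refine Or.inl ⟨h3 hf, ?_⟩
        rw [Finset.mem_insert, not_or]
        exact ⟨fun h => he (h ▸ hf), fun h => Finset.disjoint_left.1 hST hf (hP h)⟩

/-- The negative edges. -/
abbrev NE (G : SignedMultigraph) : Finset G.E := G.negEdges Finset.univ

/-- The positive edges. -/
def PE (G : SignedMultigraph) : Finset G.E := Finset.univ.filter fun e => G.neg e = false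

lemma mem_NE {e : G.E} : e ∈ G.NE ↔ G.neg e = true := by simp [NE, negEdges]

lemma mem_PE {e : G.E} : e ∈ G.PE ↔ G.neg e = false := by simp [PE]

lemma mem_PE_or_NE (e : G.E) : e ∈ G.PE ∨ e ∈ G.NE := by
  rw [mem_PE, mem_NE]; cases G.neg e <;> simp

lemma disjoint_NE_PE {S T : Finset G.E} (hS : S ⊆ G.NE) (hT : T ⊆ G.PE) : Disjoint S T := by
  rw [Finset.disjoint_left]
  intro e he he'
  have h1 := mem_NE.1 (hS he)
  have h2 := mem_PE.1 (hT he')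
  rw [h1] at h2
  exact Bool.noConfusion h2

lemma nin_congr {S Z T : Finset G.E} (hT : T ⊆ G.PE) (hZ : Z ⊆ T ∪ S) (hSZ : S ⊆ Z)
    (W : Finset G.V) : nin W Z = nin W S := by
  unfold nin
  symm
  refine Finset.sum_subset hSZ fun e he heS => ?_
  have h1 : e ∈ T := by
    rcases Finset.mem_union.1 (hZ he) with h | h
    · exact h
    · exact absurd h heS
  rw [if_neg]
  rintro ⟨h, -⟩
  rw [mem_PE.1 (hT h1)] at h
  exact Bool.noConfusion h

lemma even_boundary_pair {Z : Finset G.E} (hZ : Ev Z) {W : Finset G.V} {b e : G.E}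
    (hW : G.boundary Finset.univ W = {b, e}) (heZ : e ∈ Z) : b ∈ Z := by
  by_contra hb
  have h1 : G.boundary Z W = {e} := by
    ext f
    rw [Finset.mem_singleton]
    constructor
    · intro hf
      have := boundary_mono (Finset.subset_univ Z) W hf
      rw [hW, Finset.mem_insert, Finset.mem_singleton] at this
      rcases this with rfl | h
      · exact absurd (boundary_subset _ _ hf) hb
      · exact h
    · rintro rfl
      have : f ∈ G.boundary Finset.univ W := by rw [hW]; simp
      rw [mem_boundary] at this ⊢
      exact ⟨heZ, this.2⟩
  have h2 := hZ.boundary_card W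
  rw [h1] at h2
  simp at h2

lemma exists_passCover {T Z S : Finset G.E}
    (hT : ∀ u v, G.Reach Finset.univ u v → G.Reach T u v) (hTP : T ⊆ G.PE)
    (hZ : Ev Z) (hZs : Z ⊆ T ∪ S) (hSZ : S ⊆ Z)
    (hpar : ∀ W, G.boundary Finset.univ W = ∅ → nin W S = 0) :
    ∃ F : Multiset (Finset G.E), (∀ K ∈ F, G.IsSignedCircuit K) ∧ (∀ K ∈ F, K ⊆ T ∪ S) ∧
      PassCover F S ∧ 2 * G.coverLength F ≤ 2 * T.card + (Z ∩ T).card + 3 * S.card := by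
  have hn := nin_congr hTP hZs hSZ
  obtain ⟨F, f1, f2, f3, f4, f5⟩ := exists_pass hT hZ fun W hW => (hn W).trans (hpar W hW)
  refine ⟨F, f1, ?_, ⟨fun e he => f3 e (hSZ he), ?_, ?_⟩, ?_⟩
  · intro K hK
    exact (f2 K hK).trans (Finset.union_subset Finset.subset_union_left hZs)
  · intro b e W hW hbe he
    exact f3 b (even_boundary_pair hZ hW (hSZ he))
  · intro b W hW hodd
    exact f4 b W hW (by rwa [hn])
  · have h1 : Z = (Z ∩ T) ∪ S := by
      ext e
      simp only [Finset.mem_union, Finset.mem_inter]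
      constructor
      · intro he
        rcases Finset.mem_union.1 (hZs he) with h | h
        · exact Or.inl ⟨he, h⟩
        · exact Or.inr h
      · rintro (h | h)
        · exact h.1
        · exact hSZ h
    have h2 : Z.card ≤ (Z ∩ T).card + S.card := by
      conv_lhs => rw [h1]
      exact Finset.card_union_le _ _
    have h3 := Finset.card_sdiff_add_card_inter T Z
    rw [Finset.inter_comm] at h3
    omega

lemma IsUnbalancedCircuit.exists_neg {C : Finset G.E} (h : G.IsUnbalancedCircuit C) :
    ∃ e ∈ C, e ∈ G.NE := by
  by_contra! hcon
  apply h.2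
  rw [negEdges_eq_empty]
  · simp
  · intro e he
    have := hcon e he
    rw [mem_NE] at this
    simpa using this

/-- A signed circuit with at most two negative edges, one of which is `e`, contains the other
one, and `e` lies on a circuit. -/
lemma IsSignedCircuit.of_two {K : Finset G.E} (hK : G.IsSignedCircuit K) {e f : G.E}
    (hef : ∀ g ∈ K, g ∈ G.NE → g = e ∨ g = f) (heK : e ∈ K) (he : e ∈ G.NE) :
    f ∈ K ∧ ∃ C ⊆ K, G.IsCircuit C ∧ e ∈ C := by
  have key : ∀ C₁ C₂, G.IsUnbalancedCircuit C₁ → G.IsUnbalancedCircuit C₂ → Disjoint C₁ C₂ →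
      C₁ ⊆ K → C₂ ⊆ K → f ∈ K ∧ ∃ C ⊆ K, G.IsCircuit C ∧ e ∈ C := by
    intro C₁ C₂ h₁ h₂ hd k₁ k₂
    obtain ⟨g₁, m₁, n₁⟩ := h₁.exists_neg
    obtain ⟨g₂, m₂, n₂⟩ := h₂.exists_neg
    have hne : g₁ ≠ g₂ := fun h => Finset.disjoint_left.1 hd m₁ (h ▸ m₂)
    rcases hef g₁ (k₁ m₁) n₁ with rfl | rfl
    · rcases hef g₂ (k₂ m₂) n₂ with rfl | rfl
      · exact absurd rfl hne
      · exact ⟨k₂ m₂, C₁, k₁, h₁.1, m₁⟩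
    · rcases hef g₂ (k₂ m₂) n₂ with rfl | rfl
      · exact ⟨k₁ m₁, C₂, k₂, h₂.1, m₂⟩
      · exact absurd rfl hne
  rcases hK with h | ⟨C₁, C₂, h₁, h₂, hd, hc, rfl⟩ | ⟨C₁, C₂, P, u, v, h₁, h₂, hd, hP, -, -, -, -, rfl⟩
  · refine ⟨?_, K, le_rfl, h.1, heK⟩
    by_contra hf
    have h1 : G.negEdges K = {e} := by
      ext g
      rw [Finset.mem_singleton, negEdges, Finset.mem_filter]
      constructor
      · rintro ⟨hg, hn⟩
        rcases hef g hg (mem_NE.2 hn) with h | h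
        · exact h
        · exact absurd (h ▸ hg) hf
      · rintro rfl
        exact ⟨heK, mem_NE.1 he⟩
    have h2 := h.2
    rw [h1] at h2
    simp at h2
  · exact key C₁ C₂ h₁ h₂ hd Finset.subset_union_left Finset.subset_union_right
  · refine key C₁ C₂ h₁ h₂ ?_ (Finset.subset_union_left.trans Finset.subset_union_left)
      (Finset.subset_union_right.trans Finset.subset_union_left)
    rw [Finset.disjoint_left]
    intro g hg hg'
    obtain ⟨x, y, h⟩ := exists_ends g
    have hx : x ∈ G.ends g := by rw [h]; simp
    exact Finset.disjoint_left.1 hd (mem_support.2 ⟨g, hg, hx⟩) (mem_support.2 ⟨g, hg', hx⟩)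

lemma exists_passCover_pair {T S : Finset G.E}
    (hT : ∀ u v, G.Reach Finset.univ u v → G.Reach T u v) (hTP : T ⊆ G.PE) (hS : S ⊆ G.NE)
    (hpar : ∀ W, G.boundary Finset.univ W = ∅ → nin W S = 0) (hcard : S.card = 2) :
    ∃ F : Multiset (Finset G.E), (∀ K ∈ F, G.IsSignedCircuit K) ∧
      PassCover F S ∧ G.coverLength F ≤ T.card + 2 := by
  obtain ⟨Z, hZ, hZs, hSZ⟩ := exists_fundamental hT S (disjoint_NE_PE hS hTP)
  obtain ⟨F, f1, f2, f3, -⟩ := exists_passCover hT hTP hZ hZs hSZ hpar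
  obtain ⟨e, f, hef, rfl⟩ := Finset.card_eq_two.1 hcard
  obtain ⟨K, hK, heK⟩ := f3.1 e (by simp)
  have hneg : ∀ g ∈ K, g ∈ G.NE → g = e ∨ g = f := by
    intro g hg hgn
    rcases Finset.mem_union.1 (f2 K hK hg) with h | h
    · exact absurd h (Finset.disjoint_left.1 (disjoint_NE_PE le_rfl hTP) hgn)
    · simpa using h
  have he : e ∈ G.NE := hS (by simp)
  have hf : f ∈ G.NE := hS (by simp)
  obtain ⟨hfK, C, hCK, hC, heC⟩ := (f1 K hK).of_two hneg heK he
  obtain ⟨-, D, hDK, hD, hfD⟩ :=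
    (f1 K hK).of_two (fun g hg hn => (hneg g hg hn).symm) hfK hf
  refine ⟨{K}, by simpa using f1 K hK, ⟨?_, ?_, ?_⟩, ?_⟩
  · intro g hg
    rw [Finset.mem_insert, Finset.mem_singleton] at hg
    rcases hg with rfl | rfl
    · exact ⟨K, by simp, heK⟩
    · exact ⟨K, by simp, hfK⟩
  · intro b g W hW hbg hg
    refine ⟨K, by simp, ?_⟩
    rw [Finset.mem_insert, Finset.mem_singleton] at hg
    rcases hg with rfl | rfl
    · exact hCK (even_boundary_pair hC.ev hW heC)
    · exact hDK (even_boundary_pair hD.ev hW hfD)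
  · intro b W hW hodd
    refine ⟨K, by simp, ?_⟩
    by_contra hb
    apply hodd
    have hWK : G.boundary K W = ∅ := by
      rw [Finset.eq_empty_iff_forall_notMem]
      intro g hg
      have := boundary_mono (Finset.subset_univ K) W hg
      rw [hW, Finset.mem_singleton] at this
      exact hb (this ▸ boundary_subset _ _ hg)
    have hWS : G.boundary {e, f} W = ∅ := Finset.subset_empty.1 (hWK ▸ boundary_mono (by
      intro g hg
      rw [Finset.mem_insert, Finset.mem_singleton] at hg
      rcases hg with rfl | rfl
      · exact heK
      · exact hfK) W)
    obtain ⟨x, y, hxy⟩ := exists_ends e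
    have hx : x ∈ G.support K := mem_support.2 ⟨e, heK, by rw [hxy]; simp⟩
    have hin : ∀ g ∈ K, (∀ z ∈ G.ends g, z ∈ W) ↔ x ∈ W := by
      intro g hg
      have hz : ∀ z ∈ G.ends g, (z ∈ W ↔ x ∈ W) := fun z hz =>
        mem_iff_of_boundary hWK ((f1 K hK).connOn z (mem_support.2 ⟨g, hg, hz⟩) x hx)
      obtain ⟨x', y', h'⟩ := exists_ends g
      have hx' : x' ∈ G.ends g := by rw [h']; simp
      exact ⟨fun h => (hz x' hx').1 (h x' hx'), fun h z hzg => (hz z hzg).2 h⟩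
    rw [nin, Finset.sum_pair hef]
    simp only [hin e heK, hin f hfK, mem_NE.1 he, mem_NE.1 hf, true_and]
    split_ifs <;> decide
  · have h1 : K.card ≤ T.card + 2 := by
      have := Finset.card_le_card (f2 K hK)
      have h2 := Finset.card_union_le T {e, f}
      rw [hcard] at h2
      omega
    simpa [coverLength] using h1

lemma nin_univ {S : Finset G.E} (hS : S ⊆ G.NE) : nin Finset.univ S = (S.card : ZMod 2) := by
  rw [nin, Finset.card_eq_sum_ones]
  push_cast
  refine Finset.sum_congr rfl fun e he => ?_
  rw [if_pos]
  exact ⟨mem_NE.1 (hS he), by simp⟩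

lemma boundary_univ_right (S : Finset G.E) : G.boundary S Finset.univ = ∅ := by
  rw [Finset.eq_empty_iff_forall_notMem]
  intro e he
  obtain ⟨x, y, h⟩ := exists_ends e
  rw [mem_boundary_of_ends h] at he
  simp at he

lemma exists_passCover_all {T Z S : Finset G.E}
    (hT : ∀ u v, G.Reach Finset.univ u v → G.Reach T u v) (hTP : T ⊆ G.PE) (hS : S ⊆ G.NE)
    (hZ : Ev Z) (hZs : Z ⊆ T ∪ S) (hSZ : S ⊆ Z)
    (hpar : ∀ W, G.boundary Finset.univ W = ∅ → nin W S = 0) :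
    ∃ F : Multiset (Finset G.E), (∀ K ∈ F, G.IsSignedCircuit K) ∧
      PassCover F S ∧ 2 * G.coverLength F ≤ 2 * T.card + (Z ∩ T).card + 3 * S.card ∧
      (S.card = 0 → G.coverLength F = 0) ∧ (S.card = 2 → G.coverLength F ≤ T.card + 2) := by
  by_cases h0 : S.card = 0
  · rw [Finset.card_eq_zero] at h0
    subst h0
    refine ⟨0, by simp, ⟨by simp, by simp, ?_⟩, by simp [coverLength], by simp [coverLength],
      by simp⟩
    intro b W _ h
    exact absurd (by simp [nin]) h
  by_cases h2 : S.card = 2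
  · obtain ⟨F, f1, f2, f3⟩ := exists_passCover_pair hT hTP hS hpar h2
    exact ⟨F, f1, f2, by omega, by omega, fun _ => f3⟩
  · obtain ⟨F, f1, -, f2, f3⟩ := exists_passCover hT hTP hZ hZs hSZ hpar
    exact ⟨F, f1, f2, f3, by omega, by omega⟩

lemma two_passes_arith {t n s₁ s₂ s₃ z₁ z₂ z₃ c₁ c₂ c₃ a₁ a₂ a₃ : ℕ}
    (l₁ : 2 * c₁ ≤ 2 * t + z₁ + 3 * s₁) (l₂ : 2 * c₂ ≤ 2 * t + z₂ + 3 * s₂)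
    (l₃ : 2 * c₃ ≤ 2 * t + z₃ + 3 * s₃)
    (e₁ : s₁ = 0 → c₁ = 0) (e₂ : s₂ = 0 → c₂ = 0) (e₃ : s₃ = 0 → c₃ = 0)
    (p₁ : s₁ = 2 → c₁ ≤ t + 2) (p₂ : s₂ = 2 → c₂ ≤ t + 2) (p₃ : s₃ = 2 → c₃ ≤ t + 2)
    (h₁ : s₁ = a₁ + a₁) (h₂ : s₂ = a₂ + a₂) (h₃ : s₃ = a₃ + a₃)
    (k₁ : s₁ ≤ n) (k₂ : s₂ ≤ n) (k₃ : s₃ ≤ n) (hs : s₁ + s₂ + s₃ = 2 * n)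
    (hz : z₁ + z₂ + z₃ ≤ 2 * t) (hn : 2 ≤ n) :
    3 * (c₁ + c₂) + 12 ≤ 8 * t + 9 * n ∨ 3 * (c₁ + c₃) + 12 ≤ 8 * t + 9 * n ∨
      3 * (c₂ + c₃) + 12 ≤ 8 * t + 9 * n := by
  by_cases h4 : 4 ≤ n
  · clear e₁ e₂ e₃ p₁ p₂ p₃
    by_contra! hcon
    obtain ⟨x, y, z⟩ := hcon
    linarith
  · have hn' : n = 2 ∨ n = 3 := by omega
    have h5 : a₁ = 0 ∨ a₁ = 1 := by omega
    have h6 : a₂ = 0 ∨ a₂ = 1 := by omega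
    have h7 : a₃ = 0 ∨ a₃ = 1 := by omega
    subst h₁ h₂ h₃
    rcases hn' with rfl | rfl <;> rcases h5 with rfl | rfl <;> rcases h6 with rfl | rfl <;>
      rcases h7 with rfl | rfl <;> norm_num at * <;> omega

lemma card_inter_symmDiff_le {α : Type*} (A B T : Finset α) :
    (A ∩ T).card + (B ∩ T).card + (symmDiff A B ∩ T).card ≤ 2 * T.card := by
  have h1 := card_symmDiff_add (A ∩ T) (B ∩ T)
  have h2 := Finset.card_union_add_card_inter (A ∩ T) (B ∩ T)
  have h3 : (A ∩ T) ∪ (B ∩ T) ⊆ T :=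
    Finset.union_subset Finset.inter_subset_right Finset.inter_subset_right
  have h4 := Finset.card_le_card h3
  have h5 : symmDiff A B ∩ T = symmDiff (A ∩ T) (B ∩ T) := by
    ext e
    simp only [Finset.mem_inter, Finset.mem_symmDiff]
    tauto
  rw [h5]
  omega

/-- Two passes cover the negative edges and all edges in small cuts. -/
theorem exists_two_passes {T S₁ S₂ : Finset G.E}
    (hT : ∀ u v, G.Reach Finset.univ u v → G.Reach T u v) (hTP : T ⊆ G.PE)
    (hS : S₁ ∪ S₂ = G.NE) (hε : 2 ≤ G.NE.card)
    (hpar : ∀ W, G.boundary Finset.univ W = ∅ → nin W S₁ = 0 ∧ nin W S₂ = 0) :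
    ∃ F : Multiset (Finset G.E), (∀ K ∈ F, G.IsSignedCircuit K) ∧
      (∀ e ∈ G.NE, Covers F e) ∧
      (∀ b e W, G.boundary Finset.univ W = {b, e} → b ≠ e → e ∈ G.NE → Covers F b) ∧
      (∀ b W, G.boundary Finset.univ W = {b} → (nin W S₁ ≠ 0 ∨ nin W S₂ ≠ 0) → Covers F b) ∧
      3 * G.coverLength F + 12 ≤ 8 * T.card + 9 * G.NE.card := by
  have s1 : S₁ ⊆ G.NE := hS ▸ Finset.subset_union_left
  have s2 : S₂ ⊆ G.NE := hS ▸ Finset.subset_union_right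
  obtain ⟨S₃, hS₃⟩ : ∃ S, S = symmDiff S₁ S₂ := ⟨_, rfl⟩
  have s3 : S₃ ⊆ G.NE := hS₃ ▸ Finset.symmDiff_subset_union.trans hS.le
  have hnin : ∀ W, nin W S₃ = nin W S₁ + nin W S₂ := fun W => hS₃ ▸ sum_symmDiff_zmod _ _ _
  obtain ⟨Z₁, z1, zs1, sz1⟩ := exists_fundamental hT S₁ (disjoint_NE_PE s1 hTP)
  obtain ⟨Z₂, z2, zs2, sz2⟩ := exists_fundamental hT S₂ (disjoint_NE_PE s2 hTP)
  have hdis : ∀ e ∈ G.NE, e ∉ T := fun e he => Finset.disjoint_left.1 (disjoint_NE_PE le_rfl hTP) he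
  have hm1 : ∀ e ∈ G.NE, (e ∈ Z₁ ↔ e ∈ S₁) := fun e he =>
    ⟨fun h => (Finset.mem_union.1 (zs1 h)).resolve_left (hdis e he), fun h => sz1 h⟩
  have hm2 : ∀ e ∈ G.NE, (e ∈ Z₂ ↔ e ∈ S₂) := fun e he =>
    ⟨fun h => (Finset.mem_union.1 (zs2 h)).resolve_left (hdis e he), fun h => sz2 h⟩
  obtain ⟨Z₃, hZ₃⟩ : ∃ Z, Z = symmDiff Z₁ Z₂ := ⟨_, rfl⟩
  have zs3 : Z₃ ⊆ T ∪ S₃ := by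
    intro e he
    rw [Finset.mem_union]
    by_cases heN : e ∈ G.NE
    · right
      rw [hZ₃, Finset.mem_symmDiff] at he
      rw [hS₃, Finset.mem_symmDiff, ← hm1 e heN, ← hm2 e heN]
      exact he
    · left
      rw [hZ₃, Finset.mem_symmDiff] at he
      rcases he with he | he
      · exact (Finset.mem_union.1 (zs1 he.1)).resolve_right fun h => heN (s1 h)
      · exact (Finset.mem_union.1 (zs2 he.1)).resolve_right fun h => heN (s2 h)
  have sz3 : S₃ ⊆ Z₃ := by
    intro e he
    have heN := s3 he
    rw [hS₃, Finset.mem_symmDiff, ← hm1 e heN, ← hm2 e heN] at he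
    rw [hZ₃, Finset.mem_symmDiff]
    exact he
  obtain ⟨F₁, p1, c1, l1, l1', l1''⟩ := exists_passCover_all hT hTP s1 z1 zs1 sz1
    fun W hW => (hpar W hW).1
  obtain ⟨F₂, p2, c2, l2, l2', l2''⟩ := exists_passCover_all hT hTP s2 z2 zs2 sz2
    fun W hW => (hpar W hW).2
  obtain ⟨F₃, p3, c3, l3, l3', l3''⟩ := exists_passCover_all hT hTP s3 (hZ₃ ▸ z1.symmDiff z2) zs3 sz3
    fun W hW => by rw [hnin, (hpar W hW).1, (hpar W hW).2, add_zero]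
  have comb : ∀ A B F F', (∀ e ∈ G.NE, e ∈ A ∨ e ∈ B) →
      (∀ W, (nin W S₁ ≠ 0 ∨ nin W S₂ ≠ 0) → (nin W A ≠ 0 ∨ nin W B ≠ 0)) →
      (∀ K ∈ F, G.IsSignedCircuit K) → (∀ K ∈ F', G.IsSignedCircuit K) →
      PassCover F A → PassCover F' B →
      3 * (G.coverLength F + G.coverLength F') + 12 ≤ 8 * T.card + 9 * G.NE.card →
      ∃ F : Multiset (Finset G.E), (∀ K ∈ F, G.IsSignedCircuit K) ∧
      (∀ e ∈ G.NE, Covers F e) ∧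
      (∀ b e W, G.boundary Finset.univ W = {b, e} → b ≠ e → e ∈ G.NE → Covers F b) ∧
      (∀ b W, G.boundary Finset.univ W = {b} → (nin W S₁ ≠ 0 ∨ nin W S₂ ≠ 0) → Covers F b) ∧
      3 * G.coverLength F + 12 ≤ 8 * T.card + 9 * G.NE.card := by
    intro A B F F' hAB hn hF hF' cF cF' hl
    refine ⟨F + F', ?_, ?_, ?_, ?_, by rw [coverLength_add]; exact hl⟩
    · intro K hK
      rcases Multiset.mem_add.1 hK with h | h
      · exact hF K h
      · exact hF' K h
    · intro e he
      rcases hAB e he with h | h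
      · exact (cF.1 e h).add_left
      · exact (cF'.1 e h).add_right
    · intro b e W hW hbe he
      rcases hAB e he with h | h
      · exact (cF.2.1 b e W hW hbe h).add_left
      · exact (cF'.2.1 b e W hW hbe h).add_right
    · intro b W hW hodd
      rcases hn W hodd with h | h
      · exact (cF.2.2 b W hW h).add_left
      · exact (cF'.2.2 b W hW h).add_right
  have hev : ∀ S ⊆ G.NE, nin Finset.univ S = 0 → Even S.card := fun S hS' h => by
    rw [nin_univ hS'] at h
    exact ZMod.natCast_eq_zero_iff_even.1 h
  have huniv := hpar Finset.univ (boundary_univ_right _)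
  obtain ⟨a1, ha1⟩ := hev S₁ s1 huniv.1
  obtain ⟨a2, ha2⟩ := hev S₂ s2 huniv.2
  obtain ⟨a3, ha3⟩ := hev S₃ s3 (by rw [hnin, huniv.1, huniv.2, add_zero])
  have k1 := Finset.card_le_card s1
  have k2 := Finset.card_le_card s2
  have k3 := Finset.card_le_card s3
  have ksum : S₁.card + S₂.card + S₃.card = 2 * G.NE.card := by
    have h1 := card_symmDiff_add S₁ S₂
    have h2 := Finset.card_union_add_card_inter S₁ S₂
    rw [hS] at h2
    rw [← hS₃] at h1
    omega
  have kz : (Z₁ ∩ T).card + (Z₂ ∩ T).card + (Z₃ ∩ T).card ≤ 2 * T.card :=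
    hZ₃ ▸ card_inter_symmDiff_le Z₁ Z₂ T
  have hmem3 : ∀ e, e ∈ S₃ ↔ (e ∈ S₁ ∧ e ∉ S₂ ∨ e ∈ S₂ ∧ e ∉ S₁) := fun e =>
    hS₃ ▸ Finset.mem_symmDiff
  have hNE : ∀ e ∈ G.NE, e ∈ S₁ ∨ e ∈ S₂ := fun e he => Finset.mem_union.1 (hS ▸ he)
  have hNE₁ : ∀ e ∈ G.NE, e ∈ S₁ ∨ e ∈ S₃ := fun e he => by
    by_cases h : e ∈ S₁
    · exact Or.inl h
    · exact Or.inr ((hmem3 e).2 (Or.inr ⟨(hNE e he).resolve_left h, h⟩))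
  have hNE₂ : ∀ e ∈ G.NE, e ∈ S₂ ∨ e ∈ S₃ := fun e he => by
    by_cases h : e ∈ S₂
    · exact Or.inl h
    · exact Or.inr ((hmem3 e).2 (Or.inl ⟨(hNE e he).resolve_right h, h⟩))
  have hlen := two_passes_arith l1 l2 l3 l1' l2' l3' l1'' l2'' l3'' ha1 ha2 ha3 k1 k2 k3 ksum kz hε
  rcases hlen with h | h | h
  · exact comb S₁ S₂ F₁ F₂ hNE (fun W h => h) p1 p2 c1 c2 h
  · refine comb S₁ S₃ F₁ F₃ hNE₁ (fun W h => ?_) p1 p3 c1 c3 h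
    rw [hnin]
    by_cases h1 : nin W S₁ = 0
    · rw [h1, zero_add]
      exact Or.inr (h.resolve_left fun h' => h' h1)
    · exact Or.inl h1
  · refine comb S₂ S₃ F₂ F₃ hNE₂ (fun W h => ?_) p2 p3 c2 c3 h
    rw [hnin]
    by_cases h1 : nin W S₂ = 0
    · rw [h1, add_zero]
      exact Or.inr (h.resolve_right fun h' => h' h1)
    · exact Or.inl h1

/-! ### Labelling the negative edges -/

lemma klein_add_self (a : ZMod 2 × ZMod 2) : a + a = 0 := by
  revert a; decide

lemma exists_separated_pair {α : Type*} {N : Finset α} (hN : 2 ≤ N.card) {L : Set (Finset α)}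
    (hL : ∀ M ∈ L, M ⊆ N ∧ M.Nonempty ∧ N \ M ∈ L)
    (hc : ∀ M ∈ L, ∀ M' ∈ L, Disjoint M M' ∨ M ⊆ M' ∨ M' ⊆ M ∨ N ⊆ M ∪ M') :
    ∃ e ∈ N, ∃ f ∈ N, e ≠ f ∧ ∀ M ∈ L, e ∈ M → f ∉ M → M = {e} ∨ N \ M = {f} := by
  have hex : ∃ B, B ∈ (N.powerset.filter fun B => 2 ≤ B.card ∧ (B = N ∨ B ∈ L)) :=
    ⟨N, by simp [hN]⟩
  obtain ⟨B, hB, hmin⟩ := Finset.exists_min_image _ Finset.card hex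
  simp only [Finset.mem_filter, Finset.mem_powerset] at hB hmin
  obtain ⟨hBN, hB2, hBL⟩ := hB
  obtain ⟨e, he, f, hf, hef⟩ := Finset.one_lt_card.1 (show 1 < B.card by omega)
  refine ⟨e, hBN he, f, hBN hf, hef, ?_⟩
  have small : ∀ M ∈ L, M ⊆ B → ∀ x ∈ M, ∀ y ∈ B, y ∉ M → M = {x} := by
    intro M hM hMB x hx y hy hyM
    have h1 : M.card < B.card := Finset.card_lt_card ⟨hMB, fun h => hyM (h hy)⟩
    have h2 : M.card ≤ 1 := by
      by_contra! h
      have := hmin M ⟨(hL M hM).1, h, Or.inr hM⟩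
      omega
    exact Finset.eq_singleton_iff_unique_mem.2 ⟨hx, fun z hz => Finset.card_le_one.1 h2 z hz x hx⟩
  intro M hM heM hfM
  have hsub : M ⊆ B ∨ N \ M ⊆ B := by
    rcases hBL with rfl | hBL
    · exact Or.inl (hL M hM).1
    · rcases hc M hM B hBL with h | h | h | h
      · exact absurd he (Finset.disjoint_left.1 h heM)
      · exact Or.inl h
      · exact absurd (h hf) hfM
      · right
        intro x hx
        rw [Finset.mem_sdiff] at hx
        exact (Finset.mem_union.1 (h hx.1)).resolve_left hx.2
  rcases hsub with h | h
  · exact Or.inl (small M hM h e heM f hf hfM)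
  · exact Or.inr (small _ (hL M hM).2.2 h f (Finset.mem_sdiff.2 ⟨hBN hf, hfM⟩) e he
      fun h => (Finset.mem_sdiff.1 h).2 heM)

/-- A cross-free family of proper subsets has a nowhere zero labelling by the Klein group
with total sum zero and nonzero sum on every member. -/
lemma exists_labels {α : Type*} (n : ℕ) : ∀ (N : Finset α), N.card = n + 2 →
    ∀ L : Set (Finset α), (∀ M ∈ L, M ⊆ N ∧ M.Nonempty ∧ N \ M ∈ L) →
    (∀ M ∈ L, ∀ M' ∈ L, Disjoint M M' ∨ M ⊆ M' ∨ M' ⊆ M ∨ N ⊆ M ∪ M') →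
    ∃ f : α → ZMod 2 × ZMod 2, (∀ e ∈ N, f e ≠ 0) ∧ ∑ e ∈ N, f e = 0 ∧
      ∀ M ∈ L, ∑ e ∈ M, f e ≠ 0 := by
  induction n with
  | zero =>
    intro N hN L hL _
    refine ⟨fun _ => (1, 0), fun _ _ h => absurd (congrArg Prod.fst h) one_ne_zero, ?_, ?_⟩
    · rw [Finset.sum_const, hN]
      decide
    · intro M hM
      obtain ⟨h1, h2, h3⟩ := hL M hM
      have h4 : M.card + (N \ M).card = N.card := by
        rw [Finset.card_sdiff_of_subset h1]
        have := Finset.card_le_card h1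
        omega
      have h5 := Finset.card_pos.2 h2
      have h6 := Finset.card_pos.2 (hL _ h3).2.1
      have h7 : M.card = 1 := by omega
      rw [Finset.sum_const, h7]
      decide
  | succ n ih =>
    intro N hN L hL hc
    obtain ⟨e, he, f, hf, hef, hsep⟩ := exists_separated_pair (by omega) hL hc
    have hfe : f ∈ N.erase e := Finset.mem_erase.2 ⟨hef.symm, hf⟩
    obtain ⟨g, g1, g2, g3⟩ := ih (N.erase e) (by rw [Finset.card_erase_of_mem he]; omega)
      {M | ∃ M' ∈ L, (e ∈ M' ↔ f ∈ M') ∧ M = M'.erase e} (by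
        rintro _ ⟨M, hM, hM2, rfl⟩
        obtain ⟨h1, h2, h3⟩ := hL M hM
        refine ⟨Finset.erase_subset_erase _ h1, ?_, N \ M, h3, ?_, ?_⟩
        · by_cases heM : e ∈ M
          · exact ⟨f, Finset.mem_erase.2 ⟨hef.symm, hM2.1 heM⟩⟩
          · rwa [Finset.erase_eq_of_notMem heM]
        · simp only [Finset.mem_sdiff, he, hf, true_and, hM2]
        · ext x
          simp only [Finset.mem_sdiff, Finset.mem_erase]
          tauto) (by
        rintro _ ⟨M, hM, hM2, rfl⟩ _ ⟨M', hM', hM2', rfl⟩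
        rcases hc M hM M' hM' with h | h | h | h
        · exact Or.inl (Finset.disjoint_of_subset_left (Finset.erase_subset _ _)
            (Finset.disjoint_of_subset_right (Finset.erase_subset _ _) h))
        · exact Or.inr (Or.inl (Finset.erase_subset_erase _ h))
        · exact Or.inr (Or.inr (Or.inl (Finset.erase_subset_erase _ h)))
        · refine Or.inr (Or.inr (Or.inr ?_))
          rw [← Finset.erase_union_distrib]
          exact Finset.erase_subset_erase _ h)
    obtain ⟨d, hd, hd'⟩ : ∃ d : ZMod 2 × ZMod 2, d ≠ 0 ∧ g f ≠ d := by
      generalize g f = a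
      revert a; decide
    have hfd : g f + d ≠ 0 := fun h => hd' (by
      have := klein_add_self d
      have h3 : g f + d + d = d := by rw [h, zero_add]
      rwa [add_assoc, this, add_zero] at h3)
    set k : α → ZMod 2 × ZMod 2 := fun x => if x = e then d else if x = f then g f + d else g x
      with hk
    have ke : k e = d := by simp [hk]
    have kf : k f = g f + d := by simp [hk, hef.symm]
    have kx : ∀ x, x ≠ e → x ≠ f → k x = g x := fun x h1 h2 => by simp [hk, h1, h2]
    have knone : ∀ M : Finset α, e ∉ M → f ∉ M → ∑ x ∈ M, k x = ∑ x ∈ M, g x := by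
      intro M h1 h2
      exact Finset.sum_congr rfl fun x hx => kx x (fun h => h1 (h ▸ hx)) fun h => h2 (h ▸ hx)
    have kboth : ∀ M : Finset α, e ∈ M → f ∈ M → ∑ x ∈ M, k x = ∑ x ∈ M.erase e, g x := by
      intro M h1 h2
      have h3 : f ∈ M.erase e := Finset.mem_erase.2 ⟨hef.symm, h2⟩
      rw [← Finset.add_sum_erase _ _ h1, ← Finset.add_sum_erase _ _ h3,
        ← Finset.add_sum_erase _ g h3, knone _ (by simp) (by simp), ke, kf]
      have := klein_add_self d
      linear_combination this
    have ktot : ∑ x ∈ N, k x = 0 := by rw [kboth N he hf, g2]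
    have kcompl : ∀ M ∈ L, ∑ x ∈ N \ M, k x = ∑ x ∈ M, k x := by
      intro M hM
      have h1 := Finset.sum_sdiff (f := k) (hL M hM).1
      rw [ktot] at h1
      have h2 := klein_add_self (∑ x ∈ M, k x)
      linear_combination h1 - h2
    have ksep : ∀ M ∈ L, e ∈ M → f ∉ M → ∑ x ∈ M, k x ≠ 0 := by
      intro M hM h1 h2
      rcases hsep M hM h1 h2 with h | h
      · rw [h, Finset.sum_singleton, ke]
        exact hd
      · rw [← kcompl M hM, h, Finset.sum_singleton, kf]
        exact hfd
    refine ⟨k, ?_, ktot, ?_⟩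
    · intro x hx
      by_cases h1 : x = e
      · rw [h1, ke]; exact hd
      by_cases h2 : x = f
      · rw [h2, kf]; exact hfd
      rw [kx x h1 h2]
      exact g1 x (Finset.mem_erase.2 ⟨h1, hx⟩)
    · intro M hM
      by_cases h1 : e ∈ M <;> by_cases h2 : f ∈ M
      · rw [kboth M h1 h2]
        exact g3 _ ⟨M, hM, by simp [h1, h2], rfl⟩
      · exact ksep M hM h1 h2
      · rw [← kcompl M hM]
        have h3 := ksep _ (hL M hM).2.2 (Finset.mem_sdiff.2 ⟨he, h1⟩)
          (fun h => (Finset.mem_sdiff.1 h).2 h2)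
        exact h3
      · rw [knone M h1 h2]
        exact g3 _ ⟨M, hM, by simp [h1, h2], (Finset.erase_eq_of_notMem h1).symm⟩

/-! ### Consequences of being s-bridgeless -/

/-- A chosen end of an edge. -/
def tip (e : G.E) : G.V := (exists_ends e).choose

lemma tip_mem (e : G.E) : tip e ∈ G.ends e := by
  obtain ⟨y, h⟩ := (exists_ends e).choose_spec
  exact Sym2.mem_iff_exists.2 ⟨y, h⟩

lemma mem_iff_tip {S : Finset G.E} {U : Finset G.V} {e : G.E} (he : e ∈ S)
    (hU : e ∉ G.boundary S U) {x : G.V} (hx : x ∈ G.ends e) : x ∈ U ↔ tip e ∈ U := by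
  obtain ⟨a, b, h⟩ := exists_ends e
  have ht := tip_mem e
  rw [mem_boundary_of_ends h] at hU
  rw [h, Sym2.mem_iff] at hx ht
  rcases hx with rfl | rfl <;> rcases ht with ht | ht <;> rw [ht] <;> tauto

lemma IsUnbalancedCircuit.exists_neg_side {C : Finset G.E} (h : G.IsUnbalancedCircuit C)
    {U : Finset G.V} (hU : G.boundary C U = ∅) {u : G.V} (hu : u ∈ G.support C) :
    ∃ e ∈ C, e ∈ G.NE ∧ (tip e ∈ U ↔ u ∈ U) := by
  obtain ⟨e, he, hn⟩ := h.exists_neg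
  exact ⟨e, he, hn, mem_iff_of_boundary hU
    (h.1.2.1 _ (mem_support.2 ⟨e, he, tip_mem e⟩) _ hu)⟩

lemma boundary_eq_empty_of_ev {C : Finset G.E} (hC : Ev C) {U : Finset G.V} {b : G.E}
    (hU : G.boundary Finset.univ U = {b}) : G.boundary C U = ∅ := by
  have h1 : G.boundary C U ⊆ {b} := hU ▸ boundary_mono (Finset.subset_univ _) U
  rcases Finset.subset_singleton_iff.1 h1 with h | h
  · exact h
  · have := hC.boundary_card U
    rw [h] at this
    simp at this

lemma IsSignedCircuit.bridge_sides {S : Finset G.E} (hS : G.IsSignedCircuit S) {U : Finset G.V}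
    {b : G.E} (hU : G.boundary Finset.univ U = {b}) (hb : b ∈ S) :
    (∃ e ∈ S, e ∈ G.NE ∧ tip e ∈ U) ∧ ∃ e ∈ S, e ∈ G.NE ∧ tip e ∉ U := by
  have hbU : ∀ C, b ∈ C → b ∈ G.boundary C U := fun C h =>
    mem_boundary.2 ⟨h, (mem_boundary.1 (hU ▸ Finset.mem_singleton_self b :
      b ∈ G.boundary Finset.univ U)).2⟩
  have hev : ∀ C, Ev C → b ∉ C := fun C hC h => by
    have := hbU C h
    rw [boundary_eq_empty_of_ev hC hU] at this
    simp at this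
  rcases hS with h | ⟨C₁, C₂, h₁, h₂, -, -, rfl⟩ | ⟨C₁, C₂, P, u, v, h₁, h₂, -, hP, hu, hv, -, -, rfl⟩
  · exact absurd hb (hev _ h.1.ev)
  · rcases Finset.mem_union.1 hb with h | h
    · exact absurd h (hev _ h₁.1.ev)
    · exact absurd h (hev _ h₂.1.ev)
  · have hbP : b ∈ P := by
      rcases Finset.mem_union.1 hb with h | h
      · rcases Finset.mem_union.1 h with h | h
        · exact absurd h (hev _ h₁.1.ev)
        · exact absurd h (hev _ h₂.1.ev)
      · exact h
    have hPb : G.boundary P U = {b} :=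
      Finset.Subset.antisymm (hU ▸ boundary_mono (Finset.subset_univ _) U)
        (Finset.singleton_subset_iff.2 (hbU P hbP))
    obtain ⟨-, -, huv, -, -, du, dv, dw⟩ := hP
    have hbd : ∀ x, bd P x = (if u = x then 1 else 0) + (if v = x then 1 else 0) := by
      intro x
      rw [bd]
      by_cases h1 : u = x
      · subst h1
        rw [du]
        simp [huv.symm]
      by_cases h2 : v = x
      · subst h2
        rw [dv]
        simp [huv]
      rw [if_neg h1, if_neg h2, add_zero]
      by_cases h3 : x ∈ G.support P
      · rw [dw x h3 (Ne.symm h1) (Ne.symm h2)]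
        decide
      · have : G.degIn P x = 0 := by
          by_contra h
          exact h3 (degIn_pos_iff.1 (Nat.pos_of_ne_zero h))
        rw [this]
        simp
    have hsum := sum_bd P U
    rw [hPb] at hsum
    simp only [hbd, Finset.sum_add_distrib, Finset.sum_ite_eq] at hsum
    have hu' : u ∈ G.support C₁ := (Finset.mem_inter.1 (hu ▸ Finset.mem_singleton_self u :
      u ∈ G.support P ∩ G.support C₁)).2
    have hv' : v ∈ G.support C₂ := (Finset.mem_inter.1 (hv ▸ Finset.mem_singleton_self v :
      v ∈ G.support P ∩ G.support C₂)).2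
    obtain ⟨e₁, m₁, n₁, t₁⟩ := h₁.exists_neg_side (boundary_eq_empty_of_ev h₁.1.ev hU) hu'
    obtain ⟨e₂, m₂, n₂, t₂⟩ := h₂.exists_neg_side (boundary_eq_empty_of_ev h₂.1.ev hU) hv'
    have m₁' : e₁ ∈ C₁ ∪ C₂ ∪ P := by simp [m₁]
    have m₂' : e₂ ∈ C₁ ∪ C₂ ∪ P := by simp [m₂]
    by_cases hu1 : u ∈ U <;> by_cases hv1 : v ∈ U
    · simp only [hu1, hv1, if_true, Finset.card_singleton] at hsum
      exact absurd hsum (by decide)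
    · exact ⟨⟨e₁, m₁', n₁, t₁.2 hu1⟩, e₂, m₂', n₂, fun h => hv1 (t₂.1 h)⟩
    · exact ⟨⟨e₂, m₂', n₂, t₂.2 hv1⟩, e₁, m₁', n₁, fun h => hu1 (t₁.1 h)⟩
    · simp only [hu1, hv1, if_false, Finset.card_singleton] at hsum
      exact absurd hsum (by decide)

lemma IsSignedCircuit.two_neg {S : Finset G.E} (hS : G.IsSignedCircuit S) {e : G.E} (he : e ∈ S)
    (hn : e ∈ G.NE) : ∃ f ∈ S, f ∈ G.NE ∧ f ≠ e := by
  have two : ∀ C₁ C₂ : Finset G.E, G.IsUnbalancedCircuit C₁ → G.IsUnbalancedCircuit C₂ →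
      Disjoint C₁ C₂ → ∃ f ∈ C₁ ∪ C₂, f ∈ G.NE ∧ f ≠ e := by
    intro C₁ C₂ h₁ h₂ hd
    obtain ⟨e₁, m₁, n₁⟩ := h₁.exists_neg
    obtain ⟨e₂, m₂, n₂⟩ := h₂.exists_neg
    by_cases h : e₁ = e
    · exact ⟨e₂, Finset.mem_union_right _ m₂, n₂,
        fun h' => Finset.disjoint_left.1 hd m₁ (by rw [h, ← h']; exact m₂)⟩
    · exact ⟨e₁, Finset.mem_union_left _ m₁, n₁, h⟩
  rcases hS with h | ⟨C₁, C₂, h₁, h₂, hd, -, rfl⟩ | ⟨C₁, C₂, P, u, v, h₁, h₂, hd, hP, -, -, -, -, rfl⟩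
  · have hmem : e ∈ G.negEdges S := Finset.mem_filter.2 ⟨he, mem_NE.1 hn⟩
    have h1 : 1 < (G.negEdges S).card := by
      have h2 := Finset.card_pos.2 ⟨e, hmem⟩
      rcases h.2 with ⟨k, hk⟩
      omega
    obtain ⟨f, hf, hfe⟩ := Finset.exists_mem_ne h1 e
    exact ⟨f, (Finset.mem_filter.1 hf).1, mem_NE.2 (Finset.mem_filter.1 hf).2, hfe⟩
  · exact two C₁ C₂ h₁ h₂ hd
  · have hd' : Disjoint C₁ C₂ := by
      rw [Finset.disjoint_left]
      intro f h1 h2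
      exact Finset.disjoint_left.1 hd (mem_support.2 ⟨f, h1, tip_mem f⟩)
        (mem_support.2 ⟨f, h2, tip_mem f⟩)
    obtain ⟨f, hf, h⟩ := two C₁ C₂ h₁ h₂ hd'
    exact ⟨f, Finset.mem_union_left _ hf, h⟩

lemma boundary_compl (S : Finset G.E) (U : Finset G.V) : G.boundary S Uᶜ = G.boundary S U := by
  ext e
  obtain ⟨x, y, h⟩ := exists_ends e
  rw [mem_boundary_of_ends h, mem_boundary_of_ends h]
  simp only [Finset.mem_compl]
  tauto

lemma notMem_boundary {S : Finset G.E} {A : Finset G.V} {e : G.E} {x y : G.V}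
    (h : G.ends e = s(x, y)) (hx : x ∉ A) (hy : y ∉ A) : e ∉ G.boundary S A := by
  rw [mem_boundary_of_ends h]
  tauto

/-- Two bridges leave one of the four corner sets without boundary. -/
lemma exists_corner {U U' : Finset G.V} {b b' : G.E} (hU : G.boundary Finset.univ U = {b})
    (hU' : G.boundary Finset.univ U' = {b'}) :
    G.boundary Finset.univ (U ∩ U') = ∅ ∨ G.boundary Finset.univ (U ∩ U'ᶜ) = ∅ ∨
      G.boundary Finset.univ (Uᶜ ∩ U') = ∅ ∨ G.boundary Finset.univ (Uᶜ ∩ U'ᶜ) = ∅ := by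
  have sub : ∀ A B : Finset G.V, G.boundary Finset.univ A = {b} → G.boundary Finset.univ B = {b'} →
      b ∉ G.boundary Finset.univ (A ∩ B) → b' ∉ G.boundary Finset.univ (A ∩ B) →
      G.boundary Finset.univ (A ∩ B) = ∅ := by
    intro A B hA hB h1 h2
    rw [Finset.eq_empty_iff_forall_notMem]
    intro e he
    have h3 : e ∈ G.boundary Finset.univ A ∨ e ∈ G.boundary Finset.univ B := by
      obtain ⟨x, y, h⟩ := exists_ends e
      rw [mem_boundary_of_ends h] at he ⊢
      rw [mem_boundary_of_ends h]
      simp only [Finset.mem_inter] at he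
      tauto
    rw [hA, hB, Finset.mem_singleton, Finset.mem_singleton] at h3
    rcases h3 with rfl | rfl
    · exact h1 he
    · exact h2 he
  have hUc := boundary_compl Finset.univ U
  have hUc' := boundary_compl Finset.univ U'
  rw [hU] at hUc
  rw [hU'] at hUc'
  have e1 := sub U U' hU hU'
  have e2 := sub U U'ᶜ hU hUc'
  have e3 := sub Uᶜ U' hUc hU'
  have e4 := sub Uᶜ U'ᶜ hUc hUc'
  obtain ⟨x, y, h⟩ := exists_ends b
  obtain ⟨x', y', h'⟩ := exists_ends b'
  have hb : b ∈ G.boundary Finset.univ U := hU ▸ Finset.mem_singleton_self b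
  have hb' : b' ∈ G.boundary Finset.univ U' := hU' ▸ Finset.mem_singleton_self b'
  have hbb : b = b' ∨ b ∉ G.boundary Finset.univ U' := by
    rw [hU', Finset.mem_singleton]
    exact em _
  have hbb' : b = b' ∨ b' ∉ G.boundary Finset.univ U := by
    rw [hU, Finset.mem_singleton, eq_comm]
    exact em _
  rcases hbb with rfl | hbb
  · simp only [mem_boundary_of_ends h, Finset.mem_inter, Finset.mem_compl, Finset.mem_univ,
      true_and] at *
    by_cases a1 : x ∈ U <;> by_cases a2 : y ∈ U <;> by_cases a3 : x ∈ U' <;>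
      by_cases a4 : y ∈ U' <;> simp_all
  · rcases hbb' with rfl | hbb'
    · exact absurd hb' hbb
    · have n1 : ∀ A B : Finset G.V, x ∉ B → y ∉ B → b ∉ G.boundary Finset.univ (A ∩ B) :=
        fun A B h1 h2 => notMem_boundary h (fun h' => h1 (Finset.mem_inter.1 h').2)
          fun h' => h2 (Finset.mem_inter.1 h').2
      have n2 : ∀ A B : Finset G.V, x' ∉ A → y' ∉ A → b' ∉ G.boundary Finset.univ (A ∩ B) :=
        fun A B h1 h2 => notMem_boundary h' (fun h' => h1 (Finset.mem_inter.1 h').1)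
          fun h' => h2 (Finset.mem_inter.1 h').1
      have i1 : x ∈ U' ↔ y ∈ U' :=
        (mem_iff_tip (Finset.mem_univ _) hbb (by rw [h]; simp)).trans
          (mem_iff_tip (Finset.mem_univ _) hbb (by rw [h]; simp)).symm
      have i2 : x' ∈ U ↔ y' ∈ U :=
        (mem_iff_tip (Finset.mem_univ _) hbb' (by rw [h']; simp)).trans
          (mem_iff_tip (Finset.mem_univ _) hbb' (by rw [h']; simp)).symm
      have c : ∀ {A : Finset G.V} {z : G.V}, z ∈ A → z ∉ Aᶜ := fun h1 h2 =>
        Finset.mem_compl.1 h2 h1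
      by_cases p : x ∈ U' <;> by_cases q : x' ∈ U
      · exact Or.inr (Or.inr (Or.inr (e4 (n1 _ _ (c p) (c (i1.1 p))) (n2 _ _ (c q) (c (i2.1 q))))))
      · exact Or.inr (Or.inl (e2 (n1 _ _ (c p) (c (i1.1 p))) (n2 _ _ q fun h => q (i2.2 h))))
      · exact Or.inr (Or.inr (Or.inl (e3 (n1 _ _ p fun h => p (i1.2 h))
          (n2 _ _ (c q) (c (i2.1 q))))))
      · exact Or.inl (e1 (n1 _ _ p fun h => p (i1.2 h)) (n2 _ _ q fun h => q (i2.2 h)))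

lemma exists_component_labels (hG : G.SBridgeless) (r : G.V) :
    ∃ f : G.E → ZMod 2 × ZMod 2,
      (∀ e ∈ G.NE.filter fun e => tip e ∈ comp Finset.univ r, f e ≠ 0) ∧
      ∑ e ∈ G.NE.filter (fun e => tip e ∈ comp Finset.univ r), f e = 0 ∧
      ∀ U b, G.boundary Finset.univ U = {b} →
        (∃ e ∈ G.NE.filter fun e => tip e ∈ comp Finset.univ r, tip e ∈ U) →
        (∃ e ∈ G.NE.filter fun e => tip e ∈ comp Finset.univ r, tip e ∉ U) →
        ∑ e ∈ (G.NE.filter fun e => tip e ∈ comp Finset.univ r).filter (fun e => tip e ∈ U),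
          f e ≠ 0 := by
  set N := G.NE.filter fun e => tip e ∈ comp Finset.univ r with hN
  have hmem : ∀ e, e ∈ N ↔ e ∈ G.NE ∧ G.Reach Finset.univ r (tip e) := fun e => by
    rw [hN, Finset.mem_filter, mem_comp]
  by_cases h0 : N = ∅
  · refine ⟨fun _ => 0, by simp [h0], by simp, ?_⟩
    rintro U b - ⟨e, he, -⟩
    rw [h0] at he
    simp at he
  obtain ⟨e, he⟩ := Finset.nonempty_iff_ne_empty.2 h0
  have h2 : 2 ≤ N.card := by
    obtain ⟨S, hS, heS⟩ := hG e
    obtain ⟨f, hf, hfN, hfe⟩ := hS.two_neg heS ((hmem e).1 he).1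
    have h3 : f ∈ N := (hmem f).2 ⟨hfN, ((hmem e).1 he).2.trans
      ((hS.connOn _ (mem_support.2 ⟨e, heS, tip_mem e⟩) _
        (mem_support.2 ⟨f, hf, tip_mem f⟩)).mono (Finset.subset_univ _))⟩
    exact Finset.one_lt_card.2 ⟨f, h3, e, he, hfe⟩
  obtain ⟨n, hn⟩ := Nat.exists_eq_add_of_le' h2
  obtain ⟨f, f1, f2, f3⟩ := exists_labels n N hn
    {M | M.Nonempty ∧ (N \ M).Nonempty ∧ ∃ U b, G.boundary Finset.univ U = {b} ∧
      M = N.filter fun e => tip e ∈ U} (by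
    rintro M ⟨h3, h4, U, b, hU, rfl⟩
    refine ⟨Finset.filter_subset _ _, h3, h4, ?_, Uᶜ, b, by rw [boundary_compl, hU], ?_⟩
    · rwa [Finset.sdiff_sdiff_eq_self (Finset.filter_subset _ _)]
    · ext x
      simp only [Finset.mem_sdiff, Finset.mem_filter, Finset.mem_compl]
      tauto) (by
    rintro M ⟨-, -, U, b, hU, rfl⟩ M' ⟨-, -, U', b', hU', rfl⟩
    have hside : ∀ A : Finset G.V, G.boundary Finset.univ A = ∅ →
        (∀ x ∈ N, tip x ∈ A) ∨ ∀ x ∈ N, tip x ∉ A := by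
      intro A hA
      by_cases hr : r ∈ A
      · exact Or.inl fun x hx => (mem_iff_of_boundary hA ((hmem x).1 hx).2).1 hr
      · exact Or.inr fun x hx h => hr ((mem_iff_of_boundary hA ((hmem x).1 hx).2).2 h)
    simp only [Finset.disjoint_left, Finset.subset_iff, Finset.mem_filter, Finset.mem_union]
    rcases exists_corner hU hU' with h | h | h | h <;> rcases hside _ h with h' | h' <;>
      simp only [Finset.mem_inter, Finset.mem_compl] at h'
    · exact Or.inr (Or.inl fun x hx => ⟨hx.1, (h' x hx.1).2⟩)
    · exact Or.inl fun x hx hx' => h' x hx.1 ⟨hx.2, hx'.2⟩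
    · exact Or.inl fun x hx hx' => (h' x hx.1).2 hx'.2
    · exact Or.inr (Or.inl fun x hx => ⟨hx.1, by_contra fun h => h' x hx.1 ⟨hx.2, h⟩⟩)
    · exact Or.inl fun x hx hx' => (h' x hx.1).1 hx.2
    · exact Or.inr (Or.inr (Or.inl fun x hx => ⟨hx.1, by_contra fun h => h' x hx.1 ⟨h, hx.2⟩⟩))
    · exact Or.inl fun x hx hx' => (h' x hx.1).1 hx.2
    · refine Or.inr (Or.inr (Or.inr fun x hx => ?_))
      have := h' x hx
      tauto)
  refine ⟨f, f1, f2, ?_⟩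
  rintro U b hU ⟨x, hx, hxU⟩ ⟨y, hy, hyU⟩
  refine f3 _ ⟨⟨x, Finset.mem_filter.2 ⟨hx, hxU⟩⟩, ⟨y, Finset.mem_sdiff.2 ⟨hy, fun h => ?_⟩⟩,
    U, b, hU, rfl⟩
  exact hyU (Finset.mem_filter.1 h).2

/-- The negative edges split into two sets, each meeting every component evenly, such that one of
them is odd on each side of any bridge. -/
theorem exists_split (hG : G.SBridgeless)
    (hcut : ∀ U, 2 * (G.boundary G.NE U).card ≤ (G.boundary Finset.univ U).card) :
    ∃ S₁ S₂ : Finset G.E, S₁ ∪ S₂ = G.NE ∧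
      (∀ W, G.boundary Finset.univ W = ∅ → nin W S₁ = 0 ∧ nin W S₂ = 0) ∧
      ∀ b W, G.boundary Finset.univ W = {b} → nin W S₁ ≠ 0 ∨ nin W S₂ ≠ 0 := by
  have hf : ∀ C : Finset G.V, ∃ f : G.E → ZMod 2 × ZMod 2, (∃ r, C = comp Finset.univ r) →
      (∀ e ∈ G.NE.filter fun e => tip e ∈ C, f e ≠ 0) ∧
      ∑ e ∈ G.NE.filter (fun e => tip e ∈ C), f e = 0 ∧
      ∀ U b, G.boundary Finset.univ U = {b} →
        (∃ e ∈ G.NE.filter fun e => tip e ∈ C, tip e ∈ U) →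
        (∃ e ∈ G.NE.filter fun e => tip e ∈ C, tip e ∉ U) →
        ∑ e ∈ (G.NE.filter fun e => tip e ∈ C).filter (fun e => tip e ∈ U), f e ≠ 0 := by
    intro C
    by_cases h : ∃ r, C = comp Finset.univ r
    · obtain ⟨r, rfl⟩ := h
      obtain ⟨f, hf⟩ := exists_component_labels hG r
      exact ⟨f, fun _ => hf⟩
    · exact ⟨fun _ => 0, fun h' => absurd h' h⟩
  choose f hf using hf
  set l : G.E → ZMod 2 × ZMod 2 := fun e => f (comp Finset.univ (tip e)) e with hl
  have hcomp : ∀ r x : G.V, x ∈ comp Finset.univ r → comp Finset.univ x = comp Finset.univ r := by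
    intro r x hx
    rw [mem_comp] at hx
    ext y
    rw [mem_comp, mem_comp]
    exact ⟨fun h => hx.trans h, fun h => hx.symm.trans h⟩
  have hl0 : ∀ e ∈ G.NE, l e ≠ 0 := fun e he =>
    (hf _ ⟨_, rfl⟩).1 e (Finset.mem_filter.2 ⟨he, mem_comp.2 (Reach.refl _ _)⟩)
  have hsum : ∀ W : Finset G.V, ∑ e ∈ G.NE.filter (fun e => tip e ∈ W), l e =
      ∑ C ∈ Finset.univ.image (comp (G := G) Finset.univ),
        ∑ e ∈ (G.NE.filter fun e => tip e ∈ C).filter (fun e => tip e ∈ W), f C e := by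
    intro W
    rw [← Finset.sum_fiberwise_of_maps_to (t := Finset.univ.image (comp (G := G) Finset.univ))
      (g := fun e => comp Finset.univ (tip e)) (fun e _ => Finset.mem_image_of_mem _
        (Finset.mem_univ _))]
    refine Finset.sum_congr rfl fun C hC => ?_
    obtain ⟨r, -, rfl⟩ := Finset.mem_image.1 hC
    have h1 : ((G.NE.filter fun e => tip e ∈ W).filter fun e =>
        comp Finset.univ (tip e) = comp Finset.univ r) =
        (G.NE.filter fun e => tip e ∈ comp Finset.univ r).filter fun e => tip e ∈ W := by
      ext e
      simp only [Finset.mem_filter]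
      constructor
      · rintro ⟨⟨h1, h2⟩, h3⟩
        exact ⟨⟨h1, h3 ▸ mem_comp.2 (Reach.refl _ _)⟩, h2⟩
      · rintro ⟨⟨h1, h2⟩, h3⟩
        exact ⟨⟨h1, h3⟩, hcomp _ _ h2⟩
    rw [h1]
    refine Finset.sum_congr rfl fun e he => ?_
    rw [hl]
    simp only
    rw [hcomp r (tip e) (Finset.mem_filter.1 (Finset.mem_filter.1 he).1).2]
  have hzero : ∀ (W : Finset G.V) (r : G.V),
      (∀ e ∈ G.boundary Finset.univ W, tip e ∉ comp Finset.univ r) →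
      ∑ e ∈ (G.NE.filter fun e => tip e ∈ comp Finset.univ r).filter (fun e => tip e ∈ W),
        f (comp Finset.univ r) e = 0 := by
    intro W r h
    have h1 : G.boundary Finset.univ (comp Finset.univ r ∩ W) = ∅ := by
      rw [Finset.eq_empty_iff_forall_notMem]
      intro e he
      have h2 : e ∉ G.boundary Finset.univ (comp Finset.univ r) := by
        rw [boundary_comp]
        simp
      have h3 : e ∈ G.boundary Finset.univ W ∧ tip e ∈ comp Finset.univ r := by
        obtain ⟨x, y, hxy⟩ := exists_ends e
        have hx : x ∈ comp Finset.univ r ↔ tip e ∈ comp Finset.univ r :=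
          mem_iff_tip (Finset.mem_univ e) h2 (by rw [hxy]; simp)
        have hy : y ∈ comp Finset.univ r ↔ tip e ∈ comp Finset.univ r :=
          mem_iff_tip (Finset.mem_univ e) h2 (by rw [hxy]; simp)
        rw [mem_boundary_of_ends hxy] at he ⊢
        simp only [Finset.mem_inter] at he
        tauto
      exact h e h3.1 h3.2
    by_cases hr : r ∈ W
    · rw [Finset.filter_true_of_mem, (hf _ ⟨r, rfl⟩).2.1]
      intro e he
      have he' := (Finset.mem_filter.1 he).2
      exact (Finset.mem_inter.1 ((mem_iff_of_boundary h1 (mem_comp.1 he')).1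
        (Finset.mem_inter.2 ⟨mem_comp.2 (Reach.refl _ _), hr⟩))).2
    · rw [Finset.filter_false_of_mem, Finset.sum_empty]
      intro e he heW
      have he' := (Finset.mem_filter.1 he).2
      exact hr (Finset.mem_inter.1 ((mem_iff_of_boundary h1 (mem_comp.1 he')).2
        (Finset.mem_inter.2 ⟨he', heW⟩))).2
  have hnin : ∀ (W : Finset G.V) (p : G.E → ZMod 2), G.boundary G.NE W = ∅ →
      nin W (G.NE.filter fun e => p e ≠ 0) = ∑ e ∈ G.NE.filter (fun e => tip e ∈ W), p e := by
    intro W p hW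
    rw [nin, Finset.sum_filter, Finset.sum_filter]
    refine Finset.sum_congr rfl fun e he => ?_
    have h1 : (∀ x ∈ G.ends e, x ∈ W) ↔ tip e ∈ W := by
      have h2 : ∀ x ∈ G.ends e, x ∈ W ↔ tip e ∈ W := fun x hx =>
        mem_iff_tip he (by rw [hW]; simp) hx
      exact ⟨fun h => h _ (tip_mem e), fun h x hx => (h2 x hx).2 h⟩
    simp only [mem_NE.1 he, h1, true_and]
    have h01 : ∀ a : ZMod 2, a ≠ 0 → a = 1 := by decide
    by_cases h3 : p e = 0
    · simp [h3]
    · simp [h01 _ h3]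
  have hNb : ∀ W, (G.boundary Finset.univ W).card ≤ 1 → G.boundary G.NE W = ∅ := by
    intro W h
    have := hcut W
    exact Finset.card_eq_zero.1 (by omega)
  have hfst : ∀ s : Finset G.E, ∑ e ∈ s, (l e).1 = (∑ e ∈ s, l e).1 := fun s => Prod.fst_sum.symm
  have hsnd : ∀ s : Finset G.E, ∑ e ∈ s, (l e).2 = (∑ e ∈ s, l e).2 := fun s => Prod.snd_sum.symm
  refine ⟨G.NE.filter fun e => (l e).1 ≠ 0, G.NE.filter fun e => (l e).2 ≠ 0, ?_, ?_, ?_⟩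
  · rw [← Finset.filter_or, Finset.filter_true_of_mem]
    intro e he
    by_contra! h
    exact hl0 e he (Prod.ext h.1 h.2)
  · intro W hW
    have h0 : ∑ e ∈ G.NE.filter (fun e => tip e ∈ W), l e = 0 := by
      rw [hsum]
      refine Finset.sum_eq_zero fun C hC => ?_
      obtain ⟨r, -, rfl⟩ := Finset.mem_image.1 hC
      exact hzero W r (by rw [hW]; simp)
    have hb := hNb W (by rw [hW]; simp)
    rw [hnin W _ hb, hnin W _ hb, hfst, hsnd, h0]
    exact ⟨rfl, rfl⟩
  · intro b W hW
    have hb := hNb W (by rw [hW]; simp)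
    have h0 : ∑ e ∈ G.NE.filter (fun e => tip e ∈ W), l e ≠ 0 := by
      rw [hsum, Finset.sum_eq_single (comp Finset.univ (tip b))]
      · obtain ⟨S, hS, hbS⟩ := hG b
        obtain ⟨⟨e₁, m₁, n₁, t₁⟩, e₂, m₂, n₂, t₂⟩ := hS.bridge_sides hW hbS
        have hr : ∀ e ∈ S, tip e ∈ comp Finset.univ (tip b) := fun e he =>
          mem_comp.2 ((hS.connOn _ (mem_support.2 ⟨b, hbS, tip_mem b⟩) _
            (mem_support.2 ⟨e, he, tip_mem e⟩)).mono (Finset.subset_univ _))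
        exact (hf _ ⟨_, rfl⟩).2.2 W b hW ⟨e₁, Finset.mem_filter.2 ⟨n₁, hr _ m₁⟩, t₁⟩
          ⟨e₂, Finset.mem_filter.2 ⟨n₂, hr _ m₂⟩, t₂⟩
      · intro C hC hne
        obtain ⟨r, -, rfl⟩ := Finset.mem_image.1 hC
        refine hzero W r ?_
        rw [hW]
        intro e he h
        rw [Finset.mem_singleton] at he
        subst he
        exact hne (hcomp _ _ h).symm
      · intro h
        exact absurd (Finset.mem_image_of_mem _ (Finset.mem_univ _)) h
    rw [hnin W _ hb, hnin W _ hb, hfst, hsnd]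
    by_contra! h
    exact h0 (Prod.ext h.1 h.2)

/-! ### Cacti of circuits in well connected pieces -/

lemma Ev.singleton_loop {g : G.E} {v : G.V} (h : G.ends g = s(v, v)) : Ev ({g} : Finset G.E) := by
  intro x
  rw [bd_eq_sum, Finset.sum_singleton, inc_of_ends h]
  split_ifs <;> decide

lemma mem_support_of_ends {S : Finset G.E} {e : G.E} (he : e ∈ S) {x y : G.V}
    (h : G.ends e = s(x, y)) : x ∈ G.support S ∧ y ∈ G.support S :=
  ⟨mem_support.2 ⟨e, he, by simp [h]⟩, mem_support.2 ⟨e, he, by simp [h]⟩⟩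

/-- Circuits with at least two edges which share at most one vertex are edge-disjoint. -/
lemma IsCircuit.disjoint_of_support {K K' : Finset G.E} (hK : G.IsCircuit K) (h2 : 2 ≤ K.card)
    {v : G.V} (hv : ∀ x ∈ G.support K, x ∈ G.support K' → x = v) : Disjoint K K' := by
  rw [Finset.disjoint_left]
  intro g hg hg'
  obtain ⟨x, y, h⟩ := exists_ends g
  have h1 := mem_support_of_ends hg h
  have h1' := mem_support_of_ends hg' h
  rw [hv x h1.1 h1'.1, hv y h1.2 h1'.2] at h
  have := hK.eq_of_ev (S := {g}) (by simpa using hg) (Ev.singleton_loop h) (by simp)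
  rw [← this, Finset.card_singleton] at h2
  omega

/-- An edge of `S` which is not a bridge of `S` lies in a circuit of `S`. -/
lemma exists_circuit_or_cut {S : Finset G.E} {e : G.E} (he : e ∈ S) :
    (∃ K ⊆ S, G.IsCircuit K ∧ e ∈ K) ∨ ∃ U, G.boundary S U = {e} := by
  obtain ⟨x, y, h⟩ := exists_ends e
  by_cases hr : G.Reach (S.erase e) x y
  · obtain ⟨P, hP, W, hp⟩ := hr.exists_pth
    have heP : e ∉ P := fun h' => by simpa using hP h'
    refine Or.inl ⟨insert e P, ?_, (hp.close h heP).1, Finset.mem_insert_self _ _⟩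
    exact Finset.insert_subset he (hP.trans (Finset.erase_subset _ _))
  · refine Or.inr ⟨comp (S.erase e) x, ?_⟩
    ext f
    rw [Finset.mem_singleton]
    constructor
    · intro hf
      by_contra hne
      have hb := boundary_comp (S.erase e) x
      have : f ∈ G.boundary (S.erase e) (comp (S.erase e) x) :=
        mem_boundary.2 ⟨Finset.mem_erase.2 ⟨hne, (mem_boundary.1 hf).1⟩, (mem_boundary.1 hf).2⟩
      rw [hb] at this
      simp at this
    · rintro rfl
      exact (mem_boundary_of_ends h).2 ⟨he, Or.inl ⟨by simpa using Reach.refl _ _, by simpa using hr⟩⟩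

/-- `T` is a spanning tree of the vertex set `A` obtained from a tree-like arrangement `𝒦` of
circuits of `H` by removing one edge from each circuit. -/
structure Cactus (H : Finset G.E) (A : Finset G.V) (T : Finset G.E)
    (𝒦 : Finset (Finset G.E)) : Prop where
  circ : ∀ K ∈ 𝒦, G.IsCircuit K ∧ K ⊆ H ∧ (K \ T).card = 1 ∧ 2 ≤ K.card ∧ G.support K ⊆ A
  disj : ∀ K ∈ 𝒦, ∀ K' ∈ 𝒦, K ≠ K' → Disjoint K K'
  sub : T ⊆ 𝒦.biUnion id
  card : T.card + 1 = A.card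
  reach : ∀ u ∈ A, ∀ v ∈ A, G.Reach T u v

lemma Cactus.single (H : Finset G.E) (a : G.V) : Cactus H {a} ∅ ∅ where
  circ := by simp
  disj := by simp
  sub := by simp
  card := by simp
  reach := by
    intro u hu v hv
    rw [Finset.mem_singleton] at hu hv
    rw [hu, hv]
    exact Reach.refl _ _

lemma Cactus.attach {H T : Finset G.E} {A : Finset G.V} {𝒦 : Finset (Finset G.E)}
    (h : Cactus H A T 𝒦) {K : Finset G.E} (hK : G.IsCircuit K) (hKH : K ⊆ H) (h2 : 2 ≤ K.card)
    {v : G.V} (hvK : v ∈ G.support K) (hvA : v ∈ A)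
    (hA : ∀ x ∈ G.support K, x ∈ A → x = v) :
    ∃ T', Cactus H (A ∪ G.support K) T' (insert K 𝒦) := by
  obtain ⟨e, he⟩ := hK.1
  obtain ⟨x, y, hxy⟩ := exists_ends e
  have hd : ∀ K' ∈ 𝒦, Disjoint K K' := fun K' hK' =>
    hK.disjoint_of_support h2 fun x hx hx' => hA x hx ((h.circ K' hK').2.2.2.2 hx')
  have hdT : Disjoint K T := by
    refine Finset.disjoint_of_subset_right h.sub ?_
    rw [Finset.disjoint_biUnion_right]
    exact hd
  have hinter : A ∩ G.support K = {v} := by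
    ext z
    rw [Finset.mem_inter, Finset.mem_singleton]
    constructor
    · exact fun hz => hA z hz.2 hz.1
    · rintro rfl
      exact ⟨hvA, hvK⟩
  have hpth := hK.exists_pth_erase he hxy
  refine ⟨T ∪ K.erase e, ?_, ?_, ?_, ?_, ?_⟩
  · intro K' hK'
    rcases Finset.mem_insert.1 hK' with rfl | hK'
    · refine ⟨hK, hKH, ?_, h2, Finset.subset_union_right⟩
      have : K' \ (T ∪ K'.erase e) = {e} := by
        ext f
        rw [Finset.mem_sdiff, Finset.mem_union, Finset.mem_erase, Finset.mem_singleton]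
        constructor
        · intro hf
          by_contra hne
          exact hf.2 (Or.inr ⟨hne, hf.1⟩)
        · rintro rfl
          exact ⟨he, fun h' => h'.elim (Finset.disjoint_left.1 hdT he) fun h' => h'.1 rfl⟩
      rw [this, Finset.card_singleton]
    · obtain ⟨c1, c2, c3, c4, c5⟩ := h.circ K' hK'
      refine ⟨c1, c2, ?_, c4, c5.trans Finset.subset_union_left⟩
      have : K' \ (T ∪ K.erase e) = K' \ T := by
        ext f
        rw [Finset.mem_sdiff, Finset.mem_sdiff, Finset.mem_union, Finset.mem_erase]
        constructor
        · exact fun hf => ⟨hf.1, fun h' => hf.2 (Or.inl h')⟩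
        · exact fun hf => ⟨hf.1, fun h' => h'.elim hf.2 fun h' =>
            Finset.disjoint_left.1 (hd K' hK') h'.2 hf.1⟩
      rw [this, c3]
  · intro K₁ h₁ K₂ h₂ hne
    rcases Finset.mem_insert.1 h₁ with e₁ | m₁ <;> rcases Finset.mem_insert.1 h₂ with e₂ | m₂
    · exact absurd (e₁.trans e₂.symm) hne
    · exact e₁ ▸ hd K₂ m₂
    · exact e₂ ▸ (hd K₁ m₁).symm
    · exact h.disj K₁ m₁ K₂ m₂ hne
  · rw [Finset.biUnion_insert]
    refine Finset.union_subset (h.sub.trans Finset.subset_union_right) ?_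
    exact (Finset.erase_subset _ _).trans Finset.subset_union_left
  · have c1 : (T ∪ K.erase e).card = T.card + (K.erase e).card :=
      Finset.card_union_of_disjoint
        (Finset.disjoint_of_subset_right (Finset.erase_subset _ _) hdT.symm)
    have c2 := Finset.card_erase_add_one he
    have c3 := Finset.card_union_add_card_inter A (G.support K)
    rw [hinter, Finset.card_singleton, hK.card_support] at c3
    have c4 := h.card
    omega
  · have key : ∀ u ∈ A ∪ G.support K, G.Reach (T ∪ K.erase e) u v := by
      intro u hu
      rcases Finset.mem_union.1 hu with hu | hu
      · exact (h.reach u hu v hvA).mono Finset.subset_union_left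
      · exact (hpth.reach_mem hu hvK).mono Finset.subset_union_right
    exact fun u hu w hw => (key u hu).trans (key w hw).symm

/-- Vertices reachable from `a` by chains of at most `n` circuits of `H`. -/
def lay (H : Finset G.E) (a : G.V) : ℕ → G.V → Prop
  | 0, v => v = a
  | n + 1, v => lay H a n v ∨
      ∃ u, lay H a n u ∧ ∃ K ⊆ H, G.IsCircuit K ∧ u ∈ G.support K ∧ v ∈ G.support K

lemma lay_mono {H : Finset G.E} {a v : G.V} {m n : ℕ} (hmn : m ≤ n) (h : lay H a m v) :
    lay H a n v := by
  induction n, hmn using Nat.le_induction with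
  | base => exact h
  | succ n _ ih => exact Or.inl ih

lemma exists_cactus_of_lay (H : Finset G.E) (a : G.V) (n : ℕ) :
    ∀ v, lay H a n v → (∀ m < n, ¬ lay H a m v) →
    ∃ A T 𝒦, Cactus H A T 𝒦 ∧ a ∈ A ∧ v ∈ A ∧ ∀ u ∈ A, u ≠ v →
      (∃ m < n, lay H a m u) ∨ ∃ K ⊆ H, G.IsCircuit K ∧ u ∈ G.support K ∧ v ∈ G.support K ∧
        ∃ s ∈ G.support K, ∃ m < n, lay H a m s := by
  induction n with
  | zero =>
    rintro v rfl -
    exact ⟨{v}, ∅, ∅, Cactus.single H v, by simp, by simp, fun u hu hne =>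
      absurd (Finset.mem_singleton.1 hu) hne⟩
  | succ n ih =>
    intro w hw hmin
    have hnw := hmin n (Nat.lt_succ_self n)
    rcases hw with hw | ⟨v, hv, K, hKH, hK, hvK, hwK⟩
    · exact absurd hw hnw
    have hvmin : ∀ m < n, ¬ lay H a m v := fun m hm hl =>
      hnw (lay_mono (Nat.succ_le_of_lt hm) (Or.inr ⟨v, hl, K, hKH, hK, hvK, hwK⟩))
    obtain ⟨A, T, 𝒦, hc, haA, hvA, hinv⟩ := ih v hv hvmin
    have hvw : v ≠ w := by
      rintro rfl
      exact hnw hv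
    have h2 : 2 ≤ K.card := by
      rw [← hK.card_support]
      exact Finset.one_lt_card.2 ⟨v, hvK, w, hwK, hvw⟩
    have hA : ∀ x ∈ G.support K, x ∈ A → x = v := by
      intro p hpK hpA
      by_contra hpv
      rcases hinv p hpA hpv with ⟨m, hm, hl⟩ | ⟨K', hK'H, hK', hpK', hvK', s, hs, m, hm, hl⟩
      · exact hnw (lay_mono (Nat.succ_le_of_lt hm) (Or.inr ⟨p, hl, K, hKH, hK, hpK, hwK⟩))
      · obtain ⟨C, hCs, hC, hwC, hsC⟩ := hK.merge hK' hpv hpK hvK hpK' hvK' hwK hs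
        exact hnw (lay_mono (Nat.succ_le_of_lt hm)
          (Or.inr ⟨s, hl, C, hCs.trans (Finset.union_subset hKH hK'H), hC, hsC, hwC⟩))
    obtain ⟨T', hT'⟩ := hc.attach hK hKH h2 hvK hvA hA
    refine ⟨_, T', _, hT', Finset.mem_union_left _ haA, Finset.mem_union_right _ hwK, ?_⟩
    intro u hu huw
    rcases Finset.mem_union.1 hu with hu | hu
    · left
      refine ⟨n, Nat.lt_succ_self n, ?_⟩
      by_cases huv : u = v
      · rw [huv]
        exact hv
      rcases hinv u hu huv with ⟨m, hm, hl⟩ | ⟨K', hK'H, hK', huK', hvK', s, hs, m, hm, hl⟩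
      · exact lay_mono hm.le hl
      · exact lay_mono (Nat.succ_le_of_lt hm) (Or.inr ⟨s, hl, K', hK'H, hK', hs, huK'⟩)
    · exact Or.inr ⟨K, hKH, hK, hu, hwK, v, hvK, n, Nat.lt_succ_self n, hv⟩

lemma boundary_inter_of_ends {H : Finset G.E} {L : Finset G.V}
    (hH : ∀ e ∈ H, ∀ x ∈ G.ends e, x ∈ L) (U : Finset G.V) :
    G.boundary H (U ∩ L) = G.boundary H U := by
  ext e
  obtain ⟨x, y, h⟩ := exists_ends e
  rw [mem_boundary_of_ends h, mem_boundary_of_ends h]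
  refine and_congr_right fun he => ?_
  have hx := hH e he x (by simp [h])
  have hy := hH e he y (by simp [h])
  simp [hx, hy]

/-- If every nontrivial cut of the graph with vertex set `L` and edge set `H` has at least two
edges, then any two vertices of `L` lie in a common cactus. -/
lemma exists_cactus {H : Finset G.E} {L : Finset G.V}
    (hH : ∀ e ∈ H, ∀ x ∈ G.ends e, x ∈ L)
    (hcut : ∀ U ⊆ L, U.Nonempty → U ≠ L → 2 ≤ (G.boundary H U).card)
    {a b : G.V} (ha : a ∈ L) (hb : b ∈ L) :
    ∃ A T 𝒦, Cactus H A T 𝒦 ∧ a ∈ A ∧ b ∈ A ∧ A ⊆ L := by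
  have hlay : ∃ n, lay H a n b := by
    by_contra hno
    have h2 := hcut (L.filter fun v => ∃ n, lay H a n v) (Finset.filter_subset _ _)
      ⟨a, Finset.mem_filter.2 ⟨ha, 0, rfl⟩⟩ fun h => by
        rw [← h] at hb
        exact hno (Finset.mem_filter.1 hb).2
    obtain ⟨e, he⟩ := Finset.card_pos.1 (by omega : 0 < (G.boundary H
      (L.filter fun v => ∃ n, lay H a n v)).card)
    have heH := boundary_subset _ _ he
    obtain ⟨x, y, hxy⟩ := exists_ends e
    have hx := hH e heH x (by simp [hxy])
    have hy := hH e heH y (by simp [hxy])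
    rcases exists_circuit_or_cut heH with ⟨K, hKH, hK, heK⟩ | ⟨U, hU⟩
    · have hs := mem_support_of_ends heK hxy
      rw [mem_boundary_of_ends hxy, Finset.mem_filter, Finset.mem_filter] at he
      rcases he.2 with ⟨⟨-, n, hn⟩, h'⟩ | ⟨h', -, n, hn⟩
      · exact h' ⟨hy, n + 1, Or.inr ⟨x, hn, K, hKH, hK, hs.1, hs.2⟩⟩
      · exact h' ⟨hx, n + 1, Or.inr ⟨y, hn, K, hKH, hK, hs.2, hs.1⟩⟩
    · have heU : e ∈ G.boundary H U := by simp [hU]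
      rw [mem_boundary_of_ends hxy] at heU
      rw [← boundary_inter_of_ends hH] at hU
      have := hcut (U ∩ L) Finset.inter_subset_right ?_ ?_
      · rw [hU, Finset.card_singleton] at this
        omega
      · rcases heU.2 with h | h
        · exact ⟨x, Finset.mem_inter.2 ⟨h.1, hx⟩⟩
        · exact ⟨y, Finset.mem_inter.2 ⟨h.2, hy⟩⟩
      · intro hL
        rcases heU.2 with h | h
        · rw [← hL] at hy
          exact h.2 (Finset.mem_inter.1 hy).1
        · rw [← hL] at hx
          exact h.1 (Finset.mem_inter.1 hx).1
  obtain ⟨A, T, 𝒦, hc, haA, hbA, -⟩ := exists_cactus_of_lay H a (Nat.find hlay) b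
    (Nat.find_spec hlay) fun m hm => Nat.find_min hlay hm
  refine ⟨A, T, 𝒦, hc, haA, hbA, fun v hv => ?_⟩
  rcases (hc.reach a haA v hv).cases_tail with h | ⟨u, -, e, he, hue⟩
  · rw [h]
    exact ha
  · obtain ⟨K, hK, heK⟩ := Finset.mem_biUnion.1 (hc.sub he)
    exact hH e ((hc.circ K hK).2.1 heK) v (by simp [hue])

/-! ### The core of an edge set and a good spanning forest of it -/

/-- The edges of `P` which are not bridges of `P`. -/
def core (P : Finset G.E) : Finset G.E := P.filter fun e => ∃ Y ⊆ P, Ev Y ∧ e ∈ Y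

lemma core_subset (P : Finset G.E) : core P ⊆ P := Finset.filter_subset _ _

lemma Ev.subset_core {P Y : Finset G.E} (hY : Ev Y) (h : Y ⊆ P) : Y ⊆ core P := fun _ he =>
  Finset.mem_filter.2 ⟨h he, Y, h, hY, he⟩

lemma Ev.boundary_ne_singleton {Y : Finset G.E} (hY : Ev Y) (U : Finset G.V) (e : G.E) :
    G.boundary Y U ≠ {e} := fun h => by
  have := hY.boundary_card U
  rw [h, Finset.card_singleton] at this
  exact absurd this (by decide)

lemma boundary_core_ne (P : Finset G.E) (U : Finset G.V) (e : G.E) :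
    G.boundary (core P) U ≠ {e} := fun h => by
  have he : e ∈ G.boundary (core P) U := by simp [h]
  obtain ⟨-, Y, hY, hev, heY⟩ := Finset.mem_filter.1 (boundary_subset _ _ he)
  refine hev.boundary_ne_singleton U e (Finset.Subset.antisymm ?_ ?_)
  · rw [← h]
    exact boundary_mono (hev.subset_core hY) U
  · rw [Finset.singleton_subset_iff]
    exact mem_boundary.2 ⟨heY, (mem_boundary.1 he).2⟩

/-- The edges of `S` with all ends in `W`. -/
def ind (S : Finset G.E) (W : Finset G.V) : Finset G.E := S.filter fun e => ∀ x ∈ G.ends e, x ∈ W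

lemma ind_subset (S : Finset G.E) (W : Finset G.V) : ind S W ⊆ S := Finset.filter_subset _ _

lemma mem_ind_of_ends {S : Finset G.E} {W : Finset G.V} {e : G.E} {x y : G.V}
    (h : G.ends e = s(x, y)) : e ∈ ind S W ↔ e ∈ S ∧ x ∈ W ∧ y ∈ W := by
  simp [ind, h]

lemma card_boundary_add_le (S : Finset G.E) {L U : Finset G.V} (hU : U ⊆ L) :
    (G.boundary S U).card + (G.boundary S (L \ U)).card ≤
      2 * (G.boundary (ind S L) U).card + (G.boundary S L).card := by
  have h1 : ∀ S' ⊆ S, ∀ W, (G.boundary S' W).card =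
      ∑ e ∈ S, if e ∈ G.boundary S' W then 1 else 0 := by
    intro S' hS' W
    rw [← Finset.card_filter]
    congr 1
    ext e
    rw [Finset.mem_filter]
    exact ⟨fun h => ⟨hS' (boundary_subset _ _ h), h⟩, fun h => h.2⟩
  rw [h1 S le_rfl U, h1 S le_rfl (L \ U), h1 _ (ind_subset S L) U, h1 S le_rfl L, Finset.mul_sum,
    ← Finset.sum_add_distrib, ← Finset.sum_add_distrib]
  refine Finset.sum_le_sum fun e he => ?_
  obtain ⟨x, y, h⟩ := exists_ends e
  simp only [mem_boundary_of_ends h, mem_ind_of_ends h, Finset.mem_sdiff, he, true_and]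
  by_cases hx : x ∈ U <;> by_cases hy : y ∈ U <;> by_cases hxL : x ∈ L <;> by_cases hyL : y ∈ L <;>
    first
      | exact absurd (hU hx) hxL
      | exact absurd (hU hy) hyL
      | simp [hx, hy, hxL, hyL]

/-- Two edges lying in the same even subsets of `P`. -/
def Series (P : Finset G.E) (e f : G.E) : Prop := ∀ Y ⊆ P, Ev Y → (e ∈ Y ↔ f ∈ Y)

lemma series_of_boundary {P : Finset G.E} {U : Finset G.V} {e f : G.E}
    (h : G.boundary (core P) U = {e, f}) : Series P e f := by
  intro Y hY hev
  have hsub := boundary_mono (hev.subset_core hY) U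
  have he : e ∈ G.boundary (core P) U := by simp [h]
  have hf : f ∈ G.boundary (core P) U := by simp [h]
  have key : ∀ {a b : G.E}, G.boundary (core P) U = {a, b} → a ∈ G.boundary (core P) U →
      a ∈ Y → b ∈ Y := by
    intro a b hab ha haY
    by_contra hb
    refine hev.boundary_ne_singleton U a (Finset.Subset.antisymm ?_ ?_)
    · intro g hg
      have := hsub hg
      rw [hab, Finset.mem_insert, Finset.mem_singleton] at this
      rcases this with rfl | rfl
      · simp
      · exact absurd (boundary_subset _ _ hg) hb
    · rw [Finset.singleton_subset_iff]
      exact mem_boundary.2 ⟨haY, (mem_boundary.1 ha).2⟩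
  exact ⟨key h he, key (h.trans (Finset.pair_comm _ _)) hf⟩

/-- A spanning forest `T` of the part of the core of `P` on the vertex set `X`, with one root in
each component, together with disjoint circuits each having one edge outside `T`. -/
structure Forest (P : Finset G.E) (X : Finset G.V) (T : Finset G.E) (𝒦 : Finset (Finset G.E))
    (rts : Finset G.V) : Prop where
  sub : T ⊆ core P
  ends : ∀ e ∈ T, ∀ x ∈ G.ends e, x ∈ X
  circ : ∀ K ∈ 𝒦, G.IsCircuit K ∧ K ⊆ core P ∧ (K \ T).card = 1 ∧ 2 ≤ K.card ∧ G.support K ⊆ X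
  disj : ∀ K ∈ 𝒦, ∀ K' ∈ 𝒦, K ≠ K' → Disjoint K K'
  reach : ∀ u ∈ X, ∀ v ∈ X, G.Reach (core P) u v → G.Reach T u v
  roots : rts ⊆ X
  card : T.card + rts.card = X.card
  root : ∀ v ∈ X, ∃ r ∈ rts, G.Reach T r v

lemma mem_of_mem_biUnion {𝒦 : Finset (Finset G.E)} {X : Finset G.V}
    (h : ∀ K ∈ 𝒦, G.support K ⊆ X) {e : G.E} (he : e ∈ 𝒦.biUnion id) {x : G.V}
    (hx : x ∈ G.ends e) : x ∈ X := by
  obtain ⟨K, hK, heK⟩ := Finset.mem_biUnion.1 he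
  exact h K hK (mem_support.2 ⟨e, heK, hx⟩)

lemma Cactus.mem_of_mem {H T : Finset G.E} {A : Finset G.V} {𝒦 : Finset (Finset G.E)}
    (h : Cactus H A T 𝒦) {e : G.E} (he : e ∈ 𝒦.biUnion id) {x : G.V} (hx : x ∈ G.ends e) :
    x ∈ A := mem_of_mem_biUnion (fun K hK => (h.circ K hK).2.2.2.2) he hx

lemma Cactus.sub_edges {H T : Finset G.E} {A : Finset G.V} {𝒦 : Finset (Finset G.E)}
    (h : Cactus H A T 𝒦) : T ⊆ H := fun e he => by
  obtain ⟨K, hK, heK⟩ := Finset.mem_biUnion.1 (h.sub he)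
  exact (h.circ K hK).2.1 heK

lemma Forest.mem_of_mem {P T : Finset G.E} {X rts : Finset G.V} {𝒦 : Finset (Finset G.E)}
    (h : Forest P X T 𝒦 rts) {e : G.E} (he : e ∈ 𝒦.biUnion id) {x : G.V} (hx : x ∈ G.ends e) :
    x ∈ X := mem_of_mem_biUnion (fun K hK => (h.circ K hK).2.2.2.2) he hx

lemma exists_mem_ends (e : G.E) : ∃ x, x ∈ G.ends e := by
  obtain ⟨x, y, h⟩ := exists_ends e
  exact ⟨x, by simp [h]⟩

lemma Forest.addRoot {P T : Finset G.E} {X rts : Finset G.V} {𝒦 : Finset (Finset G.E)}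
    (h : Forest P X T 𝒦 rts) {v : G.V} (hv : v ∉ X)
    (hcut : ∀ u ∈ X, ¬ G.Reach (core P) u v) :
    Forest P (insert v X) T 𝒦 (insert v rts) where
  sub := h.sub
  ends := fun e he x hx => Finset.mem_insert_of_mem (h.ends e he x hx)
  circ := fun K hK => by
    obtain ⟨h1, h2, h3, h4, h5⟩ := h.circ K hK
    exact ⟨h1, h2, h3, h4, h5.trans (Finset.subset_insert _ _)⟩
  disj := h.disj
  reach := by
    intro u hu w hw huw
    rcases Finset.mem_insert.1 hu with hu | hu <;> rcases Finset.mem_insert.1 hw with hw | hw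
    · rw [hu, hw]
      exact Reach.refl _ _
    · rw [hu] at huw
      exact absurd huw.symm (hcut w hw)
    · rw [hw] at huw
      exact absurd huw (hcut u hu)
    · exact h.reach u hu w hw huw
  roots := Finset.insert_subset_insert _ h.roots
  card := by
    rw [Finset.card_insert_of_notMem hv, Finset.card_insert_of_notMem fun h' => hv (h.roots h'),
      ← h.card]
    omega
  root := by
    intro w hw
    rcases Finset.mem_insert.1 hw with rfl | hw
    · exact ⟨w, by simp, Reach.refl _ _⟩
    · obtain ⟨r, hr, h'⟩ := h.root w hw
      exact ⟨r, Finset.mem_insert_of_mem hr, h'⟩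

lemma Forest.attach {P T H TC : Finset G.E} {X rts A : Finset G.V} {𝒦 𝒦C : Finset (Finset G.E)}
    (h : Forest P X T 𝒦 rts) (hc : Cactus H A TC 𝒦C) (hH : H ⊆ core P) (hA : ∀ v ∈ A, v ∉ X)
    {x : G.E} (hx : x ∈ core P) {a a' : G.V} (hxe : G.ends x = s(a, a')) (ha : a ∈ A)
    (ha' : a' ∈ X) : Forest P (X ∪ A) (insert x (T ∪ TC)) (𝒦 ∪ 𝒦C) rts := by
  have hax : a ∈ G.ends x := by simp [hxe]
  have hax' : a' ∈ G.ends x := by simp [hxe]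
  have hxT : x ∉ T := fun h' => hA a ha (h.ends x h' a hax)
  have hxD : x ∉ 𝒦.biUnion id := fun h' => hA a ha (h.mem_of_mem h' hax)
  have hxDC : x ∉ 𝒦C.biUnion id := fun h' => hA a' (hc.mem_of_mem h' hax') ha'
  have hdis : ∀ e, (∀ v ∈ G.ends e, v ∈ X) → (∀ v ∈ G.ends e, v ∈ A) → False := by
    intro e h1 h2
    obtain ⟨v, hv⟩ := exists_mem_ends e
    exact hA v (h2 v hv) (h1 v hv)
  have hDX : ∀ K ∈ 𝒦, ∀ e ∈ K, ∀ v ∈ G.ends e, v ∈ X := fun K hK e he v hv =>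
    h.mem_of_mem (Finset.mem_biUnion.2 ⟨K, hK, he⟩) hv
  have hDA : ∀ K ∈ 𝒦C, ∀ e ∈ K, ∀ v ∈ G.ends e, v ∈ A := fun K hK e he v hv =>
    hc.mem_of_mem (Finset.mem_biUnion.2 ⟨K, hK, he⟩) hv
  refine ⟨?_, ?_, ?_, ?_, ?_, ?_, ?_, ?_⟩
  · exact Finset.insert_subset hx (Finset.union_subset h.sub (hc.sub_edges.trans hH))
  · intro e he v hv
    rcases Finset.mem_insert.1 he with rfl | he
    · rw [hxe, Sym2.mem_iff] at hv
      rcases hv with rfl | rfl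
      · exact Finset.mem_union_right _ ha
      · exact Finset.mem_union_left _ ha'
    · rcases Finset.mem_union.1 he with he | he
      · exact Finset.mem_union_left _ (h.ends e he v hv)
      · exact Finset.mem_union_right _ (hc.mem_of_mem (hc.sub he) hv)
  · intro K hK
    rcases Finset.mem_union.1 hK with hK | hK
    · obtain ⟨h1, h2, h3, h4, h5⟩ := h.circ K hK
      refine ⟨h1, h2, ?_, h4, h5.trans Finset.subset_union_left⟩
      rw [← h3]
      congr 1
      ext e
      rw [Finset.mem_sdiff, Finset.mem_sdiff, Finset.mem_insert, Finset.mem_union]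
      refine and_congr_right fun he => not_congr ⟨?_, fun h' => Or.inr (Or.inl h')⟩
      rintro (rfl | h' | h')
      · exact absurd (Finset.mem_biUnion.2 ⟨K, hK, he⟩) hxD
      · exact h'
      · exact (hdis e (hDX K hK e he) fun v hv => hc.mem_of_mem (hc.sub h') hv).elim
    · obtain ⟨h1, h2, h3, h4, h5⟩ := hc.circ K hK
      refine ⟨h1, h2.trans hH, ?_, h4, h5.trans Finset.subset_union_right⟩
      rw [← h3]
      congr 1
      ext e
      rw [Finset.mem_sdiff, Finset.mem_sdiff, Finset.mem_insert, Finset.mem_union]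
      refine and_congr_right fun he => not_congr ⟨?_, fun h' => Or.inr (Or.inr h')⟩
      rintro (rfl | h' | h')
      · exact absurd (Finset.mem_biUnion.2 ⟨K, hK, he⟩) hxDC
      · exact (hdis e (h.ends e h') (hDA K hK e he)).elim
      · exact h'
  · have key : ∀ K ∈ 𝒦, ∀ K' ∈ 𝒦C, Disjoint K K' := fun K hK K' hK' =>
      Finset.disjoint_left.2 fun e he he' => hdis e (hDX K hK e he) (hDA K' hK' e he')
    intro K hK K' hK' hne
    rcases Finset.mem_union.1 hK with hK | hK <;> rcases Finset.mem_union.1 hK' with hK' | hK'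
    · exact h.disj K hK K' hK' hne
    · exact key K hK K' hK'
    · exact (key K' hK' K hK).symm
    · exact hc.disj K hK K' hK' hne
  · have hT' : T ⊆ insert x (T ∪ TC) := Finset.subset_union_left.trans (Finset.subset_insert _ _)
    have hTCx : TC ⊆ insert x (T ∪ TC) := Finset.subset_union_right.trans (Finset.subset_insert _ _)
    have hsub : insert x (T ∪ TC) ⊆ core P :=
      Finset.insert_subset hx (Finset.union_subset h.sub (hc.sub_edges.trans hH))
    have hxr : G.Reach (insert x (T ∪ TC)) a a' := reach_of_ends (Finset.mem_insert_self _ _) hxe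
    have key : ∀ u ∈ X ∪ A, ∃ u' ∈ X, G.Reach (insert x (T ∪ TC)) u u' := by
      intro u hu
      rcases Finset.mem_union.1 hu with hu | hu
      · exact ⟨u, hu, Reach.refl _ _⟩
      · exact ⟨a', ha', ((hc.reach u hu a ha).mono hTCx).trans hxr⟩
    intro u hu v hv huv
    obtain ⟨u', hu', h1⟩ := key u hu
    obtain ⟨v', hv', h2⟩ := key v hv
    exact (h1.trans ((h.reach u' hu' v' hv'
      (((h1.mono hsub).symm.trans huv).trans (h2.mono hsub))).mono hT')).trans h2.symm
  · exact h.roots.trans Finset.subset_union_left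
  · have hd : Disjoint T TC := Finset.disjoint_left.2 fun e he he' =>
      hdis e (h.ends e he) fun v hv => hc.mem_of_mem (hc.sub he') hv
    rw [Finset.card_insert_of_notMem, Finset.card_union_of_disjoint hd,
      Finset.card_union_of_disjoint (Finset.disjoint_left.2 fun v hv hv' => hA v hv' hv)]
    · have := h.card
      have := hc.card
      omega
    · rw [Finset.mem_union]
      exact fun h' => h'.elim hxT fun h' => hxDC (hc.sub h')
  · have hT' : T ⊆ insert x (T ∪ TC) := Finset.subset_union_left.trans (Finset.subset_insert _ _)
    have hTCx : TC ⊆ insert x (T ∪ TC) := Finset.subset_union_right.trans (Finset.subset_insert _ _)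
    intro v hv
    rcases Finset.mem_union.1 hv with hv | hv
    · obtain ⟨r, hr, h'⟩ := h.root v hv
      exact ⟨r, hr, h'.mono hT'⟩
    · obtain ⟨r, hr, h'⟩ := h.root a' ha'
      exact ⟨r, hr, ((h'.mono hT').trans
        (reach_of_ends (Finset.mem_insert_self _ _) hxe).symm).trans
        ((hc.reach a ha v hv).mono hTCx)⟩

/-- A spanning forest as in `Forest`, together with data that will produce one even set meeting
the edges of the forest which lie in none of the circuits. -/
structure Stage (P : Finset G.E) (X : Finset G.V) (T : Finset G.E) (𝒦 : Finset (Finset G.E))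
    (rts : Finset G.V) (R Fx : Finset G.E) : Prop where
  forest : Forest P X T 𝒦 rts
  sub : R ⊆ core P
  ends : ∀ e ∈ R, ∀ x ∈ G.ends e, x ∈ X
  card : R.card ≤ Fx.card
  fix_sub : ∀ e ∈ Fx, e ∈ T ∧ e ∉ 𝒦.biUnion id
  fix : ∀ Y, Ev Y → Y ⊆ core P → ∃ C, Ev C ∧ C ⊆ T ∪ 𝒦.biUnion id ∪ R ∧
    ∀ f ∈ Fx, f ∈ symmDiff Y C
  series : ∀ e ∈ T, e ∉ 𝒦.biUnion id → ∃ z, Series P e z ∧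
    (z ∈ Fx ∨ z ∈ core P ∧ z ∉ T ∧ ∃ x ∈ G.ends z, x ∈ X)

lemma Stage.empty (P : Finset G.E) : Stage P ∅ ∅ ∅ ∅ ∅ ∅ where
  forest := by constructor <;> simp
  sub := by simp
  ends := by simp
  card := le_rfl
  fix_sub := by simp
  fix := fun _ _ _ => ⟨∅, ev_empty, by simp, by simp⟩
  series := by simp

lemma Stage.addRoot {P T R Fx : Finset G.E} {X rts : Finset G.V} {𝒦 : Finset (Finset G.E)}
    (h : Stage P X T 𝒦 rts R Fx) {v : G.V} (hv : v ∉ X)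
    (hcut : ∀ u ∈ X, ¬ G.Reach (core P) u v) :
    Stage P (insert v X) T 𝒦 (insert v rts) R Fx where
  forest := h.forest.addRoot hv hcut
  sub := h.sub
  ends := fun e he x hx => Finset.mem_insert_of_mem (h.ends e he x hx)
  card := h.card
  fix_sub := h.fix_sub
  fix := h.fix
  series := fun e he heD => by
    obtain ⟨z, h1, h2⟩ := h.series e he heD
    refine ⟨z, h1, h2.imp_right ?_⟩
    rintro ⟨h3, h4, x, h5, h6⟩
    exact ⟨h3, h4, x, h5, Finset.mem_insert_of_mem h6⟩

lemma Series.trans {P : Finset G.E} {e f g : G.E} (h : Series P e f) (h' : Series P f g) :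
    Series P e g := fun Y hY hev => (h Y hY hev).trans (h' Y hY hev)

lemma Series.refl (P : Finset G.E) (e : G.E) : Series P e e := fun _ _ _ => Iff.rfl

lemma Stage.attach {P T H TC R Fx R' Fx' : Finset G.E} {X rts A : Finset G.V}
    {𝒦 𝒦C : Finset (Finset G.E)}
    (h : Stage P X T 𝒦 rts R Fx) (hc : Cactus H A TC 𝒦C) (hH : H ⊆ core P) (hA : ∀ v ∈ A, v ∉ X)
    {x : G.E} (hx : x ∈ core P) {a a' : G.V} (hxe : G.ends x = s(a, a')) (ha : a ∈ A)
    (ha' : a' ∈ X) (hR' : R' ⊆ core P) (hends : ∀ e ∈ R', ∀ x ∈ G.ends e, x ∈ X ∪ A)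
    (hcard : R'.card ≤ Fx'.card) (hFx : Fx ⊆ Fx') (hFx' : Fx' ⊆ insert x Fx)
    (hfix : ∀ Y, Ev Y → Y ⊆ core P → ∃ C, Ev C ∧
      C ⊆ insert x (T ∪ TC) ∪ (𝒦 ∪ 𝒦C).biUnion id ∪ R' ∧ ∀ f ∈ Fx', f ∈ symmDiff Y C)
    (hser : ∃ z, Series P x z ∧
      (z ∈ Fx' ∨ z ∈ core P ∧ z ∉ insert x (T ∪ TC) ∧ ∃ x ∈ G.ends z, x ∈ X ∪ A)) :
    Stage P (X ∪ A) (insert x (T ∪ TC)) (𝒦 ∪ 𝒦C) rts R' Fx' where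
  forest := h.forest.attach hc hH hA hx hxe ha ha'
  sub := hR'
  ends := hends
  card := hcard
  fix_sub := by
    intro e he
    rw [Finset.union_biUnion, Finset.mem_union, not_or]
    rcases Finset.mem_insert.1 (hFx' he) with rfl | he
    · refine ⟨Finset.mem_insert_self _ _, fun h' => ?_, fun h' => ?_⟩
      · exact hA a ha (h.forest.mem_of_mem h' (by simp [hxe]))
      · exact hA a' (hc.mem_of_mem h' (by simp [hxe])) ha'
    · obtain ⟨h1, h2⟩ := h.fix_sub e he
      refine ⟨Finset.mem_insert_of_mem (Finset.mem_union_left _ h1), h2, fun h' => ?_⟩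
      obtain ⟨v, hv⟩ := exists_mem_ends e
      exact hA v (hc.mem_of_mem h' hv) (h.forest.ends e h1 v hv)
  fix := hfix
  series := by
    intro e he heD
    rw [Finset.union_biUnion, Finset.mem_union, not_or] at heD
    rcases Finset.mem_insert.1 he with rfl | he
    · exact hser
    rcases Finset.mem_union.1 he with he | he
    · obtain ⟨z, h1, h2⟩ := h.series e he heD.1
      rcases h2 with h2 | ⟨h3, h4, v, h5, h6⟩
      · exact ⟨z, h1, Or.inl (hFx h2)⟩
      · by_cases hzx : z = x
        · subst hzx
          obtain ⟨z', h7, h8⟩ := hser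
          exact ⟨z', h1.trans h7, h8⟩
        · refine ⟨z, h1, Or.inr ⟨h3, ?_, v, h5, Finset.mem_union_left _ h6⟩⟩
          rw [Finset.mem_insert, Finset.mem_union, not_or, not_or]
          exact ⟨hzx, h4, fun h' => hA v (hc.mem_of_mem (hc.sub h') h5) h6⟩
    · exact absurd (hc.sub he) heD.2

/-- Among the nonempty sets of vertices outside `X` with small boundary a minimal one induces a
graph without small cuts. -/
lemma exists_tight_piece (S : Finset G.E) {X : Finset G.V} (hX : X ≠ Finset.univ) :
    ∃ L : Finset G.V, L.Nonempty ∧ L ⊆ Xᶜ ∧ (G.boundary (ind S Xᶜ) L).card ≤ 1 ∧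
      ∀ U ⊆ L, U.Nonempty → U ≠ L → 2 ≤ (G.boundary (ind (ind S Xᶜ) L) U).card := by
  have hne : (Finset.univ.filter fun L : Finset G.V => L.Nonempty ∧ L ⊆ Xᶜ ∧
      (G.boundary (ind S Xᶜ) L).card ≤ 1).Nonempty := by
    refine ⟨Xᶜ, Finset.mem_filter.2 ⟨Finset.mem_univ _, ?_, le_rfl, ?_⟩⟩
    · rw [Finset.nonempty_iff_ne_empty, Ne, Finset.compl_eq_empty_iff]
      exact hX
    · have : G.boundary (ind S Xᶜ) Xᶜ = ∅ := by
        rw [Finset.eq_empty_iff_forall_notMem]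
        intro e he
        obtain ⟨x, y, h⟩ := exists_ends e
        rw [mem_boundary_of_ends h, mem_ind_of_ends h] at he
        rcases he with ⟨⟨-, h1, h2⟩, h3 | h3⟩
        · exact h3.2 h2
        · exact h3.1 h1
      rw [this, Finset.card_empty]
      exact Nat.zero_le 1
  obtain ⟨L, hL, hmin⟩ := Finset.exists_min_image _ Finset.card hne
  obtain ⟨-, h1, h2, h3⟩ := Finset.mem_filter.1 hL
  refine ⟨L, h1, h2, h3, fun U hU hUn hUL => ?_⟩
  have key : ∀ W ⊆ L, W.Nonempty → W.card < L.card → 2 ≤ (G.boundary (ind S Xᶜ) W).card := by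
    intro W hW hWn hlt
    by_contra hc
    have := hmin W (Finset.mem_filter.2 ⟨Finset.mem_univ _, hWn, hW.trans h2, by omega⟩)
    omega
  have c1 := Finset.card_lt_card (hU.ssubset_of_ne hUL)
  have c2 := Finset.card_sdiff_add_card_eq_card hU
  have c3 := hUn.card_pos
  have k1 := key U hU hUn c1
  have k2 := key (L \ U) Finset.sdiff_subset (Finset.card_pos.1 (by omega)) (by omega)
  have k3 := card_boundary_add_le (ind S Xᶜ) hU
  omega

lemma exists_fixing {P T TC H R Fx : Finset G.E} {X rts A : Finset G.V}
    {𝒦 𝒦C : Finset (Finset G.E)} (h : Stage P X T 𝒦 rts R Fx) (hc : Cactus H A TC 𝒦C)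
    (hH : H ⊆ core P) (hA : ∀ v ∈ A, v ∉ X) {x y : G.E} (hx : x ∈ core P) (hy : y ∈ core P)
    (hxy : x ≠ y) {a a' b b' : G.V} (hxe : G.ends x = s(a, a')) (hye : G.ends y = s(b, b'))
    (ha : a ∈ A) (ha' : a' ∈ X) (hb : b ∈ A) (hb' : b' ∈ X) (Y : Finset G.E) (hY : Ev Y)
    (hYP : Y ⊆ core P) :
    ∃ C, Ev C ∧ C ⊆ insert x (T ∪ TC) ∪ (𝒦 ∪ 𝒦C).biUnion id ∪ insert y R ∧
      ∀ f ∈ insert x Fx, f ∈ symmDiff Y C := by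
  obtain ⟨J₁, hJ₁, W₁, p₁⟩ := (hc.reach a ha b hb).exists_pth
  have hr : G.Reach (core P) a' b' :=
    ((reach_of_ends hx hxe).symm.trans ((hc.reach a ha b hb).mono (hc.sub_edges.trans hH))).trans
      (reach_of_ends hy hye)
  obtain ⟨J₂, hJ₂, W₂, p₂⟩ := (h.forest.reach a' ha' b' hb' hr).exists_pth
  have hax : a ∈ G.ends x := by simp [hxe]
  have hax' : a' ∈ G.ends x := by simp [hxe]
  have hxT : x ∉ T := fun h' => hA a ha (h.forest.ends x h' a hax)
  have hxTC : x ∉ TC := fun h' => hA a' (hc.mem_of_mem (hc.sub h') hax') ha'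
  have hQ : Ev (symmDiff (symmDiff J₁ J₂) (symmDiff {x} {y})) := by
    intro v
    rw [bd_symmDiff, bd_symmDiff, bd_symmDiff, p₁.bd_eq, p₂.bd_eq, bd_eq_sum, bd_eq_sum,
      Finset.sum_singleton, Finset.sum_singleton, inc_of_ends hxe, inc_of_ends hye]
    push_cast
    have : ∀ p q r s : ZMod 2, (p + q) + (r + s) + ((p + r) + (q + s)) = 0 := by decide
    exact this _ _ _ _
  obtain ⟨Q, hQe⟩ : ∃ Q, Q = symmDiff (symmDiff J₁ J₂) (symmDiff {x} {y}) := ⟨_, rfl⟩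
  rw [← hQe] at hQ
  have hQs : ∀ e ∈ Q, e ∈ TC ∨ e ∈ T ∨ e = x ∨ e = y := by
    intro e he
    rw [hQe, Finset.mem_symmDiff] at he
    rcases he with ⟨he, -⟩ | ⟨he, -⟩
    · rcases Finset.mem_symmDiff.1 he with ⟨he, -⟩ | ⟨he, -⟩
      · exact Or.inl (hJ₁ he)
      · exact Or.inr (Or.inl (hJ₂ he))
    · rcases Finset.mem_symmDiff.1 he with ⟨he, -⟩ | ⟨he, -⟩
      · exact Or.inr (Or.inr (Or.inl (Finset.mem_singleton.1 he)))
      · exact Or.inr (Or.inr (Or.inr (Finset.mem_singleton.1 he)))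
  have hxQ : x ∈ Q := by
    rw [hQe, Finset.mem_symmDiff]
    refine Or.inr ⟨Finset.mem_symmDiff.2 (Or.inl ⟨by simp, by simpa using hxy⟩), fun h' => ?_⟩
    rcases Finset.mem_symmDiff.1 h' with ⟨he, -⟩ | ⟨he, -⟩
    · exact hxTC (hJ₁ he)
    · exact hxT (hJ₂ he)
  have hQP : Q ⊆ core P := fun e he => by
    rcases hQs e he with h' | h' | rfl | rfl
    · exact hH (hc.sub_edges h')
    · exact h.forest.sub h'
    · exact hx
    · exact hy
  have hold : ∀ C ⊆ T ∪ 𝒦.biUnion id ∪ R,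
      C ⊆ insert x (T ∪ TC) ∪ (𝒦 ∪ 𝒦C).biUnion id ∪ insert y R := by
    intro C hC e he
    rw [Finset.union_biUnion]
    have := hC he
    rw [Finset.mem_union, Finset.mem_union] at this
    rw [Finset.mem_union, Finset.mem_union, Finset.mem_union, Finset.mem_insert, Finset.mem_insert,
      Finset.mem_union]
    rcases this with (h' | h') | h'
    · exact Or.inl (Or.inl (Or.inr (Or.inl h')))
    · exact Or.inl (Or.inr (Or.inl h'))
    · exact Or.inr (Or.inr h')
  have hxC : ∀ C ⊆ T ∪ 𝒦.biUnion id ∪ R, x ∉ C := by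
    intro C hC h'
    have := hC h'
    rw [Finset.mem_union, Finset.mem_union] at this
    rcases this with (h' | h') | h'
    · exact hxT h'
    · exact hA a ha (h.forest.mem_of_mem h' hax)
    · exact hA a ha (h.ends x h' a hax)
  by_cases hxY : x ∈ Y
  · obtain ⟨C, hC, hCs, hCf⟩ := h.fix Y hY hYP
    refine ⟨C, hC, hold C hCs, fun f hf => ?_⟩
    rcases Finset.mem_insert.1 hf with rfl | hf
    · exact Finset.mem_symmDiff.2 (Or.inl ⟨hxY, hxC C hCs⟩)
    · exact hCf f hf
  · obtain ⟨C, hC, hCs, hCf⟩ := h.fix (symmDiff Y Q) (hY.symmDiff hQ)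
      (Finset.symmDiff_subset_union.trans (Finset.union_subset hYP hQP))
    refine ⟨symmDiff Q C, hQ.symmDiff hC, ?_, fun f hf => ?_⟩
    · refine Finset.symmDiff_subset_union.trans (Finset.union_subset (fun e he => ?_) (hold C hCs))
      rw [Finset.mem_union, Finset.mem_union, Finset.mem_insert, Finset.mem_insert,
        Finset.mem_union]
      rcases hQs e he with h' | h' | h' | h'
      · exact Or.inl (Or.inl (Or.inr (Or.inr h')))
      · exact Or.inl (Or.inl (Or.inr (Or.inl h')))
      · exact Or.inl (Or.inl (Or.inl h'))
      · exact Or.inr (Or.inl h')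
    · rw [← symmDiff_assoc]
      rcases Finset.mem_insert.1 hf with rfl | hf
      · refine Finset.mem_symmDiff.2 (Or.inl ⟨Finset.mem_symmDiff.2 (Or.inr ⟨hxQ, hxY⟩), hxC C hCs⟩)
      · exact hCf f hf

lemma Stage.step {P T R Fx : Finset G.E} {X rts : Finset G.V} {𝒦 : Finset (Finset G.E)}
    (h : Stage P X T 𝒦 rts R Fx) (hX : X ≠ Finset.univ) :
    ∃ X' T' 𝒦' rts' R' Fx', Stage P X' T' 𝒦' rts' R' Fx' ∧ X ⊂ X' := by
  obtain ⟨L, ⟨v, hv⟩, hLX, hsmall, htight⟩ := exists_tight_piece (core P) hX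
  have hLX' : ∀ u ∈ L, u ∉ X := fun u hu => Finset.mem_compl.1 (hLX hu)
  have hout : ∀ e ∈ G.boundary (core P) L, e ∉ G.boundary (ind (core P) Xᶜ) L →
      ∃ a ∈ L, ∃ a' ∈ X, G.ends e = s(a, a') := by
    intro e he hne
    obtain ⟨p, q, hpq⟩ := exists_ends e
    rw [mem_boundary_of_ends hpq] at he hne
    rw [mem_ind_of_ends hpq, Finset.mem_compl, Finset.mem_compl] at hne
    rcases he.2 with h1 | h1
    · refine ⟨p, h1.1, q, ?_, hpq⟩
      by_contra hq
      exact hne ⟨⟨he.1, hLX' p h1.1, hq⟩, Or.inl h1⟩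
    · refine ⟨q, h1.2, p, ?_, hpq.trans Sym2.eq_swap⟩
      by_contra hp
      exact hne ⟨⟨he.1, hp, hLX' q h1.2⟩, Or.inr h1⟩
  have hsub : G.boundary (ind (core P) Xᶜ) L ⊆ G.boundary (core P) L :=
    boundary_mono (ind_subset _ _) L
  by_cases hA : ∃ x ∈ core P, ∃ a ∈ L, ∃ a' ∈ X, G.ends x = s(a, a')
  swap
  · have hb : G.boundary (core P) L = ∅ := by
      have heq : G.boundary (core P) L = G.boundary (ind (core P) Xᶜ) L := by
        refine Finset.Subset.antisymm (fun e he => ?_) hsub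
        by_contra hne
        obtain ⟨a, ha, a', ha', hee⟩ := hout e he hne
        exact hA ⟨e, boundary_subset _ _ he, a, ha, a', ha', hee⟩
      rw [← heq] at hsmall
      by_contra hne
      have := Finset.card_pos.2 (Finset.nonempty_iff_ne_empty.2 hne)
      obtain ⟨e, he⟩ := Finset.card_eq_one.1 (by omega : (G.boundary (core P) L).card = 1)
      exact boundary_core_ne P L e he
    refine ⟨insert v X, T, 𝒦, insert v rts, R, Fx, h.addRoot (hLX' v hv) fun u hu hr => ?_,
      Finset.ssubset_insert (hLX' v hv)⟩
    exact hLX' u ((mem_iff_of_boundary hb hr).2 hv) hu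
  obtain ⟨x, hx, a, ha, a', ha', hxe⟩ := hA
  have hHL : ∀ e ∈ ind (ind (core P) Xᶜ) L, ∀ x ∈ G.ends e, x ∈ L := fun e he =>
    (Finset.mem_filter.1 he).2
  have hHP : ind (ind (core P) Xᶜ) L ⊆ core P := (ind_subset _ _).trans (ind_subset _ _)
  have hxb : x ∈ G.boundary (core P) L :=
    (mem_boundary_of_ends hxe).2 ⟨hx, Or.inl ⟨ha, fun h' => hLX' a' h' ha'⟩⟩
  by_cases hB : ∃ y ∈ core P, y ≠ x ∧ ∃ b ∈ L, ∃ b' ∈ X, G.ends y = s(b, b')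
  · obtain ⟨y, hy, hyx, b, hb, b', hb', hye⟩ := hB
    obtain ⟨A, TC, 𝒦C, hc, haA, hbA, hAL⟩ := exists_cactus hHL htight ha hb
    have hAX : ∀ u ∈ A, u ∉ X := fun u hu => hLX' u (hAL hu)
    refine ⟨X ∪ A, insert x (T ∪ TC), 𝒦 ∪ 𝒦C, rts, insert y R, insert x Fx,
      h.attach hc hHP hAX hx hxe haA ha' (Finset.insert_subset hy h.sub) ?_ ?_
        (Finset.subset_insert _ _) le_rfl ?_ ?_, ?_⟩
    · intro e he u hu
      rcases Finset.mem_insert.1 he with rfl | he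
      · rw [hye, Sym2.mem_iff] at hu
        rcases hu with rfl | rfl
        · exact Finset.mem_union_right _ hbA
        · exact Finset.mem_union_left _ hb'
      · exact Finset.mem_union_left _ (h.ends e he u hu)
    · have hxF : x ∉ Fx := fun h' =>
        hLX' a ha (h.forest.ends x (h.fix_sub x h').1 a (by simp [hxe]))
      rw [Finset.card_insert_of_notMem hxF]
      exact (Finset.card_insert_le _ _).trans (Nat.succ_le_succ h.card)
    · exact exists_fixing h hc hHP hAX hx hy hyx.symm hxe hye haA ha' hbA hb'
    · exact ⟨x, Series.refl P x, Or.inl (Finset.mem_insert_self _ _)⟩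
    · exact Finset.ssubset_iff_subset_ne.2 ⟨Finset.subset_union_left, fun h' =>
        hLX' a ha (h' ▸ Finset.mem_union_right _ haA)⟩
  · have hin : ∀ e ∈ G.boundary (core P) L, e ≠ x → e ∈ G.boundary (ind (core P) Xᶜ) L := by
      intro e he hex
      by_contra hne
      obtain ⟨b, hb, b', hb', hee⟩ := hout e he hne
      exact hB ⟨e, boundary_subset _ _ he, hex, b, hb, b', hb', hee⟩
    obtain ⟨z, hz, hzx⟩ : ∃ z ∈ G.boundary (core P) L, z ≠ x := by
      by_contra! hall
      refine boundary_core_ne P L x (Finset.Subset.antisymm (fun e he => ?_) ?_)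
      · exact Finset.mem_singleton.2 (hall e he)
      · exact Finset.singleton_subset_iff.2 hxb
    have hcutxz : G.boundary (core P) L = {x, z} := by
      refine Finset.Subset.antisymm (fun e he => ?_) ?_
      · rw [Finset.mem_insert, Finset.mem_singleton]
        by_cases hex : e = x
        · exact Or.inl hex
        · exact Or.inr (Finset.card_le_one.1 hsmall e (hin e he hex) z (hin z hz hzx))
      · exact Finset.insert_subset hxb (Finset.singleton_subset_iff.2 hz)
    obtain ⟨b, hb, c, hcL, hze⟩ : ∃ b ∈ L, ∃ c, c ∉ L ∧ G.ends z = s(b, c) := by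
      obtain ⟨p, q, hpq⟩ := exists_ends z
      rcases ((mem_boundary_of_ends hpq).1 hz).2 with h1 | h1
      · exact ⟨p, h1.1, q, h1.2, hpq⟩
      · exact ⟨q, h1.2, p, h1.1, hpq.trans Sym2.eq_swap⟩
    obtain ⟨A, TC, 𝒦C, hc, haA, hbA, hAL⟩ := exists_cactus hHL htight ha hb
    have hAX : ∀ u ∈ A, u ∉ X := fun u hu => hLX' u (hAL hu)
    have hbz : b ∈ G.ends z := by simp [hze]
    refine ⟨X ∪ A, insert x (T ∪ TC), 𝒦 ∪ 𝒦C, rts, R, Fx,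
      h.attach hc hHP hAX hx hxe haA ha' h.sub ?_ h.card le_rfl (Finset.subset_insert _ _) ?_ ?_,
      ?_⟩
    · exact fun e he u hu => Finset.mem_union_left _ (h.ends e he u hu)
    · intro Y hY hYP
      obtain ⟨C, hC, hCs, hCf⟩ := h.fix Y hY hYP
      refine ⟨C, hC, hCs.trans ?_, hCf⟩
      refine Finset.union_subset_union (Finset.union_subset_union ?_ ?_) le_rfl
      · exact Finset.subset_union_left.trans (Finset.subset_insert _ _)
      · rw [Finset.union_biUnion]
        exact Finset.subset_union_left
    · refine ⟨z, series_of_boundary hcutxz, Or.inr ⟨boundary_subset _ _ hz, ?_, b, hbz,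
        Finset.mem_union_right _ hbA⟩⟩
      rw [Finset.mem_insert, Finset.mem_union, not_or, not_or]
      refine ⟨hzx, fun h' => hLX' b hb (h.forest.ends z h' b hbz), fun h' => ?_⟩
      exact hcL (hAL (hc.mem_of_mem (hc.sub h') (by simp [hze])))
    · exact Finset.ssubset_iff_subset_ne.2 ⟨Finset.subset_union_left, fun h' =>
        hLX' a ha (h' ▸ Finset.mem_union_right _ haA)⟩

lemma exists_stage_univ (P : Finset G.E) :
    ∃ T 𝒦 rts R Fx, Stage P Finset.univ T 𝒦 rts R Fx := by
  have key : ∀ n, ∀ X T 𝒦 rts R Fx, Stage P X T 𝒦 rts R Fx → Xᶜ.card = n →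
      ∃ T 𝒦 rts R Fx, Stage P Finset.univ T 𝒦 rts R Fx := by
    intro n
    induction n using Nat.strong_induction_on with
    | _ n ih =>
      intro X T 𝒦 rts R Fx h hn
      by_cases hX : X = Finset.univ
      · subst hX
        exact ⟨T, 𝒦, rts, R, Fx, h⟩
      · obtain ⟨X', T', 𝒦', rts', R', Fx', h', hlt⟩ := h.step hX
        refine ih _ ?_ X' T' 𝒦' rts' R' Fx' h' rfl
        rw [← hn]
        exact Finset.card_lt_card (Finset.compl_ssubset_compl.2 hlt)
  exact key _ ∅ ∅ ∅ ∅ ∅ ∅ (Stage.empty P) rfl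

/-- Extend a forest with given roots by bridges of `P` to a maximal forest of `P`. -/
lemma exists_forest_extension {P : Finset G.E} {n : ℕ} (hn : 0 < n) : ∀ (m : ℕ) (T : Finset G.E)
    (rts : Finset G.V), rts.card = m → T ⊆ P → T.card + rts.card ≤ n →
    (∀ v, ∃ r ∈ rts, G.Reach T r v) →
    ∃ T', T ⊆ T' ∧ T' ⊆ P ∧ T'.card + 1 ≤ n ∧ (∀ u v, G.Reach P u v → G.Reach T' u v) ∧
      ∀ e ∈ T', e ∉ T → ∃ x y, G.ends e = s(x, y) ∧ ¬ G.Reach T x y := by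
  intro m
  induction m with
  | zero =>
    intro T rts hm hT hcard hroot
    have : ∀ v : G.V, False := fun v => by
      obtain ⟨r, hr, -⟩ := hroot v
      rw [Finset.card_eq_zero.1 hm] at hr
      simp at hr
    refine ⟨T, le_rfl, hT, ?_, fun u => (this u).elim, fun e he heT => absurd he heT⟩
    have : T = ∅ := by
      rw [Finset.eq_empty_iff_forall_notMem]
      intro e he
      obtain ⟨x, -⟩ := exists_mem_ends e
      exact this x
    rw [this, Finset.card_empty]
    omega
  | succ m ih =>
    intro T rts hm hT hcard hroot
    by_cases hall : ∀ u v, G.Reach P u v → G.Reach T u v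
    · exact ⟨T, le_rfl, hT, by omega, hall, fun e he heT => absurd he heT⟩
    obtain ⟨e, he, x, y, hxy, hr⟩ : ∃ e ∈ P, ∃ x y, G.ends e = s(x, y) ∧ ¬ G.Reach T x y := by
      by_contra! hno
      exact hall fun u v h => Reach.of_edges (fun e he x y hxy => hno e he x y hxy) h
    have heT : e ∉ T := fun h => hr (reach_of_ends h hxy)
    obtain ⟨p, hp, hpx⟩ := hroot x
    obtain ⟨q, hq, hqy⟩ := hroot y
    have hsub := Finset.subset_insert e T
    have hpq : p ≠ q := fun h => hr (hpx.symm.trans (h ▸ hqy))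
    have hqp : G.Reach (insert e T) p q := ((hpx.mono hsub).trans
      (reach_of_ends (Finset.mem_insert_self _ _) hxy)).trans (hqy.mono hsub).symm
    have hc := Finset.card_erase_add_one hq
    obtain ⟨T', h1, h2, h3, h4, h5⟩ := ih (insert e T) (rts.erase q) (by omega)
      (Finset.insert_subset he hT) (by rw [Finset.card_insert_of_notMem heT]; omega) fun v => by
        obtain ⟨r, hr, hrv⟩ := hroot v
        by_cases hrq : r = q
        · exact ⟨p, Finset.mem_erase.2 ⟨hpq, hp⟩, hqp.trans (hrq ▸ hrv.mono hsub)⟩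
        · exact ⟨r, Finset.mem_erase.2 ⟨hrq, hr⟩, hrv.mono hsub⟩
    refine ⟨T', hsub.trans h1, h2, h3, h4, fun f hf hfT => ?_⟩
    by_cases hfe : f = e
    · exact ⟨x, y, hfe ▸ hxy, hr⟩
    · obtain ⟨x', y', h6, h7⟩ := h5 f hf fun h => (Finset.mem_insert.1 h).elim hfe hfT
      exact ⟨x', y', h6, fun h => h7 (h.mono hsub)⟩

/-- Every edge set `P` has a maximal forest `T`, disjoint circuits with one edge outside `T`, and
an even set `C`, such that each edge of `T` is a bridge of `P`, lies in one of the circuits or in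
`C`, or is in series with an edge outside `T`. -/
theorem exists_good_forest [Nonempty G.V] (P : Finset G.E) :
    ∃ (T : Finset G.E) (𝒦 : Finset (Finset G.E)) (C : Finset G.E), T ⊆ P ∧
      (∀ u v, G.Reach P u v → G.Reach T u v) ∧ T.card + 1 ≤ Fintype.card G.V ∧
      (∀ K ∈ 𝒦, G.IsCircuit K ∧ K ⊆ P ∧ (K \ T).card = 1 ∧ 2 ≤ K.card) ∧
      (∀ K ∈ 𝒦, ∀ K' ∈ 𝒦, K ≠ K' → Disjoint K K') ∧ Ev C ∧ C ⊆ P ∧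
      (C \ (T ∪ 𝒦.biUnion id)).card ≤ (T \ 𝒦.biUnion id).card ∧
      ∀ e ∈ T, e ∈ core P → e ∈ 𝒦.biUnion id ∨ e ∈ C ∨ ∃ f ∈ P, f ∉ T ∧ Series P e f := by
  obtain ⟨T, 𝒦, rts, R, Fx, h⟩ := exists_stage_univ P
  have hf := h.forest
  have hPc := core_subset P
  obtain ⟨T', h1, h2, h3, h4, h5⟩ := exists_forest_extension (P := P)
    (Fintype.card_pos (α := G.V)) rts.card T rts rfl (hf.sub.trans hPc)
    (by rw [hf.card, Finset.card_univ]) fun v => hf.root v (Finset.mem_univ v)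
  have hnew : ∀ e ∈ T', e ∈ core P → e ∈ T := by
    intro e he hec
    by_contra heT
    obtain ⟨x, y, hxy, hr⟩ := h5 e he heT
    exact hr (hf.reach x (Finset.mem_univ x) y (Finset.mem_univ y) (reach_of_ends hec hxy))
  have hDc : 𝒦.biUnion id ⊆ core P := Finset.biUnion_subset.2 fun K hK => (hf.circ K hK).2.1
  obtain ⟨C, hC, hCs, hCf⟩ := h.fix ∅ ev_empty (Finset.empty_subset _)
  have hCP : C ⊆ P :=
    hCs.trans ((Finset.union_subset (Finset.union_subset hf.sub hDc) h.sub).trans hPc)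
  refine ⟨T', 𝒦, C, h2, h4, h3, ?_, hf.disj, hC, hCP, ?_, ?_⟩
  · intro K hK
    obtain ⟨c1, c2, c3, c4, -⟩ := hf.circ K hK
    refine ⟨c1, c2.trans hPc, ?_, c4⟩
    rw [← c3]
    congr 1
    ext e
    rw [Finset.mem_sdiff, Finset.mem_sdiff]
    exact and_congr_right fun he => not_congr ⟨fun h' => hnew e h' (c2 he), fun h' => h1 h'⟩
  · refine (Finset.card_le_card (t := R) fun e he => ?_).trans
      (h.card.trans (Finset.card_le_card fun e he => ?_))
    · rw [Finset.mem_sdiff, Finset.mem_union, not_or] at he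
      have := hCs he.1
      rw [Finset.mem_union, Finset.mem_union] at this
      rcases this with (h' | h') | h'
      · exact absurd (h1 h') he.2.1
      · exact absurd h' he.2.2
      · exact h'
    · exact Finset.mem_sdiff.2 ⟨h1 (h.fix_sub e he).1, (h.fix_sub e he).2⟩
  · intro e he hec
    by_cases heD : e ∈ 𝒦.biUnion id
    · exact Or.inl heD
    obtain ⟨z, hz, hz'⟩ := h.series e (hnew e he hec) heD
    rcases hz' with hz' | ⟨h6, h7, -⟩
    · have hzC : z ∈ C := by
        rcases Finset.mem_symmDiff.1 (hCf z hz') with h' | h'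
        · simp at h'
        · exact h'.1
      exact Or.inr (Or.inl ((hz C hCP hC).2 hzC))
    · exact Or.inr (Or.inr ⟨z, hPc h6, fun hzT => h7 (hnew z hzT h6), hz⟩)

/-! ### Covering the core by few even sets of small total size -/

lemma card_sdiff_eq_sum {α : Type*} {X P : Finset α} (hX : X ⊆ P) (D : Finset α) :
    (X \ D).card = ∑ e ∈ P \ D, if e ∈ X then 1 else 0 := by
  rw [← Finset.card_filter]
  congr 1
  ext e
  rw [Finset.mem_filter, Finset.mem_sdiff, Finset.mem_sdiff]
  exact ⟨fun h => ⟨⟨hX h.1, h.2⟩, h.1⟩, fun h => ⟨h.2, h.1.2⟩⟩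

lemma card_eq_sum_ite {α : Type*} {X P : Finset α} (hX : X ⊆ P) :
    X.card = ∑ e ∈ P, if e ∈ X then 1 else 0 := by
  simpa using card_sdiff_eq_sum hX ∅

/-- Within a single circuit `K`, two even sets can be modified so as to cover `K`. -/
lemma exists_cover_on {α : Type*} (A B K : Finset α) (h2 : 2 ≤ K.card) :
    ∃ a ⊆ K, ∃ b ⊆ K, ∃ s ⊆ K, (a = ∅ ∨ a = K) ∧ (b = ∅ ∨ b = K) ∧ (s = ∅ ∨ s = K) ∧
      K ⊆ symmDiff A a ∪ symmDiff B b ∪ s ∧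
      3 * ((symmDiff A a ∩ K).card + (symmDiff B b ∩ K).card + s.card) + 4 ≤ 7 * K.card := by
  obtain ⟨p, hp⟩ : ∃ p, p = (K.filter fun e => e ∉ A ∧ e ∉ B).card := ⟨_, rfl⟩
  obtain ⟨q, hq⟩ : ∃ q, q = (K.filter fun e => e ∉ A ∧ e ∈ B).card := ⟨_, rfl⟩
  obtain ⟨r, hr⟩ : ∃ r, r = (K.filter fun e => e ∈ A ∧ e ∉ B).card := ⟨_, rfl⟩
  obtain ⟨t, ht⟩ : ∃ t, t = (K.filter fun e => e ∈ A ∧ e ∈ B).card := ⟨_, rfl⟩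
  have hsum : K.card = p + q + r + t := by
    rw [hp, hq, hr, ht, Finset.card_filter, Finset.card_filter, Finset.card_filter,
      Finset.card_filter, ← Finset.sum_add_distrib, ← Finset.sum_add_distrib,
      ← Finset.sum_add_distrib, Finset.card_eq_sum_ones]
    refine Finset.sum_congr rfl fun e _ => ?_
    by_cases h : e ∈ A <;> by_cases h' : e ∈ B <;> simp [h, h']
  have card_in : ∀ (X : Finset α), (symmDiff X ∅ ∩ K).card = (K.filter fun e => e ∈ X).card := by
    intro X
    congr 1
    ext e
    simp [Finset.mem_symmDiff, and_comm]
  have card_out : ∀ (X : Finset α), (symmDiff X K ∩ K).card = (K.filter fun e => e ∉ X).card := by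
    intro X
    congr 1
    ext e
    by_cases h : e ∈ K <;> simp [Finset.mem_symmDiff, h]
  have hA : (K.filter fun e => e ∈ A).card = r + t := by
    rw [hr, ht, Finset.card_filter, Finset.card_filter, Finset.card_filter,
      ← Finset.sum_add_distrib]
    refine Finset.sum_congr rfl fun e _ => ?_
    by_cases h : e ∈ A <;> by_cases h' : e ∈ B <;> simp [h, h']
  have hA' : (K.filter fun e => e ∉ A).card = p + q := by
    rw [hp, hq, Finset.card_filter, Finset.card_filter, Finset.card_filter,
      ← Finset.sum_add_distrib]
    refine Finset.sum_congr rfl fun e _ => ?_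
    by_cases h : e ∈ A <;> by_cases h' : e ∈ B <;> simp [h, h']
  have hB : (K.filter fun e => e ∈ B).card = q + t := by
    rw [hq, ht, Finset.card_filter, Finset.card_filter, Finset.card_filter,
      ← Finset.sum_add_distrib]
    refine Finset.sum_congr rfl fun e _ => ?_
    by_cases h : e ∈ A <;> by_cases h' : e ∈ B <;> simp [h, h']
  have hB' : (K.filter fun e => e ∉ B).card = p + r := by
    rw [hp, hr, Finset.card_filter, Finset.card_filter, Finset.card_filter,
      ← Finset.sum_add_distrib]
    refine Finset.sum_congr rfl fun e _ => ?_
    by_cases h : e ∈ A <;> by_cases h' : e ∈ B <;> simp [h, h']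
  have c1 : p = 0 → K ⊆ symmDiff A ∅ ∪ symmDiff B ∅ ∪ ∅ := by
    intro h e he
    rw [hp, Finset.card_eq_zero, Finset.filter_eq_empty_iff] at h
    have := h he
    by_cases h' : e ∈ A <;> by_cases h'' : e ∈ B <;> simp_all [Finset.mem_symmDiff]
  have c2 : q = 0 → K ⊆ symmDiff A ∅ ∪ symmDiff B K ∪ ∅ := by
    intro h e he
    rw [hq, Finset.card_eq_zero, Finset.filter_eq_empty_iff] at h
    have := h he
    by_cases h' : e ∈ A <;> by_cases h'' : e ∈ B <;> simp_all [Finset.mem_symmDiff]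
  have c3 : r = 0 → K ⊆ symmDiff A K ∪ symmDiff B ∅ ∪ ∅ := by
    intro h e he
    rw [hr, Finset.card_eq_zero, Finset.filter_eq_empty_iff] at h
    have := h he
    by_cases h' : e ∈ A <;> by_cases h'' : e ∈ B <;> simp_all [Finset.mem_symmDiff]
  have c4 : t = 0 → K ⊆ symmDiff A K ∪ symmDiff B K ∪ ∅ := by
    intro h e he
    rw [ht, Finset.card_eq_zero, Finset.filter_eq_empty_iff] at h
    have := h he
    by_cases h' : e ∈ A <;> by_cases h'' : e ∈ B <;> simp_all [Finset.mem_symmDiff]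
  have arith : (p = 0 ∧ 3 * ((r + t) + (q + t)) + 4 ≤ 7 * (p + q + r + t)) ∨
      (q = 0 ∧ 3 * ((r + t) + (p + r)) + 4 ≤ 7 * (p + q + r + t)) ∨
      (r = 0 ∧ 3 * ((p + q) + (q + t)) + 4 ≤ 7 * (p + q + r + t)) ∨
      (t = 0 ∧ 3 * ((p + q) + (p + r)) + 4 ≤ 7 * (p + q + r + t)) ∨ 4 ≤ p + q + r + t := by
    omega
  have hs : (∅ : Finset α).card = 0 := Finset.card_empty
  rcases arith with ⟨h, h'⟩ | ⟨h, h'⟩ | ⟨h, h'⟩ | ⟨h, h'⟩ | h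
  · refine ⟨∅, by simp, ∅, by simp, ∅, by simp, by simp, by simp, by simp, c1 h, ?_⟩
    rw [card_in, card_in, hA, hB, hs, hsum]
    omega
  · refine ⟨∅, by simp, K, le_rfl, ∅, by simp, by simp, by simp, by simp, c2 h, ?_⟩
    rw [card_in, card_out, hA, hB', hs, hsum]
    omega
  · refine ⟨K, le_rfl, ∅, by simp, ∅, by simp, by simp, by simp, by simp, c3 h, ?_⟩
    rw [card_out, card_in, hA', hB, hs, hsum]
    omega
  · refine ⟨K, le_rfl, K, le_rfl, ∅, by simp, by simp, by simp, by simp, c4 h, ?_⟩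
    rw [card_out, card_out, hA', hB', hs, hsum]
    omega
  · obtain ⟨a, ha, ha', ha''⟩ : ∃ a ⊆ K, (a = ∅ ∨ a = K) ∧
        2 * (symmDiff A a ∩ K).card ≤ p + q + r + t := by
      by_cases hle : r + t ≤ p + q
      · refine ⟨∅, by simp, by simp, ?_⟩
        rw [card_in, hA]
        omega
      · refine ⟨K, le_rfl, by simp, ?_⟩
        rw [card_out, hA']
        omega
    obtain ⟨b, hb, hb', hb''⟩ : ∃ b ⊆ K, (b = ∅ ∨ b = K) ∧
        2 * (symmDiff B b ∩ K).card ≤ p + q + r + t := by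
      by_cases hle : q + t ≤ p + r
      · refine ⟨∅, by simp, by simp, ?_⟩
        rw [card_in, hB]
        omega
      · refine ⟨K, le_rfl, by simp, ?_⟩
        rw [card_out, hB']
        omega
    refine ⟨a, ha, b, hb, K, le_rfl, ha', hb', by simp, Finset.subset_union_right, ?_⟩
    omega

lemma symmDiff_inter_of_disjoint {α : Type*} {A a D : Finset α} (h : Disjoint a D) :
    symmDiff A a ∩ D = A ∩ D := by
  ext e
  rw [Finset.mem_inter, Finset.mem_inter, Finset.mem_symmDiff]
  refine and_congr_left fun he => ?_
  have := Finset.disjoint_right.1 h he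
  simp [this]

lemma symmDiff_sdiff_of_subset {α : Type*} {A a D : Finset α} (h : a ⊆ D) :
    symmDiff A a \ D = A \ D := by
  ext e
  rw [Finset.mem_sdiff, Finset.mem_sdiff, Finset.mem_symmDiff]
  refine and_congr_left fun he => ?_
  have : e ∉ a := fun h' => he (h h')
  simp [this]

lemma exists_cover_circuits {A B : Finset G.E} (hA : Ev A) (hB : Ev B)
    (𝒦 : Finset (Finset G.E)) (hK : ∀ K ∈ 𝒦, G.IsCircuit K ∧ 2 ≤ K.card)
    (hd : ∀ K ∈ 𝒦, ∀ K' ∈ 𝒦, K ≠ K' → Disjoint K K') :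
    ∃ A' B' S, Ev A' ∧ Ev B' ∧ Ev S ∧ A' \ 𝒦.biUnion id = A \ 𝒦.biUnion id ∧
      B' \ 𝒦.biUnion id = B \ 𝒦.biUnion id ∧ S ⊆ 𝒦.biUnion id ∧
      𝒦.biUnion id ⊆ A' ∪ B' ∪ S ∧
      3 * ((A' ∩ 𝒦.biUnion id).card + (B' ∩ 𝒦.biUnion id).card + S.card) + 4 * 𝒦.card ≤
        7 * (𝒦.biUnion id).card := by
  induction 𝒦 using Finset.induction_on with
  | empty => exact ⟨A, B, ∅, hA, hB, ev_empty, rfl, rfl, by simp, by simp, by simp⟩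
  | @insert K 𝒦 hK𝒦 ih =>
    obtain ⟨A', B', S, a1, b1, s1, a2, b2, s2, hcov, hcard⟩ := ih
      (fun K' h => hK K' (Finset.mem_insert_of_mem h))
      fun K₁ h₁ K₂ h₂ => hd K₁ (Finset.mem_insert_of_mem h₁) K₂ (Finset.mem_insert_of_mem h₂)
    obtain ⟨hKc, hK2⟩ := hK K (Finset.mem_insert_self _ _)
    have hKD : Disjoint K (𝒦.biUnion id) := by
      rw [Finset.disjoint_biUnion_right]
      exact fun K' h => hd K (Finset.mem_insert_self _ _) K' (Finset.mem_insert_of_mem h)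
        fun he => hK𝒦 (he ▸ h)
    rw [Finset.biUnion_insert, id]
    clear ih hK hd
    generalize 𝒦.biUnion id = D at *
    obtain ⟨a, ha, b, hb, s, hs, ha', hb', hs', hcovK, hcardK⟩ := exists_cover_on A' B' K hK2
    have hev : ∀ x, x = ∅ ∨ x = K → Ev x := by
      rintro x (rfl | rfl)
      · exact ev_empty
      · exact hKc.ev
    have hout : ∀ X X' x : Finset G.E, x ⊆ K → X' \ D = X \ D →
        symmDiff X' x \ (K ∪ D) = X \ (K ∪ D) := by
      intro X X' x hx h
      rw [symmDiff_sdiff_of_subset (hx.trans Finset.subset_union_left), Finset.union_comm,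
        ← Finset.sup_eq_union, ← sdiff_sdiff_left, ← sdiff_sdiff_left, h]
    have hcin : ∀ X' x : Finset G.E, x ⊆ K →
        (symmDiff X' x ∩ (K ∪ D)).card = (symmDiff X' x ∩ K).card + (X' ∩ D).card := by
      intro X' x hx
      rw [Finset.inter_union_distrib_left, Finset.card_union_of_disjoint,
        symmDiff_inter_of_disjoint (Finset.disjoint_of_subset_left hx hKD)]
      exact Finset.disjoint_of_subset_left Finset.inter_subset_right
        (Finset.disjoint_of_subset_right Finset.inter_subset_right hKD)
    have hsS : Disjoint s S := Finset.disjoint_of_subset_left hs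
      (Finset.disjoint_of_subset_right s2 hKD)
    refine ⟨symmDiff A' a, symmDiff B' b, s ∪ S, a1.symmDiff (hev a ha'), b1.symmDiff (hev b hb'),
      (hev s hs').union_of_disjoint s1 hsS, hout A A' a ha a2, hout B B' b hb b2,
      Finset.union_subset_union hs s2, ?_, ?_⟩
    · refine Finset.union_subset (hcovK.trans ?_) fun e he => ?_
      · exact Finset.union_subset_union le_rfl Finset.subset_union_left
      · have heK := Finset.disjoint_right.1 hKD he
        have hea : e ∉ a := fun h => heK (ha h)
        have heb : e ∉ b := fun h => heK (hb h)
        have := hcov he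
        rw [Finset.mem_union, Finset.mem_union] at this ⊢
        rcases this with (h | h) | h
        · exact Or.inl (Or.inl (Finset.mem_symmDiff.2 (Or.inl ⟨h, hea⟩)))
        · exact Or.inl (Or.inr (Finset.mem_symmDiff.2 (Or.inl ⟨h, heb⟩)))
        · exact Or.inr (Finset.mem_union_right _ h)
    · rw [hcin A' a ha, hcin B' b hb, Finset.card_union_of_disjoint hsS,
        Finset.card_insert_of_notMem hK𝒦, Finset.card_union_of_disjoint hKD]
      omega

/-- Of the seven bases formed by consecutive triples of the combinations of three sets, the
cheapest one has total size at most `12/7` of the size of the union. -/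
lemma exists_cheap_basis {A B C : Finset G.E} (hA : Ev A) (hB : Ev B) (hC : Ev C) :
    ∃ X Y Z, Ev X ∧ Ev Y ∧ Ev Z ∧ X ⊆ A ∪ B ∪ C ∧ Y ⊆ A ∪ B ∪ C ∧ Z ⊆ A ∪ B ∪ C ∧
      A ∪ B ∪ C ⊆ X ∪ Y ∪ Z ∧ 7 * (X.card + Y.card + Z.card) ≤ 12 * (A ∪ B ∪ C).card := by
  have sA : A ⊆ A ∪ B ∪ C := fun e he => by simp [he]
  have sB : B ⊆ A ∪ B ∪ C := fun e he => by simp [he]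
  have sC : C ⊆ A ∪ B ∪ C := fun e he => by simp [he]
  have sBC : symmDiff B C ⊆ A ∪ B ∪ C :=
    Finset.symmDiff_subset_union.trans (Finset.union_subset sB sC)
  have sAB : symmDiff A B ⊆ A ∪ B ∪ C :=
    Finset.symmDiff_subset_union.trans (Finset.union_subset sA sB)
  have sAC : symmDiff A C ⊆ A ∪ B ∪ C :=
    Finset.symmDiff_subset_union.trans (Finset.union_subset sA sC)
  have sABC : symmDiff (symmDiff A B) C ⊆ A ∪ B ∪ C :=
    Finset.symmDiff_subset_union.trans (Finset.union_subset sAB sC)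
  have hsum : A.card + B.card + C.card + (symmDiff B C).card + (symmDiff A B).card +
      (symmDiff A C).card + (symmDiff (symmDiff A B) C).card = 4 * (A ∪ B ∪ C).card := by
    rw [card_eq_sum_ite sA, card_eq_sum_ite sB, card_eq_sum_ite sC, card_eq_sum_ite sBC,
      card_eq_sum_ite sAB, card_eq_sum_ite sAC, card_eq_sum_ite sABC, Finset.card_eq_sum_ones,
      Finset.mul_sum, ← Finset.sum_add_distrib, ← Finset.sum_add_distrib, ← Finset.sum_add_distrib,
      ← Finset.sum_add_distrib, ← Finset.sum_add_distrib, ← Finset.sum_add_distrib]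
    refine Finset.sum_congr rfl fun e he => ?_
    rw [Finset.mem_union, Finset.mem_union] at he
    by_cases h1 : e ∈ A <;> by_cases h2 : e ∈ B <;> by_cases h3 : e ∈ C <;>
      simp only [h1, h2, h3, or_self] at he <;> simp [Finset.mem_symmDiff, h1, h2, h3]
  have hcov : ∀ X Y Z : Finset G.E, (∀ e, e ∉ X → e ∉ Y → e ∉ Z → e ∉ A ∧ e ∉ B ∧ e ∉ C) →
      A ∪ B ∪ C ⊆ X ∪ Y ∪ Z := by
    intro X Y Z h e he
    by_contra hne
    rw [Finset.mem_union, Finset.mem_union, not_or, not_or] at hne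
    obtain ⟨h1, h2, h3⟩ := h e hne.1.1 hne.1.2 hne.2
    simp [h1, h2, h3] at he
  have arith : 7 * (C.card + B.card + A.card) ≤ 12 * (A ∪ B ∪ C).card ∨
      7 * (B.card + A.card + (symmDiff B C).card) ≤ 12 * (A ∪ B ∪ C).card ∨
      7 * (A.card + (symmDiff B C).card + (symmDiff A B).card) ≤ 12 * (A ∪ B ∪ C).card ∨
      7 * ((symmDiff B C).card + (symmDiff A B).card + (symmDiff (symmDiff A B) C).card) ≤
        12 * (A ∪ B ∪ C).card ∨
      7 * ((symmDiff A B).card + (symmDiff (symmDiff A B) C).card + (symmDiff A C).card) ≤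
        12 * (A ∪ B ∪ C).card ∨
      7 * ((symmDiff (symmDiff A B) C).card + (symmDiff A C).card + C.card) ≤
        12 * (A ∪ B ∪ C).card ∨
      7 * ((symmDiff A C).card + C.card + B.card) ≤ 12 * (A ∪ B ∪ C).card := by
    omega
  have eBC := hB.symmDiff hC
  have eAB := hA.symmDiff hB
  have eAC := hA.symmDiff hC
  have eABC := eAB.symmDiff hC
  rcases arith with h | h | h | h | h | h | h
  · refine ⟨_, _, _, hC, hB, hA, sC, sB, sA, hcov _ _ _ fun e => ?_, h⟩
    exact fun h1 h2 h3 => ⟨h3, h2, h1⟩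
  · refine ⟨_, _, _, hB, hA, eBC, sB, sA, sBC, hcov _ _ _ fun e => ?_, h⟩
    by_cases h1 : e ∈ A <;> by_cases h2 : e ∈ B <;> by_cases h3 : e ∈ C <;>
      simp [Finset.mem_symmDiff, h1, h2, h3]
  · refine ⟨_, _, _, hA, eBC, eAB, sA, sBC, sAB, hcov _ _ _ fun e => ?_, h⟩
    by_cases h1 : e ∈ A <;> by_cases h2 : e ∈ B <;> by_cases h3 : e ∈ C <;>
      simp [Finset.mem_symmDiff, h1, h2, h3]
  · refine ⟨_, _, _, eBC, eAB, eABC, sBC, sAB, sABC, hcov _ _ _ fun e => ?_, h⟩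
    by_cases h1 : e ∈ A <;> by_cases h2 : e ∈ B <;> by_cases h3 : e ∈ C <;>
      simp [Finset.mem_symmDiff, h1, h2, h3]
  · refine ⟨_, _, _, eAB, eABC, eAC, sAB, sABC, sAC, hcov _ _ _ fun e => ?_, h⟩
    by_cases h1 : e ∈ A <;> by_cases h2 : e ∈ B <;> by_cases h3 : e ∈ C <;>
      simp [Finset.mem_symmDiff, h1, h2, h3]
  · refine ⟨_, _, _, eABC, eAC, hC, sABC, sAC, sC, hcov _ _ _ fun e => ?_, h⟩
    by_cases h1 : e ∈ A <;> by_cases h2 : e ∈ B <;> by_cases h3 : e ∈ C <;>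
      simp [Finset.mem_symmDiff, h1, h2, h3]
  · refine ⟨_, _, _, eAC, hC, hB, sAC, sC, sB, hcov _ _ _ fun e => ?_, h⟩
    by_cases h1 : e ∈ A <;> by_cases h2 : e ∈ B <;> by_cases h3 : e ∈ C <;>
      simp [Finset.mem_symmDiff, h1, h2, h3]

/-! ### Covering the positive edges that lie on positive circuits -/

lemma Ev.exists_family {Z : Finset G.E} (hZ : Ev Z) (hP : Z ⊆ G.PE) :
    ∃ F : Multiset (Finset G.E), (∀ S ∈ F, G.IsSignedCircuit S) ∧ (∀ e ∈ Z, Covers F e) ∧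
      G.coverLength F = Z.card := by
  obtain ⟨𝒞, h𝒞⟩ := hZ.exists_dec
  refine ⟨𝒞.val, fun K hK => Or.inl ⟨h𝒞.1 K hK, ?_⟩, fun e he => ?_, ?_⟩
  · rw [negEdges_eq_empty fun e he => mem_PE.1 (hP (h𝒞.subset hK he))]
    simp
  · obtain ⟨K, hK, heK⟩ := h𝒞.exists_mem he
    exact ⟨K, hK, heK⟩
  · rw [h𝒞.card_eq]
    rfl

lemma exists_family_three {X Y Z : Finset G.E} (hX : Ev X) (hY : Ev Y) (hZ : Ev Z)
    (sX : X ⊆ G.PE) (sY : Y ⊆ G.PE) (sZ : Z ⊆ G.PE) :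
    ∃ F : Multiset (Finset G.E), (∀ S ∈ F, G.IsSignedCircuit S) ∧
      (∀ e ∈ X ∪ Y ∪ Z, Covers F e) ∧ G.coverLength F = X.card + Y.card + Z.card := by
  obtain ⟨F₁, a1, b1, c1⟩ := hX.exists_family sX
  obtain ⟨F₂, a2, b2, c2⟩ := hY.exists_family sY
  obtain ⟨F₃, a3, b3, c3⟩ := hZ.exists_family sZ
  refine ⟨F₁ + F₂ + F₃, fun S hS => ?_, fun e he => ?_, ?_⟩
  · rw [Multiset.mem_add, Multiset.mem_add] at hS
    rcases hS with (h | h) | h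
    · exact a1 S h
    · exact a2 S h
    · exact a3 S h
  · rw [Finset.mem_union, Finset.mem_union] at he
    rcases he with (h | h) | h
    · exact (b1 e h).add_left.add_left
    · exact (b2 e h).add_right.add_left
    · exact (b3 e h).add_right
  · rw [coverLength_add, coverLength_add, c1, c2, c3]

lemma ev_biUnion {𝒦 : Finset (Finset G.E)} (hK : ∀ K ∈ 𝒦, Ev K)
    (hd : ∀ K ∈ 𝒦, ∀ K' ∈ 𝒦, K ≠ K' → Disjoint K K') : Ev (𝒦.biUnion id) := by
  induction 𝒦 using Finset.induction_on with
  | empty => exact ev_empty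
  | @insert K 𝒦 hK𝒦 ih =>
    rw [Finset.biUnion_insert]
    refine (hK K (Finset.mem_insert_self _ _)).union_of_disjoint
      (ih (fun K' h => hK K' (Finset.mem_insert_of_mem h)) fun K₁ h₁ K₂ h₂ =>
        hd K₁ (Finset.mem_insert_of_mem h₁) K₂ (Finset.mem_insert_of_mem h₂)) ?_
    rw [Finset.disjoint_biUnion_right]
    exact fun K' h => hd K (Finset.mem_insert_self _ _) K' (Finset.mem_insert_of_mem h)
      fun he => hK𝒦 (he ▸ h)

lemma card_biUnion_sdiff {𝒦 : Finset (Finset G.E)} {T : Finset G.E}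
    (hK : ∀ K ∈ 𝒦, (K \ T).card = 1)
    (hd : ∀ K ∈ 𝒦, ∀ K' ∈ 𝒦, K ≠ K' → Disjoint K K') : (𝒦.biUnion id \ T).card = 𝒦.card := by
  have : 𝒦.biUnion id \ T = 𝒦.biUnion fun K => K \ T := by
    ext e
    simp only [Finset.mem_sdiff, Finset.mem_biUnion, id]
    exact ⟨fun ⟨⟨K, h, h'⟩, h''⟩ => ⟨K, h, h', h''⟩, fun ⟨K, h, h', h''⟩ => ⟨⟨K, h, h'⟩, h''⟩⟩
  rw [this, Finset.card_biUnion, Finset.sum_congr rfl hK]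
  · simp
  · intro K h K' hK' hne
    exact Finset.disjoint_of_subset_left Finset.sdiff_subset
      (Finset.disjoint_of_subset_right Finset.sdiff_subset (hd K h K' hK' hne))

/-- One of the two sets `C₀`, `C₀ ∆ C` is small outside `D`. -/
lemma exists_small_companion {P T D C C₀ : Finset G.E} (hTP : T ⊆ P) (hC : Ev C) (hCP : C ⊆ P)
    (hC₀ : Ev C₀) (hC₀P : C₀ ⊆ P) (hcard : (C \ (T ∪ D)).card ≤ (T \ D).card) :
    ∃ B, Ev B ∧ B ⊆ P ∧ C ∪ C₀ ⊆ C ∪ B ∧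
      (C \ D).card + (B \ D).card ≤ ((P \ T) \ D).card + 2 * (T \ D).card := by
  have hsP : symmDiff C₀ C ⊆ P :=
    Finset.symmDiff_subset_union.trans (Finset.union_subset hC₀P hCP)
  have hkey : 2 * (C \ D).card + (C₀ \ D).card + (symmDiff C₀ C \ D).card ≤
      2 * ((P \ T) \ D).card + ((C \ T) \ D).card + 3 * (T \ D).card := by
    rw [card_sdiff_eq_sum hCP, card_sdiff_eq_sum hC₀P, card_sdiff_eq_sum hsP,
      card_sdiff_eq_sum Finset.sdiff_subset, card_sdiff_eq_sum (Finset.sdiff_subset.trans hCP),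
      card_sdiff_eq_sum hTP, Finset.mul_sum, Finset.mul_sum, Finset.mul_sum,
      ← Finset.sum_add_distrib, ← Finset.sum_add_distrib, ← Finset.sum_add_distrib,
      ← Finset.sum_add_distrib]
    refine Finset.sum_le_sum fun e he => ?_
    have heP := (Finset.mem_sdiff.1 he).1
    by_cases h1 : e ∈ T <;> by_cases h2 : e ∈ C <;> by_cases h3 : e ∈ C₀ <;>
      simp [Finset.mem_symmDiff, h1, h2, h3, heP]
  have hCT : (C \ T) \ D = C \ (T ∪ D) := by
    rw [← Finset.sup_eq_union, ← sdiff_sdiff_left]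
  rw [hCT] at hkey
  by_cases h : (C₀ \ D).card ≤ (symmDiff C₀ C \ D).card
  · exact ⟨C₀, hC₀, hC₀P, le_rfl, by omega⟩
  · refine ⟨symmDiff C₀ C, hC₀.symmDiff hC, hsP, fun e he => ?_, by omega⟩
    rw [Finset.mem_union] at he ⊢
    by_cases heC : e ∈ C
    · exact Or.inl heC
    · exact Or.inr (Finset.mem_symmDiff.2 (Or.inl ⟨he.resolve_left heC, heC⟩))

/-- A spanning forest `T` of the positive edges together with two covers of the core of the
positive edges. -/
theorem exists_core_cover [Nonempty G.V]
    (hreach : ∀ u v, G.Reach Finset.univ u v → G.Reach G.PE u v) :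
    ∃ T ⊆ G.PE, (∀ u v, G.Reach Finset.univ u v → G.Reach T u v) ∧
      T.card + 1 ≤ Fintype.card G.V ∧
      (∃ F : Multiset (Finset G.E), (∀ S ∈ F, G.IsSignedCircuit S) ∧
        (∀ e ∈ core G.PE, Covers F e) ∧
        3 * G.coverLength F ≤ 3 * (G.PE \ T).card + 7 * T.card) ∧
      ∃ F : Multiset (Finset G.E), (∀ S ∈ F, G.IsSignedCircuit S) ∧
        (∀ e ∈ core G.PE, Covers F e) ∧ 7 * G.coverLength F ≤ 12 * G.PE.card := by
  obtain ⟨T, 𝒦, C, hTP, hT, hTc, hK, hd, hC, hCP, hCc, hcore⟩ := exists_good_forest G.PE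
  have hT' : ∀ u v, G.Reach Finset.univ u v → G.Reach T u v := fun u v h => hT u v (hreach u v h)
  obtain ⟨C₀, hC₀, hC₀s, hC₀c⟩ := exists_fundamental hT' (G.PE \ T) Finset.sdiff_disjoint
  have hC₀P : C₀ ⊆ G.PE := hC₀s.trans (Finset.union_subset hTP Finset.sdiff_subset)
  obtain ⟨D, hD⟩ : ∃ D, D = 𝒦.biUnion id := ⟨_, rfl⟩
  have hDev : Ev D := hD ▸ ev_biUnion (fun K h => (hK K h).1.ev) hd
  have hDP : D ⊆ G.PE := by
    rw [hD, Finset.biUnion_subset]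
    exact fun K h => (hK K h).2.1
  have hDT : (D \ T).card = 𝒦.card := hD ▸ card_biUnion_sdiff (fun K h => (hK K h).2.2.1) hd
  have hcov : core G.PE ⊆ D ∪ C ∪ C₀ := by
    intro e he
    have heP := core_subset _ he
    rw [Finset.mem_union, Finset.mem_union, hD]
    by_cases heT : e ∈ T
    · rcases hcore e heT he with h | h | ⟨f, hf, hfT, hs⟩
      · exact Or.inl (Or.inl h)
      · exact Or.inl (Or.inr h)
      · exact Or.inr ((hs C₀ hC₀P hC₀).2 (hC₀c (Finset.mem_sdiff.2 ⟨hf, hfT⟩)))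
    · exact Or.inr (hC₀c (Finset.mem_sdiff.2 ⟨heP, heT⟩))
  refine ⟨T, hTP, hT', hTc, ?_, ?_⟩
  · obtain ⟨B, hB, hBP, hCB, hcard⟩ :=
      exists_small_companion (D := D) hTP hC hCP hC₀ hC₀P (hD ▸ hCc)
    obtain ⟨A', B', S, a1, b1, s1, a2, b2, s2, hc, hl⟩ :=
      exists_cover_circuits hC hB 𝒦 (fun K h => ⟨(hK K h).1, (hK K h).2.2.2⟩) hd
    rw [← hD] at a2 b2 s2 hc hl
    have hsub : ∀ X X' : Finset G.E, X' ⊆ G.PE → X \ D = X' \ D → X ⊆ G.PE := by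
      intro X X' hX' h e he
      by_cases heD : e ∈ D
      · exact hDP heD
      · have : e ∈ X \ D := Finset.mem_sdiff.2 ⟨he, heD⟩
        rw [h] at this
        exact hX' (Finset.mem_sdiff.1 this).1
    obtain ⟨F, f1, f2, f3⟩ := exists_family_three a1 b1 s1 (hsub _ _ hCP a2) (hsub _ _ hBP b2)
      (s2.trans hDP)
    refine ⟨F, f1, fun e he => f2 e ?_, ?_⟩
    · by_cases heD : e ∈ D
      · exact hc heD
      · have h1 := hcov he
        rw [Finset.union_assoc, Finset.mem_union] at h1
        have h2 := hCB (h1.resolve_left heD)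
        rw [Finset.mem_union] at h2
        refine Finset.mem_union_left _ (Finset.mem_union.2 (h2.imp (fun h => ?_) fun h => ?_))
        · have : e ∈ C \ D := Finset.mem_sdiff.2 ⟨h, heD⟩
          rw [← a2] at this
          exact (Finset.mem_sdiff.1 this).1
        · have : e ∈ B \ D := Finset.mem_sdiff.2 ⟨h, heD⟩
          rw [← b2] at this
          exact (Finset.mem_sdiff.1 this).1
    · have e1 := Finset.card_inter_add_card_sdiff A' D
      have e2 := Finset.card_inter_add_card_sdiff B' D
      have e3 := Finset.card_inter_add_card_sdiff D T
      have e4 := Finset.card_inter_add_card_sdiff T D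
      have e5 := Finset.card_inter_add_card_sdiff (G.PE \ T) D
      have e6 : (G.PE \ T) ∩ D = D \ T := by
        ext e
        simp only [Finset.mem_inter, Finset.mem_sdiff]
        exact ⟨fun h => ⟨h.2, h.1.2⟩, fun h => ⟨⟨hDP h.1, h.2⟩, h.1⟩⟩
      rw [a2] at e1
      rw [b2] at e2
      rw [Finset.inter_comm] at e4
      rw [e6] at e5
      omega
  · obtain ⟨X, Y, Z, x1, y1, z1, x2, y2, z2, hc, hl⟩ := exists_cheap_basis hDev hC hC₀
    have hs : D ∪ C ∪ C₀ ⊆ G.PE := Finset.union_subset (Finset.union_subset hDP hCP) hC₀P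
    obtain ⟨F, f1, f2, f3⟩ := exists_family_three x1 y1 z1 (x2.trans hs) (y2.trans hs)
      (z2.trans hs)
    refine ⟨F, f1, fun e he => f2 e (hc (hcov he)), ?_⟩
    have := Finset.card_le_card hs
    omega

/-! ### Signatures with as few negative edges as possible across every cut -/

lemma reach_PE (hcut : ∀ U, 2 * (G.boundary G.NE U).card ≤ (G.boundary Finset.univ U).card)
    {u v : G.V} (h : G.Reach Finset.univ u v) : G.Reach G.PE u v := by
  have hbd := boundary_comp G.PE u
  have hneg : G.boundary Finset.univ (comp G.PE u) ⊆ G.boundary G.NE (comp G.PE u) := by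
    intro e he
    refine mem_boundary.2 ⟨(mem_PE_or_NE e).resolve_left fun h' => ?_, (mem_boundary.1 he).2⟩
    have : e ∈ G.boundary G.PE (comp G.PE u) := mem_boundary.2 ⟨h', (mem_boundary.1 he).2⟩
    rw [hbd] at this
    exact absurd this (Finset.notMem_empty _)
  have h0 : G.boundary Finset.univ (comp G.PE u) = ∅ := by
    have h1 := Finset.card_le_card hneg
    have h2 := hcut (comp G.PE u)
    exact Finset.card_eq_zero.1 (by omega)
  exact mem_comp.1 (h.mem_of_boundary h0 (mem_comp.2 (Reach.refl _ _)))

lemma boundary_univ_eq (U : Finset G.V) :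
    G.boundary Finset.univ U = G.boundary G.PE U ∪ G.boundary G.NE U := by
  ext e
  rw [Finset.mem_union, mem_boundary, mem_boundary, mem_boundary, ← or_and_right]
  exact and_congr_left fun _ => ⟨fun _ => mem_PE_or_NE e, fun _ => Finset.mem_univ e⟩

/-- A positive edge on no positive circuit is a bridge, or forms a cut with one negative edge. -/
lemma cut_of_notMem_core
    (hcut : ∀ U, 2 * (G.boundary G.NE U).card ≤ (G.boundary Finset.univ U).card)
    {b : G.E} (hb : b ∈ G.PE) (hc : b ∉ core G.PE) :
    ∃ U, G.boundary Finset.univ U = {b} ∨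
      ∃ e ∈ G.NE, b ≠ e ∧ G.boundary Finset.univ U = {b, e} := by
  rcases exists_circuit_or_cut hb with ⟨K, hKP, hK, hbK⟩ | ⟨U, hU⟩
  · exact absurd (hK.ev.subset_core hKP hbK) hc
  · have h1 := boundary_univ_eq U
    have h2 := hcut U
    have hdis : Disjoint (G.boundary G.PE U) (G.boundary G.NE U) :=
      (disjoint_NE_PE (boundary_subset _ _) (boundary_subset _ _)).symm
    rw [h1, Finset.card_union_of_disjoint hdis, hU, Finset.card_singleton] at h2
    rw [hU] at h1 hdis
    refine ⟨U, ?_⟩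
    rcases Nat.lt_or_ge (G.boundary G.NE U).card 1 with h | h
    · rw [Nat.lt_one_iff, Finset.card_eq_zero] at h
      rw [h, Finset.union_empty] at h1
      exact Or.inl h1
    · obtain ⟨e, he⟩ := Finset.card_eq_one.1 (by omega : (G.boundary G.NE U).card = 1)
      rw [he] at h1 hdis
      have heN : e ∈ G.NE := boundary_subset G.NE U (he ▸ Finset.mem_singleton_self e)
      exact Or.inr ⟨e, heN, by simpa using hdis, h1⟩

theorem exists_cover_of_cut (hG : G.SBridgeless)
    (hcut : ∀ U, 2 * (G.boundary G.NE U).card ≤ (G.boundary Finset.univ U).card)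
    (hne : 0 < G.NE.card) :
    (∃ F, G.IsSignedCircuitCover F ∧ 3 * G.coverLength F + 21 ≤
      5 * Fintype.card G.E + 9 * Fintype.card G.V + 4 * G.NE.card) ∧
    ∃ F, G.IsSignedCircuitCover F ∧ G.coverLength F + 8 ≤
      Fintype.card G.E + 4 * Fintype.card G.V + 2 * G.NE.card := by
  obtain ⟨e, he⟩ := Finset.card_pos.1 hne
  have hε : 2 ≤ G.NE.card := by
    obtain ⟨S, hS, heS⟩ := hG e
    obtain ⟨f, -, hf, hfe⟩ := hS.two_neg heS he
    exact Finset.one_lt_card.2 ⟨f, hf, e, he, hfe⟩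
  have : Nonempty G.V := by
    obtain ⟨x, -, -⟩ := exists_ends e
    exact ⟨x⟩
  obtain ⟨T, hTP, hT, hTc, ⟨A₁, a1, c1, l1⟩, A₂, a2, c2, l2⟩ :=
    exists_core_cover fun u v h => reach_PE hcut h
  obtain ⟨S₁, S₂, hS, hpar, hbr⟩ := exists_split hG hcut
  obtain ⟨F, f1, f2, f3, f4, f5⟩ := exists_two_passes hT hTP hS hε hpar
  have hcover : ∀ A : Multiset (Finset G.E), (∀ S ∈ A, G.IsSignedCircuit S) →
      (∀ e ∈ core G.PE, Covers A e) → G.IsSignedCircuitCover (A + F) := by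
    intro A hA hA'
    refine ⟨fun S hS => (Multiset.mem_add.1 hS).elim (hA S) (f1 S), fun b => ?_⟩
    have hcov : Covers (A + F) b := by
      rcases mem_PE_or_NE b with hb | hb
      · by_cases hbc : b ∈ core G.PE
        · exact (hA' b hbc).add_left
        · obtain ⟨U, hU | ⟨g, hg, hbg, hU⟩⟩ := cut_of_notMem_core hcut hb hbc
          · exact (f4 b U hU (hbr b U hU)).add_right
          · exact (f3 b g U hU hbg hg).add_right
      · exact (f2 b hb).add_right
    obtain ⟨S, hS, hbS⟩ := hcov
    exact Multiset.card_pos_iff_exists_mem.2 ⟨S, Multiset.mem_filter.2 ⟨hS, hbS⟩⟩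
  have hE : G.PE.card + G.NE.card = Fintype.card G.E := by
    rw [← Finset.card_union_of_disjoint (disjoint_NE_PE le_rfl le_rfl).symm, ← Finset.card_univ]
    congr 1
    ext b
    simpa using mem_PE_or_NE b
  have hP := Finset.card_sdiff_add_card_eq_card hTP
  refine ⟨?_, A₁ + F, hcover A₁ a1 c1, ?_⟩
  · by_cases hk : T.card ≤ 2 * (G.PE \ T).card
    · refine ⟨A₁ + F, hcover A₁ a1 c1, ?_⟩
      rw [coverLength_add]
      omega
    · refine ⟨A₂ + F, hcover A₂ a2 c2, ?_⟩
      rw [coverLength_add]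
      omega
  · rw [coverLength_add]
    omega

/-! ### Switching -/

/-- The signed graph obtained from `G` by switching at the vertices of `A`. -/
def switch (G : SignedMultigraph) (A : Finset G.V) : SignedMultigraph where
  V := G.V
  E := G.E
  ends := G.ends
  neg := G.negAfter A

lemma filter_negAfter (A : Finset G.V) (S : Finset G.E) :
    (S.filter fun e => G.negAfter A e = true) = symmDiff (G.negEdges S) (G.boundary S A) := by
  ext e
  rw [Finset.mem_symmDiff, mem_boundary, negEdges, Finset.mem_filter, Finset.mem_filter, negAfter]
  cases G.neg e <;> cases G.crossesB A e <;> simp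

lemma negAfter_symmDiff (A U : Finset G.V) (e : G.E) :
    G.negAfter (symmDiff A U) e = Bool.xor (G.negAfter A e) (G.crossesB U e) := by
  obtain ⟨x, y, h⟩ := exists_ends e
  rw [negAfter, negAfter, crossesB_of_ends h, crossesB_of_ends h, crossesB_of_ends h]
  by_cases h1 : x ∈ A <;> by_cases h2 : x ∈ U <;> by_cases h3 : y ∈ A <;>
    by_cases h4 : y ∈ U <;> simp [Finset.mem_symmDiff, h1, h2, h3, h4]

lemma isUnbalancedCircuit_switch (A : Finset G.V) (S : Finset G.E) :
    (G.switch A).IsUnbalancedCircuit S ↔ G.IsUnbalancedCircuit S := by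
  refine and_congr_right fun (hS : G.IsCircuit S) => not_congr ?_
  change Even (S.filter fun e => G.negAfter A e = true).card ↔ _
  rw [filter_negAfter, ← ZMod.natCast_eq_zero_iff_even, card_symmDiff_zmod,
    (ZMod.natCast_eq_zero_iff_even).2 (hS.ev.boundary_card A), add_zero,
    ZMod.natCast_eq_zero_iff_even]

lemma isBalancedCircuit_switch (A : Finset G.V) (S : Finset G.E) :
    (G.switch A).IsBalancedCircuit S ↔ G.IsBalancedCircuit S := by
  have h := isUnbalancedCircuit_switch A S
  refine and_congr_right fun (hS : G.IsCircuit S) => not_iff_not.1 ?_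
  exact ⟨fun h' => (h.1 ⟨hS, h'⟩).2, fun h' => (h.2 ⟨hS, h'⟩).2⟩

lemma isSignedCircuit_switch (A : Finset G.V) (S : Finset G.E) :
    (G.switch A).IsSignedCircuit S ↔ G.IsSignedCircuit S := by
  have h := isUnbalancedCircuit_switch (G := G) A
  refine or_congr (isBalancedCircuit_switch A S) (or_congr ?_ ?_)
  · exact exists_congr fun C₁ => exists_congr fun C₂ =>
      and_congr (h C₁) (and_congr (h C₂) Iff.rfl)
  · exact exists_congr fun C₁ => exists_congr fun C₂ => exists_congr fun P => exists_congr fun u =>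
      exists_congr fun v => and_congr (h C₁) (and_congr (h C₂) Iff.rfl)

/-- Some switching realises the negativeness; in it every cut has at most half of its edges
negative. -/
lemma exists_min_switch (G : SignedMultigraph) : ∃ A : Finset G.V,
    (G.switch A).NE.card = G.negativeness ∧
    ∀ U, 2 * ((G.switch A).boundary (G.switch A).NE U).card ≤
      ((G.switch A).boundary Finset.univ U).card := by
  have hne : { n | ∃ A : Finset G.V,
      (Finset.univ.filter fun e => G.negAfter A e = true).card = n }.Nonempty := ⟨_, ∅, rfl⟩
  obtain ⟨A, hA⟩ := Nat.sInf_mem hne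
  refine ⟨A, hA, fun (U : Finset G.V) => ?_⟩
  obtain ⟨N, hN⟩ : ∃ N, N = Finset.univ.filter fun e => G.negAfter A e = true := ⟨_, rfl⟩
  change 2 * (G.boundary (Finset.univ.filter fun e => G.negAfter A e = true) U).card ≤
    (G.boundary Finset.univ U).card
  rw [← hN] at hA ⊢
  have hmin : N.card ≤ (symmDiff N (G.boundary Finset.univ U)).card := by
    refine hA.trans_le (Nat.sInf_le ⟨symmDiff A U, ?_⟩)
    congr 1
    ext e
    rw [Finset.mem_symmDiff, mem_boundary, hN, Finset.mem_filter, Finset.mem_filter,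
      negAfter_symmDiff]
    cases G.negAfter A e <;> cases G.crossesB U e <;> simp
  have hint : G.boundary N U = N ∩ G.boundary Finset.univ U := by
    ext e
    rw [Finset.mem_inter, mem_boundary, mem_boundary]
    simp
  have hcard := card_symmDiff_add N (G.boundary Finset.univ U)
  rw [hint]
  omega

lemma scc_le {F : Multiset (Finset G.E)} (hF : G.IsSignedCircuitCover F) :
    G.SCC ≤ G.coverLength F := Nat.sInf_le ⟨F, hF, rfl⟩

end SignedMultigraph

/-- Let `G` be an s-bridgeless signed graph with negativeness
`ε_N(G) > 0`, vertex set `V` and edge set `E`. Then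
`SCC(G) ≤ |E| + 3|V| + min{(2/3)|E| + (4/3)ε_N(G) − 7, |V| + 2ε_N(G) − 8}`. -/
theorem scc_of_sBridgeless (G : SignedMultigraph) (hG : G.SBridgeless)
    (hneg : 0 < G.negativeness) :
    (G.SCC : ℝ) ≤ (Fintype.card G.E : ℝ) + 3 * (Fintype.card G.V : ℝ) +
      min ((2 / 3 : ℝ) * (Fintype.card G.E : ℝ) + (4 / 3 : ℝ) * (G.negativeness : ℝ) - 7)
        ((Fintype.card G.V : ℝ) + 2 * (G.negativeness : ℝ) - 8) := by
  obtain ⟨A, hA, hcut⟩ := SignedMultigraph.exists_min_switch G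
  have hG' : (G.switch A).SBridgeless := fun e =>
    (hG e).imp fun S hS => ⟨(SignedMultigraph.isSignedCircuit_switch A S).2 hS.1, hS.2⟩
  obtain ⟨⟨F, hF, hl⟩, F', hF', hl'⟩ := SignedMultigraph.exists_cover_of_cut hG' hcut (hA ▸ hneg)
  rw [hA] at hl hl'
  have key : ∀ F : Multiset (Finset G.E), (G.switch A).IsSignedCircuitCover F →
      G.SCC ≤ G.coverLength F := fun F hF =>
    SignedMultigraph.scc_le ⟨fun S hS => (SignedMultigraph.isSignedCircuit_switch A S).1 (hF.1 S hS), hF.2⟩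
  have h₁ : 3 * G.SCC + 21 ≤ 5 * Fintype.card G.E + 9 * Fintype.card G.V + 4 * G.negativeness :=
    (Nat.add_le_add_right (Nat.mul_le_mul_left 3 (key F hF)) 21).trans hl
  have h₂ : G.SCC + 8 ≤ Fintype.card G.E + 4 * Fintype.card G.V + 2 * G.negativeness :=
    (Nat.add_le_add_right (key F' hF') 8).trans hl'
  have h₁' : (3 * G.SCC + 21 : ℝ) ≤
      5 * Fintype.card G.E + 9 * Fintype.card G.V + 4 * G.negativeness := by exact_mod_cast h₁
  have h₂' : (G.SCC + 8 : ℝ) ≤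
      Fintype.card G.E + 4 * Fintype.card G.V + 2 * G.negativeness := by exact_mod_cast h₂
  rw [← sub_le_iff_le_add', le_min_iff]
  constructor <;> linarith
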